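/- Suppose each receiver of a discrete memoryless interference channel has side information correlated with the interfering source: Receiver 1 observes V_2^n and Receiver 2 observes V_1^n. The sources U1 and U2 can be transmitted reliably if there exist a finite-valued random variable Q and finite-valued auxiliary random variables Wbar1, Wtilde1, Wbar2, Wtilde2 with joint distribution p(q,u1,v1,u2,v2,wbar1,wbar2,wtilde1,wtilde2,x1,x2,y1,y2) = p(q) p(u1,v1) p(wbar1|u1,q) p(u2,v2) p(wbar2|u2,q) p(wtilde1,x1|q) p(wtilde2,x2|q) p(y1,y2|x1,x2) such that all of the following strict inequalities hold: H(U1) < I(X1; Y1 | Wtilde2,Q); H(U1) + I(Wbar2; U2 | V2,Q) < I(X1,Wtilde2; Y1 | Q); H(U2) < I(X2; Y2 | Wtilde1,Q); H(U2) + I(Wbar1; U1 | V1,Q) < I(X2,Wtilde1; Y2 | Q); H(U1)+H(U2) - I(Wbar1;V1|Q) < I(X1; Y1 | Wtilde1,Wtilde2,Q) + I(Wtilde1,X2; Y2 | Q); H(U1)+H(U2) - I(Wbar2;V2|Q) < I(X2; Y2 | Wtilde1,Wtilde2,Q) + I(Wtilde2,X1; Y1 | Q); H(U1)+H(U2) -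 I(Wbar1;V1|Q) - I(Wbar2;V2|Q) < I(Wtilde1,X2; Y2 | Wtilde2,Q) + I(Wtilde2,X1; Y1 | Wtilde1,Q); H(U1)+H(U2) + I(Wbar1;U1|V1,Q) - I(Wbar2;V2|Q) < I(Wtilde2,X1; Y1 | Q) + I(Wtilde1,X2; Y2 | Wtilde2,Q); H(U1)+H(U2) + I(Wbar2;U2|V2,Q) - I(Wbar1;V1|Q) < I(Wtilde1,X2; Y2 | Q) + I(Wtilde2,X1; Y1 | Wtilde1,Q); 2H(U1)+H(U2) - I(Wbar1;V1|Q) - I(Wbar2;V2|Q) < I(Wtilde2,X1; Y1 | Q) + I(X1; Y1 | Wtilde1,Wtilde2,Q) + I(Wtilde1,X2; Y2 | Wtilde2,Q); H(U1)+2H(U2) - I(Wbar1;V1|Q) - I(Wbar2;V2|Q) < I(Wtilde1,X2; Y2 | Q) + I(X2; Y2 | Wtilde2,Wtilde1,Q) + I(Wtilde2,X1; Y1 | Wtilde1,Q). -/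

import Mathlib

open Finset Real Filter
open scoped Classical

namespace Paper

/-- `p` is a probability mass function on the finite type `α`. -/
def IsPMF {α : Type*} [Fintype α] (p : α → ℝ) : Prop :=
  (∀ a, 0 ≤ p a) ∧ ∑ a, p a = 1

/-- `k` is a transition probability (channel) from `α` to the finite type `β`. -/
def IsKernel {α β : Type*} [Fintype β] (k : α → β → ℝ) : Prop :=
  ∀ a, IsPMF (k a)

variable {Ω : Type*} [Fintype Ω]

/-- Probability that the random variable `X` takes the value `x`, under the weight `p`. -/
noncomputable def pr {α : Type*} (p : Ω → ℝ) (X : Ω → α) (x : α) : ℝ :=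
  ∑ ω, if X ω = x then p ω else 0

/-- Shannon entropy (base 2) of the random variable `X` under `p`. -/
noncomputable def ent {α : Type*} [Fintype α] (p : Ω → ℝ) (X : Ω → α) : ℝ :=
  ∑ x, -(pr p X x * Real.logb 2 (pr p X x))

/-- Conditional entropy `H(X|Y) = H(X,Y) - H(Y)`. -/
noncomputable def condEnt {α β : Type*} [Fintype α] [Fintype β]
    (p : Ω → ℝ) (X : Ω → α) (Y : Ω → β) : ℝ :=
  ent p (fun ω => (X ω, Y ω)) - ent p Y

/-- Mutual information `I(X;Y) = H(X) + H(Y) - H(X,Y)`. -/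
noncomputable def mi {α β : Type*} [Fintype α] [Fintype β]
    (p : Ω → ℝ) (X : Ω → α) (Y : Ω → β) : ℝ :=
  ent p X + ent p Y - ent p (fun ω => (X ω, Y ω))

/-- Conditional mutual information `I(X;Y|Z) = H(X,Z) + H(Y,Z) - H(X,Y,Z) - H(Z)`. -/
noncomputable def cmi {α β γ : Type*} [Fintype α] [Fintype β] [Fintype γ]
    (p : Ω → ℝ) (X : Ω → α) (Y : Ω → β) (Z : Ω → γ) : ℝ :=
  ent p (fun ω => (X ω, Z ω)) + ent p (fun ω => (Y ω, Z ω))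
    - ent p (fun ω => (X ω, Y ω, Z ω)) - ent p Z

/-- The Markov chain `A → B → C`: `A` and `C` are conditionally independent given `B`. -/
def MarkovChain {α β γ : Type*} (p : Ω → ℝ) (A : Ω → α) (B : Ω → β) (C : Ω → γ) : Prop :=
  ∀ a b c, pr p (fun ω => (A ω, B ω, C ω)) (a, b, c) * pr p B b =
    pr p (fun ω => (A ω, B ω)) (a, b) * pr p (fun ω => (B ω, C ω)) (b, c)

/-! ## Statement 2: sufficient conditions via operational separation
(side information correlated with the interfering source). -/

section Stmt2

variable {U1 V1 U2 V2 X1 X2 Y1 Y2 : Type}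
  [Fintype U1] [Fintype V1] [Fintype U2] [Fintype V2]
  [Fintype X1] [Fintype X2] [Fintype Y1] [Fintype Y2]

/-- Error probability of a length-`n` joint source-channel code, where Receiver 1
has side information `V_2^n` and Receiver 2 has side information `V_1^n`. -/
noncomputable def PerrCross (ch : X1 × X2 → Y1 × Y2 → ℝ)
    (q1 : U1 × V1 → ℝ) (q2 : U2 × V2 → ℝ) (n : ℕ)
    (f1 : (Fin n → U1) → Fin n → X1) (f2 : (Fin n → U2) → Fin n → X2)
    (g1 : (Fin n → Y1) → (Fin n → V2) → Fin n → U1)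
    (g2 : (Fin n → Y2) → (Fin n → V1) → Fin n → U2) : ℝ :=
  ∑ u1 : Fin n → U1, ∑ v1 : Fin n → V1, ∑ u2 : Fin n → U2, ∑ v2 : Fin n → V2,
    ∑ y : Fin n → Y1 × Y2,
      (∏ i, q1 (u1 i, v1 i)) * (∏ i, q2 (u2 i, v2 i)) *
      (∏ i, ch (f1 u1 i, f2 u2 i) (y i)) *
      (if g1 (fun i => (y i).1) v2 = u1 ∧ g2 (fun i => (y i).2) v1 = u2 then 0 else 1)

/-- The sources can be transmitted reliably (side information about the interfering source). -/
def ReliableCross (ch : X1 × X2 → Y1 × Y2 → ℝ)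
    (q1 : U1 × V1 → ℝ) (q2 : U2 × V2 → ℝ) : Prop :=
  ∃ (f1 : ∀ n : ℕ, (Fin n → U1) → Fin n → X1)
    (f2 : ∀ n : ℕ, (Fin n → U2) → Fin n → X2)
    (g1 : ∀ n : ℕ, (Fin n → Y1) → (Fin n → V2) → Fin n → U1)
    (g2 : ∀ n : ℕ, (Fin n → Y2) → (Fin n → V1) → Fin n → U2),
    Tendsto (fun n => PerrCross ch q1 q2 n (f1 n) (f2 n) (g1 n) (g2 n)) atTop (nhds 0)

/-- Sample space carrying `(Q, U1, V1, Wbar1, U2, V2, Wbar2, Wtilde1, X1, Wtilde2, X2, Y1, Y2)`. -/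
abbrev OmSep (mQ mB1 mB2 mT1 mT2 : ℕ) (U1 V1 U2 V2 X1 X2 Y1 Y2 : Type) : Type :=
  Fin mQ × U1 × V1 × Fin mB1 × U2 × V2 × Fin mB2 × Fin mT1 × X1 × Fin mT2 × X2 × Y1 × Y2

variable {mQ mB1 mB2 mT1 mT2 : ℕ}

/-- The joint single-letter law
`p(q) p(u1,v1) p(wbar1|u1,q) p(u2,v2) p(wbar2|u2,q) p(wtilde1,x1|q) p(wtilde2,x2|q)
 p(y1,y2|x1,x2)`. -/
noncomputable def jointSep (ch : X1 × X2 → Y1 × Y2 → ℝ)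
    (q1 : U1 × V1 → ℝ) (q2 : U2 × V2 → ℝ)
    (pQ : Fin mQ → ℝ) (kb1 : U1 → Fin mQ → Fin mB1 → ℝ) (kb2 : U2 → Fin mQ → Fin mB2 → ℝ)
    (kt1 : Fin mQ → Fin mT1 × X1 → ℝ) (kt2 : Fin mQ → Fin mT2 × X2 → ℝ) :
    OmSep mQ mB1 mB2 mT1 mT2 U1 V1 U2 V2 X1 X2 Y1 Y2 → ℝ :=
  fun (q, u1, v1, b1, u2, v2, b2, t1, x1, t2, x2, y1, y2) =>
    pQ q * q1 (u1, v1) * kb1 u1 q b1 * q2 (u2, v2) * kb2 u2 q b2 *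
      kt1 q (t1, x1) * kt2 q (t2, x2) * ch (x1, x2) (y1, y2)

section Proj
variable {mQ mB1 mB2 mT1 mT2 : ℕ} {U1 V1 U2 V2 X1 X2 Y1 Y2 : Type}

def sQ : OmSep mQ mB1 mB2 mT1 mT2 U1 V1 U2 V2 X1 X2 Y1 Y2 → Fin mQ := fun ω => ω.1
def sU1 : OmSep mQ mB1 mB2 mT1 mT2 U1 V1 U2 V2 X1 X2 Y1 Y2 → U1 := fun ω => ω.2.1
def sV1 : OmSep mQ mB1 mB2 mT1 mT2 U1 V1 U2 V2 X1 X2 Y1 Y2 → V1 := fun ω => ω.2.2.1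
def sB1 : OmSep mQ mB1 mB2 mT1 mT2 U1 V1 U2 V2 X1 X2 Y1 Y2 → Fin mB1 := fun ω => ω.2.2.2.1
def sU2 : OmSep mQ mB1 mB2 mT1 mT2 U1 V1 U2 V2 X1 X2 Y1 Y2 → U2 := fun ω => ω.2.2.2.2.1
def sV2 : OmSep mQ mB1 mB2 mT1 mT2 U1 V1 U2 V2 X1 X2 Y1 Y2 → V2 := fun ω => ω.2.2.2.2.2.1
def sB2 : OmSep mQ mB1 mB2 mT1 mT2 U1 V1 U2 V2 X1 X2 Y1 Y2 → Fin mB2 := fun ω => ω.2.2.2.2.2.2.1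
def sT1 : OmSep mQ mB1 mB2 mT1 mT2 U1 V1 U2 V2 X1 X2 Y1 Y2 → Fin mT1 := fun ω => ω.2.2.2.2.2.2.2.1
def sX1 : OmSep mQ mB1 mB2 mT1 mT2 U1 V1 U2 V2 X1 X2 Y1 Y2 → X1 := fun ω => ω.2.2.2.2.2.2.2.2.1
def sT2 : OmSep mQ mB1 mB2 mT1 mT2 U1 V1 U2 V2 X1 X2 Y1 Y2 → Fin mT2 := fun ω => ω.2.2.2.2.2.2.2.2.2.1
def sX2 : OmSep mQ mB1 mB2 mT1 mT2 U1 V1 U2 V2 X1 X2 Y1 Y2 → X2 := fun ω => ω.2.2.2.2.2.2.2.2.2.2.1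
def sY1 : OmSep mQ mB1 mB2 mT1 mT2 U1 V1 U2 V2 X1 X2 Y1 Y2 → Y1 := fun ω => ω.2.2.2.2.2.2.2.2.2.2.2.1
def sY2 : OmSep mQ mB1 mB2 mT1 mT2 U1 V1 U2 V2 X1 X2 Y1 Y2 → Y2 := fun ω => ω.2.2.2.2.2.2.2.2.2.2.2.2
end Proj

/-! ### Product expectations -/

theorem prodsum {ι α : Type*} [Fintype ι] [DecidableEq ι] [Fintype α] (p : ι → α → ℝ) :
    ∑ f : ι → α, ∏ i, p i (f i) = ∏ i, ∑ a, p i a := by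
  rw [Finset.prod_univ_sum, Fintype.piFinset_univ]

theorem E0 {ι α : Type*} [Fintype ι] [DecidableEq ι] [Fintype α] (p : ι → α → ℝ)
    (hp : ∀ i, ∑ a, p i a = 1) : ∑ f : ι → α, ∏ i, p i (f i) = 1 := by
  rw [prodsum]; simp [hp]

theorem E1 {ι α : Type*} [Fintype ι] [DecidableEq ι] [Fintype α] (p : ι → α → ℝ)
    (hp : ∀ i, ∑ a, p i a = 1) (i0 : ι) (g : α → ℝ) :
    ∑ f : ι → α, (∏ i, p i (f i)) * g (f i0) = ∑ a, p i0 a * g a := by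
  have h : ∀ f : ι → α, (∏ i, p i (f i)) * g (f i0)
      = ∏ i, (p i (f i) * (if i = i0 then g (f i) else 1)) := by
    intro f
    rw [Finset.prod_mul_distrib]
    congr 1
    simp [Finset.prod_ite_eq']
  simp_rw [h]
  rw [prodsum (fun i a => p i a * (if i = i0 then g a else 1)),
    Finset.prod_eq_single i0]
  · simp
  · intro b _ hb
    simp [hb, hp]
  · simp

theorem E2 {ι α : Type*} [Fintype ι] [DecidableEq ι] [Fintype α] (p : ι → α → ℝ)
    (hp : ∀ i, ∑ a, p i a = 1) (i j : ι) (hij : i ≠ j) (g : α → α → ℝ) :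
    ∑ f : ι → α, (∏ k, p k (f k)) * g (f i) (f j)
      = ∑ a, ∑ b, p i a * p j b * g a b := by
  have h : ∀ f : ι → α, (∏ k, p k (f k)) * g (f i) (f j)
      = ∑ a, ∑ b, g a b * ∏ k, (p k (f k) * ((if k = i then (if f k = a then 1 else 0) else 1)
          * (if k = j then (if f k = b then 1 else 0) else 1))) := by
    intro f
    simp only [Finset.prod_mul_distrib]
    simp [Finset.prod_ite_eq', mul_comm]
  simp_rw [h]
  rw [Finset.sum_comm]
  refine Finset.sum_congr rfl fun a _ => ?_
  rw [Finset.sum_comm]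
  refine Finset.sum_congr rfl fun b _ => ?_
  rw [← Finset.mul_sum, prodsum (fun k c => p k c * ((if k = i then (if c = a then 1 else 0) else 1)
          * (if k = j then (if c = b then 1 else 0) else 1))),
    Finset.prod_eq_mul i j hij]
  · simp [hij, hij.symm]; ring
  · intro c _ hc
    simp [hc.1, hc.2, hp]
  · simp
  · simp

/-- Splitting a sum over vectors of pairs. -/
theorem sum_arrow_prod {ι A B : Type*} [Fintype ι] [DecidableEq ι] [Fintype A] [Fintype B]
    (F : (ι → A × B) → ℝ) :
    ∑ w : ι → A × B, F w = ∑ a : ι → A, ∑ b : ι → B, F (fun i => (a i, b i)) := by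
  have h := Fintype.sum_prod_type' (f := fun (a : ι → A) (b : ι → B) => F (fun i => (a i, b i)))
  rw [← h]
  exact Fintype.sum_equiv (Equiv.arrowProdEquivProdArrow ι (fun _ => A) (fun _ => B)) _ _ (fun _ => rfl)

/-! ### Finitely supported expectations -/

/-- `E` is the expectation functional of a finitely supported probability distribution. -/
def IsExp {Ω : Type} (E : (Ω → ℝ) → ℝ) : Prop :=
  ∃ (ι : Type) (_ : Fintype ι) (w : ι → ℝ) (g : ι → Ω), (∀ i, 0 ≤ w i) ∧ ∑ i, w i = 1 ∧
    ∀ F, E F = ∑ i, w i * F (g i)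

theorem IsExp.add {Ω : Type} {E : (Ω → ℝ) → ℝ} (h : IsExp E) (F G : Ω → ℝ) :
    E (fun o => F o + G o) = E F + E G := by
  obtain ⟨ι, _, w, g, -, -, h⟩ := h
  simp only [h, mul_add, Finset.sum_add_distrib]

theorem IsExp.smul {Ω : Type} {E : (Ω → ℝ) → ℝ} (h : IsExp E) (c : ℝ) (F : Ω → ℝ) :
    E (fun o => c * F o) = c * E F := by
  obtain ⟨ι, _, w, g, -, -, h⟩ := h
  simp only [h, Finset.mul_sum]
  exact Finset.sum_congr rfl fun _ _ => by ring

theorem IsExp.sum {Ω κ : Type} {E : (Ω → ℝ) → ℝ} (h : IsExp E) (s : Finset κ) (F : κ → Ω → ℝ) :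
    E (fun o => ∑ k ∈ s, F k o) = ∑ k ∈ s, E (F k) := by
  obtain ⟨ι, _, w, g, -, -, h⟩ := h
  simp only [h, Finset.mul_sum]
  exact Finset.sum_comm

theorem IsExp.mono {Ω : Type} {E : (Ω → ℝ) → ℝ} (h : IsExp E) {F G : Ω → ℝ}
    (hFG : ∀ o, F o ≤ G o) : E F ≤ E G := by
  obtain ⟨ι, _, w, g, hw, -, h⟩ := h
  simp only [h]
  exact Finset.sum_le_sum fun i _ => mul_le_mul_of_nonneg_left (hFG _) (hw i)

theorem IsExp.const {Ω : Type} {E : (Ω → ℝ) → ℝ} (h : IsExp E) (c : ℝ) :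
    E (fun _ => c) = c := by
  obtain ⟨ι, _, w, g, hw, h1, h⟩ := h
  simp only [h, ← Finset.sum_mul, h1, one_mul]

theorem IsExp.nonneg {Ω : Type} {E : (Ω → ℝ) → ℝ} (h : IsExp E) {F : Ω → ℝ}
    (hF : ∀ o, 0 ≤ F o) : 0 ≤ E F := by
  have := h.mono hF
  rwa [h.const] at this

theorem IsExp.exists_le {Ω : Type} {E : (Ω → ℝ) → ℝ} (h : IsExp E) {F : Ω → ℝ} {c : ℝ}
    (hF : E F ≤ c) : ∃ o, F o ≤ c := by
  obtain ⟨ι, _, w, g, hw, h1, h⟩ := h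
  by_contra! hc
  rw [h] at hF
  have hex : ∃ i ∈ Finset.univ, 0 < w i := by
    by_contra! hh
    have : ∑ i, w i ≤ 0 := Finset.sum_nonpos hh
    linarith
  have : ∑ i, w i * c < ∑ i, w i * F (g i) := by
    obtain ⟨i, hi, hwi⟩ := hex
    exact Finset.sum_lt_sum (fun j _ => mul_le_mul_of_nonneg_left (hc _).le (hw j))
      ⟨i, hi, mul_lt_mul_of_pos_left (hc _) hwi⟩
  rw [← Finset.sum_mul, h1] at this
  linarith

theorem IsExp.comm {Ω Ω' : Type} {E : (Ω → ℝ) → ℝ} {E' : (Ω' → ℝ) → ℝ} (h : IsExp E)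
    (h' : IsExp E') (F : Ω → Ω' → ℝ) :
    E (fun o => E' (fun o' => F o o')) = E' (fun o' => E (fun o => F o o')) := by
  obtain ⟨ι, _, w, g, -, -, h⟩ := h
  simp only [h]
  rw [h'.sum]
  exact Finset.sum_congr rfl fun i _ => by rw [h'.smul]

theorem IsExp.bind {Ω Ω' Ω'' : Type} {E : (Ω → ℝ) → ℝ} {E' : (Ω' → ℝ) → ℝ} (h : IsExp E)
    (h' : IsExp E') (f : Ω → Ω' → Ω'') :
    IsExp (fun F => E (fun o => E' (fun o' => F (f o o')))) := by
  obtain ⟨ι, _, w, g, hw, h1, h⟩ := h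
  obtain ⟨ι', _, w', g', hw', h1', h'⟩ := h'
  refine ⟨ι × ι', inferInstance, fun i => w i.1 * w' i.2, fun i => f (g i.1) (g' i.2),
    fun i => mul_nonneg (hw _) (hw' _), ?_, fun F => ?_⟩
  · rw [Fintype.sum_prod_type]
    simp only [← Finset.mul_sum, h1', mul_one, h1]
  · beta_reduce
    rw [h, Fintype.sum_prod_type]
    simp only [h', Finset.mul_sum, mul_assoc]

theorem IsExp.map {Ω Ω' : Type} {E : (Ω → ℝ) → ℝ} (h : IsExp E) (f : Ω → Ω') :
    IsExp (fun F => E (fun o => F (f o))) := by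
  obtain ⟨ι, _, w, g, hw, h1, h⟩ := h
  exact ⟨ι, _, w, fun i => f (g i), hw, h1, fun F => by beta_reduce; rw [h]⟩

/-- Expectation over a random function with independent values. -/
noncomputable def ewt {ι α : Type} [Fintype ι] [DecidableEq ι] [Fintype α] (p : ι → α → ℝ)
    (F : (ι → α) → ℝ) : ℝ := ∑ f : ι → α, (∏ i, p i (f i)) * F f

theorem isExp_ewt {ι α : Type} [Fintype ι] [DecidableEq ι] [Fintype α] {p : ι → α → ℝ}
    (hp : ∀ i, IsPMF (p i)) : IsExp (ewt p) :=
  ⟨ι → α, inferInstance, fun f => ∏ i, p i (f i), id,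
    fun _ => Finset.prod_nonneg fun i _ => (hp i).1 _, E0 p fun i => (hp i).2, fun _ => rfl⟩

/-! ### One user of the one-shot problem -/

/-- Single-user data of the one-shot problem: auxiliary description law, backward source kernel,
side information kernel, and the two layer input law. -/
structure Usr (U V B T X : Type) [Fintype U] [Fintype V] [Fintype B] [Fintype T] [Fintype X] where
  pB : B → ℝ
  ku : B → U → ℝ
  kv : U → V → ℝ
  pT : T → ℝ
  kx : T → X → ℝ
  hB : IsPMF pB
  hu : ∀ b, IsPMF (ku b)
  hv : ∀ u, IsPMF (kv u)
  hT : IsPMF pT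
  hx : ∀ t, IsPMF (kx t)

section Usr
variable {U V B T X : Type} [Fintype U] [Fintype V] [Fintype B] [Fintype T] [Fintype X]

namespace Usr
noncomputable def pU (S : Usr U V B T X) (u : U) : ℝ := ∑ b, S.pB b * S.ku b u
noncomputable def pBV (S : Usr U V B T X) (b : B) (v : V) : ℝ :=
  ∑ u, S.pB b * S.ku b u * S.kv u v
noncomputable def pV (S : Usr U V B T X) (v : V) : ℝ := ∑ b, S.pBV b v
noncomputable def pX (S : Usr U V B T X) (x : X) : ℝ := ∑ t, S.pT t * S.kx t x

theorem pU_nonneg (S : Usr U V B T X) (u : U) : 0 ≤ S.pU u :=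
  Finset.sum_nonneg fun b _ => mul_nonneg (S.hB.1 _) ((S.hu b).1 _)
theorem pBV_nonneg (S : Usr U V B T X) (b : B) (v : V) : 0 ≤ S.pBV b v :=
  Finset.sum_nonneg fun u _ => mul_nonneg (mul_nonneg (S.hB.1 _) ((S.hu b).1 _)) ((S.hv u).1 _)
theorem pV_nonneg (S : Usr U V B T X) (v : V) : 0 ≤ S.pV v :=
  Finset.sum_nonneg fun b _ => S.pBV_nonneg b v
theorem pX_nonneg (S : Usr U V B T X) (x : X) : 0 ≤ S.pX x :=
  Finset.sum_nonneg fun b _ => mul_nonneg (S.hT.1 _) ((S.hx b).1 _)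

/-- Reference measure for false candidates of the decoder's own user. -/
noncomputable def Q1 (S : Usr U V B T X) (M N : ℕ) (b : B) (t : T) (x' x : X) : ℝ :=
  S.pB b * S.pT t * S.kx t x' * ((1 / (N : ℝ)) * S.kx t x + (1 + M) * S.pX x)

/-- Reference measure for candidates of the interfering user. -/
noncomputable def Q2 (S : Usr U V B T X) (M N : ℕ) (v : V) (b : B) (t : T) (x : X) : ℝ :=
  S.pT t * (S.pBV b v * S.kx t x + N * (S.pBV b v * S.pX x) +
    M * N * (S.pB b * S.pV v * S.pX x))

theorem Q1_nonneg (S : Usr U V B T X) (M N : ℕ) (b : B) (t : T) (x' x : X) :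
    0 ≤ S.Q1 M N b t x' x := by
  unfold Q1
  have h1 := S.hB.1 b
  have h2 := S.hT.1 t
  have h3 := (S.hx t).1 x
  have h3 := (S.hx t).1 x'
  have h4 := S.pX_nonneg x
  positivity

theorem Q2_nonneg (S : Usr U V B T X) (M N : ℕ) (v : V) (b : B) (t : T) (x : X) :
    0 ≤ S.Q2 M N v b t x := by
  unfold Q2
  have h1 := S.hB.1 b
  have h2 := S.hT.1 t
  have h3 := (S.hx t).1 x
  have h4 := S.pX_nonneg x
  have h5 := S.pBV_nonneg b v
  have h6 := S.pV_nonneg v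
  positivity
end Usr

/-- A codebook of one user. -/
structure CB (M N : ℕ) (U B T X : Type) where
  b : Fin M → B
  h : Fin M × U → Fin N
  t : Fin M × Fin N → T
  x : Fin M × U × T → X

def CB.tt {M N : ℕ} {U B T X : Type} (C : CB M N U B T X) (m : Fin M) (u : U) : T :=
  C.t (m, C.h (m, u))
def CB.xx {M N : ℕ} {U B T X : Type} (C : CB M N U B T X) (m : Fin M) (u : U) : X :=
  C.x (m, u, C.tt m u)

/-- Expectation over the random codebook. -/
noncomputable def Ecb (S : Usr U V B T X) (M N : ℕ) (F : CB M N U B T X → ℝ) : ℝ :=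
  ewt (fun _ : Fin M => S.pB) fun b =>
  ewt (fun (_ : Fin M × U) (_ : Fin N) => 1 / (N : ℝ)) fun h =>
  ewt (fun _ : Fin M × Fin N => S.pT) fun t =>
  ewt (fun (i : Fin M × U × T) => S.kx i.2.2) fun x => F ⟨b, h, t, x⟩

theorem unif_pmf {N : ℕ} (hN : 0 < N) : IsPMF (fun _ : Fin N => 1 / (N : ℝ)) :=
  ⟨fun _ => by positivity, by
    have : (N : ℝ) ≠ 0 := by positivity
    simp [this]⟩

theorem isExp_Ecb (S : Usr U V B T X) (M : ℕ) {N : ℕ} (hN : 0 < N) : IsExp (Ecb S M N) := by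
  have h1 : IsExp (ewt (fun _ : Fin M => S.pB)) := isExp_ewt fun _ => S.hB
  have h2 : IsExp (ewt (fun (_ : Fin M × U) (_ : Fin N) => 1 / (N : ℝ))) :=
    isExp_ewt fun _ => unif_pmf hN
  have h3 : IsExp (ewt (fun _ : Fin M × Fin N => S.pT)) := isExp_ewt fun _ => S.hT
  have h4 : IsExp (ewt (fun (i : Fin M × U × T) => S.kx i.2.2)) := isExp_ewt fun i => S.hx _
  have h34 := h3.bind h4 (fun t x => (t, x))
  have h234 := h2.bind h34 (fun h tx => (h, tx))
  exact h1.bind h234 (fun b htx => (⟨b, htx.1, htx.2.1, htx.2.2⟩ : CB M N U B T X))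

/-- Expectation of a function of one true triple. -/
theorem Ecb_true (S : Usr U V B T X) (M : ℕ) {N : ℕ} (hN : 0 < N) (m : Fin M) (u : U)
    (F : B → T → X → ℝ) :
    Ecb S M N (fun C => F (C.b m) (C.tt m u) (C.xx m u)) =
      ∑ b, ∑ t, ∑ x, S.pB b * S.pT t * S.kx t x * F b t x := by
  unfold Ecb CB.xx CB.tt
  have h4 : ∀ (b : Fin M → B) (h : Fin M × U → Fin N) (t : Fin M × Fin N → T),
      (ewt (fun (i : Fin M × U × T) => S.kx i.2.2) fun x =>
        F (b m) (t (m, h (m, u))) (x (m, u, t (m, h (m, u))))) =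
      ∑ x, S.kx (t (m, h (m, u))) x * F (b m) (t (m, h (m, u))) x := fun b h t =>
    E1 (fun (i : Fin M × U × T) => S.kx i.2.2) (fun i => (S.hx _).2) (m, u, t (m, h (m, u)))
      (fun x => F (b m) (t (m, h (m, u))) x)
  simp only [h4]
  have h3 : ∀ (b : Fin M → B) (h : Fin M × U → Fin N),
      (ewt (fun _ : Fin M × Fin N => S.pT) fun t =>
        ∑ x, S.kx (t (m, h (m, u))) x * F (b m) (t (m, h (m, u))) x) =
      ∑ t, S.pT t * ∑ x, S.kx t x * F (b m) t x := fun b h =>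
    E1 (fun _ : Fin M × Fin N => S.pT) (fun i => S.hT.2) (m, h (m, u))
      (fun t => ∑ x, S.kx t x * F (b m) t x)
  simp only [h3]
  have h2 : IsExp (ewt (fun (_ : Fin M × U) (_ : Fin N) => 1 / (N : ℝ))) :=
    isExp_ewt fun _ => unif_pmf hN
  simp only [h2.const]
  have h1 := E1 (fun _ : Fin M => S.pB) (fun i => S.hB.2) m
    (fun b => ∑ t, S.pT t * ∑ x, S.kx t x * F b t x)
  refine h1.trans ?_
  simp only [Finset.mul_sum, mul_assoc]

/-- Interfering user: expected sum over all candidates. -/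
theorem user2 (S : Usr U V B T X) {M N : ℕ} (hN : 0 < N) (m : Fin M) (v : V)
    (G : B → T → X → ℝ) (hG : ∀ b t x, 0 ≤ G b t x) :
    ∑ u, Ecb S M N (fun C => ∑ m', ∑ c',
      S.ku (C.b m) u * S.kv u v * G (C.b m') (C.t (m', c')) (C.xx m u)) ≤
    ∑ b, ∑ t, ∑ x, S.Q2 M N v b t x * G b t x := by
  have hkx := fun t => (S.hx t).1
  have hku := fun t => (S.hu t).1
  have hkv := fun t => (S.hv t).1
  have hpT := S.hT.1
  have hpB := S.hB.1
  -- step x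
  set a1 : B → ℝ := fun b => ∑ t, S.pT t * ∑ x, S.kx t x * G b t x with ha1
  set a2 : B → ℝ := fun b => ∑ t, ∑ t', S.pT t * S.pT t' * ∑ x, S.kx t x * G b t' x with ha2
  have ha1n : ∀ b, 0 ≤ a1 b := fun b => Finset.sum_nonneg fun t _ => mul_nonneg (hpT t)
    (Finset.sum_nonneg fun x _ => mul_nonneg (hkx _ _) (hG _ _ _))
  have ha2n : ∀ b, 0 ≤ a2 b := fun b => Finset.sum_nonneg fun t _ => Finset.sum_nonneg fun t' _ =>
    mul_nonneg (mul_nonneg (hpT t) (hpT t'))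
    (Finset.sum_nonneg fun x _ => mul_nonneg (hkx _ _) (hG _ _ _))
  have key : ∀ u, Ecb S M N (fun C => ∑ m', ∑ c',
      S.ku (C.b m) u * S.kv u v * G (C.b m') (C.t (m', c')) (C.xx m u)) ≤
      S.kv u v * ((∑ b, S.pB b * S.ku b u * (a1 b + N * a2 b)) +
        M * N * ∑ b, ∑ b', S.pB b * S.pB b' * (S.ku b u * a2 b')) := by
    intro u
    have hE := isExp_Ecb S M hN
    rw [hE.sum]
    simp only [hE.sum]
    have hE1 : IsExp (ewt (fun _ : Fin M => S.pB)) := isExp_ewt fun _ => S.hB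
    have hE2 : IsExp (ewt (fun (_ : Fin M × U) (_ : Fin N) => 1 / (N : ℝ))) :=
      isExp_ewt fun _ => unif_pmf hN
    -- inner bound for each m'
    have hm : ∀ m', ∑ c', Ecb S M N (fun C =>
        S.ku (C.b m) u * S.kv u v * G (C.b m') (C.t (m', c')) (C.xx m u)) ≤
        ewt (fun _ : Fin M => S.pB) (fun b => S.ku (b m) u * S.kv u v *
          ((if m = m' then a1 (b m') else 0) + N * a2 (b m'))) := by
      intro m'
      unfold Ecb CB.xx CB.tt
      rw [← hE1.sum]
      refine hE1.mono fun b => ?_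
      rw [← hE2.sum]
      have hc : S.ku (b m) u * S.kv u v * ((if m = m' then a1 (b m') else 0) + N * a2 (b m')) =
        ewt (fun (_ : Fin M × U) (_ : Fin N) => 1 / (N : ℝ)) (fun _ => S.ku (b m) u * S.kv u v *
          ((if m = m' then a1 (b m') else 0) + N * a2 (b m'))) := (hE2.const _).symm
      rw [hc]
      refine hE2.mono fun h => ?_
      have hx : ∀ (t : Fin M × Fin N → T) c', (ewt (fun (i : Fin M × U × T) => S.kx i.2.2) fun x =>
          S.ku (b m) u * S.kv u v * G (b m') (t (m', c')) (x (m, u, t (m, h (m, u))))) =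
          ∑ x, S.kx (t (m, h (m, u))) x *
            (S.ku (b m) u * S.kv u v * G (b m') (t (m', c')) x) := fun t c' =>
        E1 (fun (i : Fin M × U × T) => S.kx i.2.2) (fun i => (S.hx _).2) (m, u, t (m, h (m, u)))
          (fun x => S.ku (b m) u * S.kv u v * G (b m') (t (m', c')) x)
      simp only [hx]
      have ht : ∀ c' : Fin N, (ewt (fun _ : Fin M × Fin N => S.pT) fun t =>
          ∑ x, S.kx (t (m, h (m, u))) x *
            (S.ku (b m) u * S.kv u v * G (b m') (t (m', c')) x)) ≤
          S.ku (b m) u * S.kv u v * ((if c' = h (m, u) then (if m = m' then a1 (b m') else 0) else 0)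
            + a2 (b m')) := by
        intro c'
        have hco : 0 ≤ S.ku (b m) u * S.kv u v := mul_nonneg (hku _ _) (hkv _ _)
        by_cases hcc : (m, h (m, u)) = (m', c')
        · have hm' : m = m' := congrArg Prod.fst hcc
          have hc' : h (m, u) = c' := congrArg Prod.snd hcc
          subst hc' hm'
          have := E1 (fun _ : Fin M × Fin N => S.pT) (fun i => S.hT.2) (m, h (m, u))
            (fun t => ∑ x, S.kx t x * (S.ku (b m) u * S.kv u v * G (b m) t x))
          refine (le_of_eq this).trans ?_
          simp only [if_true]
          have e : ∑ t, S.pT t * ∑ x, S.kx t x * (S.ku (b m) u * S.kv u v * G (b m) t x) =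
            S.ku (b m) u * S.kv u v * a1 (b m) := by
            simp only [ha1, Finset.mul_sum]
            exact Finset.sum_congr rfl fun t _ => Finset.sum_congr rfl fun x _ => by ring
          rw [e]
          exact mul_le_mul_of_nonneg_left (le_add_of_nonneg_right (ha2n _)) hco
        · have := E2 (fun _ : Fin M × Fin N => S.pT) (fun i => S.hT.2) _ _ hcc
            (fun t t' => ∑ x, S.kx t x * (S.ku (b m) u * S.kv u v * G (b m') t' x))
          refine (le_of_eq this).trans ?_
          have e : ∑ t, ∑ t', S.pT t * S.pT t' *
              ∑ x, S.kx t x * (S.ku (b m) u * S.kv u v * G (b m') t' x) =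
            S.ku (b m) u * S.kv u v * a2 (b m') := by
            simp only [ha2, Finset.mul_sum]
            exact Finset.sum_congr rfl fun t _ => Finset.sum_congr rfl fun t' _ =>
              Finset.sum_congr rfl fun x _ => by ring
          rw [e]
          refine mul_le_mul_of_nonneg_left (le_add_of_nonneg_left ?_) hco
          split_ifs
          · exact ha1n _
          · exact le_rfl
          · exact le_rfl
      refine (Finset.sum_le_sum fun c' _ => ht c').trans (le_of_eq ?_)
      rw [← Finset.mul_sum, Finset.sum_add_distrib]
      simp
    refine (Finset.sum_le_sum fun m' _ => hm m').trans ?_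
    have hb : ∀ m' : Fin M, ewt (fun _ : Fin M => S.pB) (fun b => S.ku (b m) u * S.kv u v *
          ((if m = m' then a1 (b m') else 0) + N * a2 (b m'))) ≤
        S.kv u v * ((if m = m' then ∑ b, S.pB b * S.ku b u * (a1 b + N * a2 b) else 0) +
         N * ∑ b, ∑ b', S.pB b * S.pB b' * (S.ku b u * a2 b')) := by
      intro m'
      have hdn : 0 ≤ ∑ b, ∑ b', S.pB b * S.pB b' * (S.ku b u * a2 b') :=
        Finset.sum_nonneg fun b _ => Finset.sum_nonneg fun b' _ => mul_nonneg
          (mul_nonneg (hpB _) (hpB _)) (mul_nonneg (hku _ _) (ha2n _))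
      by_cases hmm : m = m'
      · subst hmm
        have := E1 (fun _ : Fin M => S.pB) (fun i => S.hB.2) m
          (fun b => S.ku b u * S.kv u v * (a1 b + N * a2 b))
        simp only [if_true]
        refine (le_of_eq this).trans ?_
        rw [mul_add]
        refine le_add_of_le_of_nonneg (le_of_eq ?_) (mul_nonneg (hkv _ _)
          (mul_nonneg (Nat.cast_nonneg _) hdn))
        rw [Finset.mul_sum]
        exact Finset.sum_congr rfl fun b _ => by ring
      · have := E2 (fun _ : Fin M => S.pB) (fun i => S.hB.2) m m' hmm
          (fun b b' => S.ku b u * S.kv u v * (0 + N * a2 b'))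
        simp only [if_neg hmm]
        refine (le_of_eq this).trans (le_of_eq ?_)
        simp only [zero_add, Finset.mul_sum]
        exact Finset.sum_congr rfl fun b _ => Finset.sum_congr rfl fun b' _ => by ring
    refine (Finset.sum_le_sum fun m' _ => hb m').trans (le_of_eq ?_)
    rw [← Finset.mul_sum, Finset.sum_add_distrib]
    simp
    left; ring
  refine (Finset.sum_le_sum fun u _ => key u).trans (le_of_eq ?_)
  have ha2' : ∀ b, a2 b = ∑ t, S.pT t * ∑ x, S.pX x * G b t x := by
    intro b
    simp only [ha2, Usr.pX, Finset.mul_sum, Finset.sum_mul]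
    rw [Finset.sum_comm]
    refine Finset.sum_congr rfl fun t _ => ?_
    rw [Finset.sum_comm]
    exact Finset.sum_congr rfl fun x _ => Finset.sum_congr rfl fun t' _ => by ring
  have e1 : ∑ u, S.kv u v * ((∑ b, S.pB b * S.ku b u * (a1 b + N * a2 b)) +
        M * N * ∑ b, ∑ b', S.pB b * S.pB b' * (S.ku b u * a2 b')) =
      ∑ b, (S.pBV b v * (a1 b + N * a2 b) + M * N * (S.pB b * S.pV v * a2 b)) := by
    have e2 : ∑ u, S.kv u v * ∑ b, S.pB b * S.ku b u * (a1 b + N * a2 b) =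
      ∑ b, S.pBV b v * (a1 b + N * a2 b) := by
      simp only [Usr.pBV, Finset.mul_sum, Finset.sum_mul]
      rw [Finset.sum_comm]
      exact Finset.sum_congr rfl fun x _ => Finset.sum_congr rfl fun t' _ => by ring
    have e3 : ∑ u, S.kv u v * ∑ b, ∑ b', S.pB b * S.pB b' * (S.ku b u * a2 b') =
      ∑ b, S.pB b * S.pV v * a2 b := by
      have : ∀ b', S.pB b' * S.pV v * a2 b' =
        ∑ u, ∑ b, S.kv u v * (S.pB b * S.pB b' * (S.ku b u * a2 b')) := by
        intro b'
        simp only [Usr.pV, Usr.pBV, Finset.mul_sum, Finset.sum_mul]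
        rw [Finset.sum_comm]
        exact Finset.sum_congr rfl fun x _ => Finset.sum_congr rfl fun t' _ => by ring
      simp only [this]
      rw [Finset.sum_comm]
      refine Finset.sum_congr rfl fun u _ => ?_
      simp only [Finset.mul_sum]
      exact Finset.sum_comm
    rw [Finset.sum_add_distrib, ← e2, ← Finset.mul_sum, ← e3, Finset.mul_sum,
      ← Finset.sum_add_distrib]
    exact Finset.sum_congr rfl fun u _ => by ring
  rw [e1]
  refine Finset.sum_congr rfl fun b _ => ?_
  rw [ha2']
  simp only [ha1, Usr.Q2, mul_add, add_mul, Finset.mul_sum, Finset.sum_add_distrib]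
  congr 1
  · congr 1
    · exact Finset.sum_congr rfl fun x _ => Finset.sum_congr rfl fun t' _ => by ring
    · exact Finset.sum_congr rfl fun x _ => Finset.sum_congr rfl fun t' _ => by ring
  · exact Finset.sum_congr rfl fun x _ => Finset.sum_congr rfl fun t' _ => by ring

end Usr

section Usr
variable {U V B T X : Type} [Fintype U] [Fintype V] [Fintype B] [Fintype T] [Fintype X]

theorem ewt_hash {M N : ℕ} (hN : 0 < N) (i j : Fin M × U) (hij : i ≠ j) (c : ℝ) :
    ewt (fun (_ : Fin M × U) (_ : Fin N) => 1 / (N : ℝ)) (fun h => if h i = h j then c else 0) =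
      1 / (N : ℝ) * c := by
  have := E2 (fun (_ : Fin M × U) (_ : Fin N) => 1 / (N : ℝ)) (fun _ => (unif_pmf hN).2) i j hij
    (fun a b => if a = b then c else 0)
  refine this.trans ?_
  have : (N : ℝ) ≠ 0 := by positivity
  simp
  field_simp

/-- Own user: expected sum over all false candidates. -/
theorem user1 (S : Usr U V B T X) {M N : ℕ} (hN : 0 < N) (m : Fin M)
    (G : U → B → T → X → X → ℝ) (hG : ∀ u b t x' x, 0 ≤ G u b t x' x) :
    ∑ u, Ecb S M N (fun C => ∑ m', ∑ u', if u' = u then 0 else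
      S.ku (C.b m) u * G u' (C.b m') (C.tt m' u') (C.xx m' u') (C.xx m u)) ≤
    ∑ u', ∑ b, ∑ t, ∑ x', ∑ x, S.Q1 M N b t x' x * G u' b t x' x := by
  have hkx := fun t => (S.hx t).1
  have hku := fun t => (S.hu t).1
  have hpT := S.hT.1
  have hpB := S.hB.1
  set a1 : U → B → ℝ := fun u' b => ∑ t, S.pT t * ∑ x, ∑ x', S.kx t x * S.kx t x' * G u' b t x' x
    with ha1
  set a2 : U → B → ℝ := fun u' b => ∑ t, ∑ t', S.pT t * S.pT t' *
    ∑ x, ∑ x', S.kx t x * S.kx t' x' * G u' b t' x' x with ha2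
  have ha1n : ∀ u b, 0 ≤ a1 u b := fun u b => Finset.sum_nonneg fun t _ => mul_nonneg (hpT t)
    (Finset.sum_nonneg fun x _ => Finset.sum_nonneg fun x' _ =>
      mul_nonneg (mul_nonneg (hkx _ _) (hkx _ _)) (hG _ _ _ _ _))
  have ha2n : ∀ u b, 0 ≤ a2 u b := fun u b => Finset.sum_nonneg fun t _ =>
    Finset.sum_nonneg fun t' _ => mul_nonneg (mul_nonneg (hpT t) (hpT t'))
    (Finset.sum_nonneg fun x _ => Finset.sum_nonneg fun x' _ =>
      mul_nonneg (mul_nonneg (hkx _ _) (hkx _ _)) (hG _ _ _ _ _))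
  have hE := isExp_Ecb S M hN
  have hE1 : IsExp (ewt (fun _ : Fin M => S.pB)) := isExp_ewt fun _ => S.hB
  have hE2 : IsExp (ewt (fun (_ : Fin M × U) (_ : Fin N) => 1 / (N : ℝ))) :=
    isExp_ewt fun _ => unif_pmf hN
  have key : ∀ u m' u', Ecb S M N (fun C => if u' = u then 0 else
      S.ku (C.b m) u * G u' (C.b m') (C.tt m' u') (C.xx m' u') (C.xx m u)) ≤
      (if m = m' then ∑ b, S.pB b * (S.ku b u * (1 / (N : ℝ) * a1 u' b + a2 u' b)) else 0) +
      ∑ b, ∑ b', S.pB b * S.pB b' * (S.ku b u * a2 u' b') := by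
    intro u m' u'
    have hdn : 0 ≤ ∑ b, ∑ b', S.pB b * S.pB b' * (S.ku b u * a2 u' b') :=
        Finset.sum_nonneg fun b _ => Finset.sum_nonneg fun b' _ => mul_nonneg
          (mul_nonneg (hpB _) (hpB _)) (mul_nonneg (hku _ _) (ha2n _ _))
    have hdn1 : 0 ≤ ∑ b, S.pB b * (S.ku b u * (1 / (N : ℝ) * a1 u' b + a2 u' b)) :=
      Finset.sum_nonneg fun b _ => mul_nonneg (hpB _) (mul_nonneg (hku _ _)
        (add_nonneg (mul_nonneg (by positivity) (ha1n _ _)) (ha2n _ _)))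
    by_cases hu : u' = u
    · simp only [hu, if_true]
      rw [hE.const]
      rw [hu] at hdn hdn1
      refine add_nonneg ?_ hdn
      split_ifs
      · exact hdn1
      · exact le_rfl
    simp only [if_neg hu]
    have hb : Ecb S M N (fun C =>
        S.ku (C.b m) u * G u' (C.b m') (C.tt m' u') (C.xx m' u') (C.xx m u)) ≤
        ewt (fun _ : Fin M => S.pB) (fun b => S.ku (b m) u *
          ((if m = m' then 1 / (N : ℝ) * a1 u' (b m') else 0) + a2 u' (b m'))) := by
      unfold Ecb CB.xx CB.tt
      refine hE1.mono fun b => ?_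
      have hne : ((m, u) : Fin M × U) ≠ (m, u') := fun h => hu (congrArg Prod.snd h).symm
      have hc : S.ku (b m) u * ((if m = m' then 1 / (N : ℝ) * a1 u' (b m') else 0) + a2 u' (b m')) =
        ewt (fun (_ : Fin M × U) (_ : Fin N) => 1 / (N : ℝ)) (fun h => S.ku (b m) u *
          ((if h (m, u) = h (m, u') then (if m = m' then a1 u' (b m') else 0) else 0)
            + a2 u' (b m'))) := by
        rw [hE2.smul, hE2.add, ewt_hash hN _ _ hne, hE2.const]
        split_ifs <;> simp
      rw [hc]
      refine hE2.mono fun h => ?_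
      have hx : ∀ (t : Fin M × Fin N → T), (ewt (fun (i : Fin M × U × T) => S.kx i.2.2) fun x =>
          S.ku (b m) u * G u' (b m') (t (m', h (m', u'))) (x (m', u', t (m', h (m', u'))))
            (x (m, u, t (m, h (m, u))))) =
          ∑ x, ∑ x', S.kx (t (m, h (m, u))) x * S.kx (t (m', h (m', u'))) x' *
            (S.ku (b m) u * G u' (b m') (t (m', h (m', u'))) x' x) := fun t =>
        E2 (fun (i : Fin M × U × T) => S.kx i.2.2) (fun i => (S.hx _).2)
          (m, u, t (m, h (m, u))) (m', u', t (m', h (m', u')))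
          (fun h => hu (congrArg (fun z => z.2.1) h).symm)
          (fun x x' => S.ku (b m) u * G u' (b m') (t (m', h (m', u'))) x' x)
      simp only [hx]
      have hco : 0 ≤ S.ku (b m) u := hku _ _
      by_cases hcc : (m, h (m, u)) = (m', h (m', u'))
      · have hm' : m = m' := congrArg Prod.fst hcc
        subst hm'
        have hc' : h (m, u) = h (m, u') := congrArg Prod.snd hcc
        rw [← hc']
        have := E1 (fun _ : Fin M × Fin N => S.pT) (fun i => S.hT.2) (m, h (m, u))
            (fun t => ∑ x, ∑ x', S.kx t x * S.kx t x' * (S.ku (b m) u * G u' (b m) t x' x))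
        refine (le_of_eq this).trans ?_
        simp only [if_true]
        have e : ∑ t, S.pT t * ∑ x, ∑ x', S.kx t x * S.kx t x' * (S.ku (b m) u * G u' (b m) t x' x) =
            S.ku (b m) u * a1 u' (b m) := by
            simp only [ha1, Finset.mul_sum]
            exact Finset.sum_congr rfl fun t _ => Finset.sum_congr rfl fun x _ =>
              Finset.sum_congr rfl fun x' _ => by ring
        rw [e]
        exact mul_le_mul_of_nonneg_left (le_add_of_nonneg_right (ha2n _ _)) hco
      · have := E2 (fun _ : Fin M × Fin N => S.pT) (fun i => S.hT.2) _ _ hcc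
            (fun t t' => ∑ x, ∑ x', S.kx t x * S.kx t' x' *
              (S.ku (b m) u * G u' (b m') t' x' x))
        refine (le_of_eq this).trans ?_
        have e : ∑ t, ∑ t', S.pT t * S.pT t' *
              ∑ x, ∑ x', S.kx t x * S.kx t' x' * (S.ku (b m) u * G u' (b m') t' x' x) =
            S.ku (b m) u * a2 u' (b m') := by
            simp only [ha2, Finset.mul_sum]
            exact Finset.sum_congr rfl fun t _ => Finset.sum_congr rfl fun t' _ =>
              Finset.sum_congr rfl fun x _ => Finset.sum_congr rfl fun x' _ => by ring
        rw [e]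
        refine mul_le_mul_of_nonneg_left (le_add_of_nonneg_left ?_) hco
        split_ifs
        · exact ha1n _ _
        · exact le_rfl
        · exact le_rfl
    refine hb.trans ?_
    by_cases hmm : m = m'
    · subst hmm
      have := E1 (fun _ : Fin M => S.pB) (fun i => S.hB.2) m
          (fun b => S.ku b u * (1 / (N : ℝ) * a1 u' b + a2 u' b))
      simp only [if_true]
      exact (le_of_eq this).trans (le_add_of_nonneg_right hdn)
    · have := E2 (fun _ : Fin M => S.pB) (fun i => S.hB.2) m m' hmm
          (fun b b' => S.ku b u * (0 + a2 u' b'))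
      simp only [if_neg hmm]
      refine (le_of_eq this).trans (le_of_eq ?_)
      simp only [zero_add]
  have hsum : ∀ u, Ecb S M N (fun C => ∑ m', ∑ u', if u' = u then 0 else
      S.ku (C.b m) u * G u' (C.b m') (C.tt m' u') (C.xx m' u') (C.xx m u)) ≤
      ∑ u', ((∑ b, S.pB b * (S.ku b u * (1 / (N : ℝ) * a1 u' b + a2 u' b))) +
        M * ∑ b, ∑ b', S.pB b * S.pB b' * (S.ku b u * a2 u' b')) := by
    intro u
    rw [hE.sum]
    simp only [hE.sum]
    rw [Finset.sum_comm]
    refine Finset.sum_le_sum fun u' _ => ?_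
    refine (Finset.sum_le_sum fun m' _ => key u m' u').trans (le_of_eq ?_)
    rw [Finset.sum_add_distrib]
    simp
  refine (Finset.sum_le_sum fun u _ => hsum u).trans (le_of_eq ?_)
  rw [Finset.sum_comm]
  refine Finset.sum_congr rfl fun u' _ => ?_
  have ha2' : ∀ b, a2 u' b = ∑ t, S.pT t * ∑ x', ∑ x, S.kx t x' * S.pX x * G u' b t x' x := by
    intro b
    simp only [ha2, Usr.pX, Finset.mul_sum, Finset.sum_mul]
    rw [Finset.sum_comm]
    refine Finset.sum_congr rfl fun t _ => ?_
    rw [Finset.sum_comm, Finset.sum_comm' (t' := Finset.univ) (s' := fun _ => Finset.univ) (by simp)]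
    rw [Finset.sum_comm]
    refine (Finset.sum_congr rfl fun x _ => Finset.sum_comm).trans ?_
    rw [Finset.sum_comm]
    exact Finset.sum_congr rfl fun x _ => Finset.sum_congr rfl fun t' _ =>
      Finset.sum_congr rfl fun t' _ => by ring
  have e1 : ∑ u, ((∑ b, S.pB b * (S.ku b u * (1 / (N : ℝ) * a1 u' b + a2 u' b))) +
        M * ∑ b, ∑ b', S.pB b * S.pB b' * (S.ku b u * a2 u' b')) =
      ∑ b, S.pB b * (1 / (N : ℝ) * a1 u' b + (1 + M) * a2 u' b) := by
    have e2 : ∑ u, ∑ b, S.pB b * (S.ku b u * (1 / (N : ℝ) * a1 u' b + a2 u' b)) =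
      ∑ b, S.pB b * (1 / (N : ℝ) * a1 u' b + a2 u' b) := by
      rw [Finset.sum_comm]
      refine Finset.sum_congr rfl fun b _ => ?_
      rw [← Finset.mul_sum, ← Finset.sum_mul, (S.hu b).2, one_mul]
    have e3 : ∑ u, ∑ b, ∑ b', S.pB b * S.pB b' * (S.ku b u * a2 u' b') =
      ∑ b, S.pB b * a2 u' b := by
      have : ∑ u, ∑ b, ∑ b', S.pB b * S.pB b' * (S.ku b u * a2 u' b') =
        ∑ b, S.pB b * ∑ u, S.ku b u * ∑ b', S.pB b' * a2 u' b' := by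
        rw [Finset.sum_comm]
        simp only [Finset.mul_sum]
        exact Finset.sum_congr rfl fun x _ => Finset.sum_congr rfl fun t' _ =>
          Finset.sum_congr rfl fun t' _ => by ring
      rw [this]
      simp only [← Finset.sum_mul, (S.hu _).2, one_mul, S.hB.2]
    rw [Finset.sum_add_distrib, e2, ← Finset.mul_sum, e3, Finset.mul_sum, ← Finset.sum_add_distrib]
    exact Finset.sum_congr rfl fun u _ => by ring
  rw [e1]
  refine Finset.sum_congr rfl fun b _ => ?_
  rw [ha2']
  have ha1' : a1 u' b = ∑ t, S.pT t * ∑ x', ∑ x, S.kx t x * S.kx t x' * G u' b t x' x := by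
    simp only [ha1]
    exact Finset.sum_congr rfl fun t _ => by rw [Finset.sum_comm]
  rw [ha1']
  simp only [Usr.Q1, Finset.mul_sum, ← Finset.sum_add_distrib]
  exact Finset.sum_congr rfl fun x _ => Finset.sum_congr rfl fun t' _ =>
          Finset.sum_congr rfl fun t' _ => by ring

end Usr

section Recv
variable {U V B T X U' V' B' T' X' Y : Type} [Fintype U] [Fintype V] [Fintype B] [Fintype T]
  [Fintype X] [Fintype U'] [Fintype V'] [Fintype B'] [Fintype T'] [Fintype X'] [Fintype Y]

/-- Joint law seen by the receiver. -/
noncomputable def Pa (S : Usr U V B T X) (S' : Usr U' V' B' T' X') (W : X → X' → Y → ℝ)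
    (u : U) (b : B) (t : T) (x : X) (b' : B') (v' : V') (t' : T') (y : Y) : ℝ :=
  S.pB b * S.ku b u * S.pT t * S.kx t x * S'.pBV b' v' * S'.pT t' * ∑ x', S'.kx t' x' * W x x' y

/-- Total reference measure of all false candidates. -/
noncomputable def Rtot (S : Usr U V B T X) (S' : Usr U' V' B' T' X') (W : X → X' → Y → ℝ)
    (M N M' N' : ℕ)
    (b : B) (t : T) (x : X) (b' : B') (v' : V') (t' : T') (y : Y) : ℝ :=
  ∑ z, ∑ z', S.Q1 M N b t x z * (S'.Q2 M' N' v' b' t' z' * W z z' y)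

def Good (S : Usr U V B T X) (S' : Usr U' V' B' T' X') (W : X → X' → Y → ℝ)
    (M N M' N' : ℕ) (δ : ℝ)
    (u : U) (b : B) (t : T) (x : X) (b' : B') (v' : V') (t' : T') (y : Y) : Prop :=
  Rtot S S' W M N M' N' b t x b' v' t' y ≤ δ * Pa S S' W u b t x b' v' t' y

/-- Probability that the true tuple is not good. -/
noncomputable def Bad (S : Usr U V B T X) (S' : Usr U' V' B' T' X') (W : X → X' → Y → ℝ)
    (M N M' N' : ℕ) (δ : ℝ) : ℝ :=
  ∑ v', ∑ y, ∑ u, ∑ u', ∑ b, ∑ t, ∑ x, ∑ b', ∑ t', ∑ x',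
    S.pB b * S.pT t * S.kx t x * (S'.pB b' * S'.pT t' * S'.kx t' x' *
      (S.ku b u * (S'.ku b' u' * S'.kv u' v') * W x x' y *
        if Good S S' W M N M' N' δ u b t x b' v' t' y then 0 else 1))

/-- Unique decoding rule. -/
noncomputable def dec [Nonempty U] (P : U → Prop) : U :=
  if h : ∃ u, P u ∧ ∀ u', P u' → u' = u then h.choose else Classical.arbitrary U

theorem dec_eq [Nonempty U] (P : U → Prop) (u : U) (h : P u) (h' : ∀ u', P u' → u' = u) :
    dec P = u := by
  have hex : ∃ u, P u ∧ ∀ u', P u' → u' = u := ⟨u, h, h'⟩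
  unfold dec
  rw [dif_pos hex]
  exact h' _ hex.choose_spec.1

/-- The decoder of the receiver interested in the first user. -/
noncomputable def gdec [Nonempty U] (S : Usr U V B T X) (S' : Usr U' V' B' T' X')
    (W : X → X' → Y → ℝ) {M N M' N' : ℕ} (δ : ℝ) (C : CB M N U B T X) (C' : CB M' N' U' B' T' X')
    (y : Y) (v' : V') : U :=
  dec (fun u => ∃ m m' c', Good S S' W M N M' N' δ u (C.b m) (C.tt m u) (C.xx m u)
    (C'.b m') v' (C'.t (m', c')) y)

theorem sum_Pa (S : Usr U V B T X) (S' : Usr U' V' B' T' X') (W : X → X' → Y → ℝ)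
    (hW : ∀ x x', IsPMF (W x x')) :
    ∑ v', ∑ y, ∑ u, ∑ b, ∑ t, ∑ x, ∑ b', ∑ t', Pa S S' W u b t x b' v' t' y = 1 := by
  have h1 : ∀ v' u b t x b' t', ∑ y, Pa S S' W u b t x b' v' t' y =
      S.pB b * S.ku b u * S.pT t * S.kx t x * S'.pBV b' v' * S'.pT t' := by
    intro v' u b t x b' t'
    unfold Pa
    rw [← Finset.mul_sum, Finset.sum_comm]
    simp only [← Finset.mul_sum, (hW _ _).2, mul_one, (S'.hx _).2]
  have h2 : ∑ v', ∑ y, ∑ u, ∑ b, ∑ t, ∑ x, ∑ b', ∑ t', Pa S S' W u b t x b' v' t' y =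
      ∑ v', ∑ u, ∑ b, ∑ t, ∑ x, ∑ b', ∑ t', ∑ y, Pa S S' W u b t x b' v' t' y := by
    refine Finset.sum_congr rfl fun v' _ => ?_
    rw [Finset.sum_comm]
    refine Finset.sum_congr rfl fun u _ => ?_
    rw [Finset.sum_comm]
    refine Finset.sum_congr rfl fun b _ => ?_
    rw [Finset.sum_comm]
    refine Finset.sum_congr rfl fun t _ => ?_
    rw [Finset.sum_comm]
    refine Finset.sum_congr rfl fun x _ => ?_
    rw [Finset.sum_comm]
    refine Finset.sum_congr rfl fun b' _ => ?_
    rw [Finset.sum_comm]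
  rw [h2]
  simp only [h1]
  simp only [← Finset.mul_sum, S'.hT.2, mul_one]
  have h3 : ∀ c : ℝ, ∑ v', c * ∑ b', S'.pBV b' v' = c := by
    intro c
    rw [← Finset.mul_sum, Finset.sum_comm]
    unfold Usr.pBV
    have : ∀ b', ∑ v', ∑ u', S'.pB b' * S'.ku b' u' * S'.kv u' v' = S'.pB b' := by
      intro b'
      rw [Finset.sum_comm]
      simp only [← Finset.mul_sum, (S'.hv _).2, mul_one, (S'.hu _).2]
    simp only [this, S'.hB.2, mul_one]
  have h4 : ∑ v', ∑ u, ∑ b, ∑ t, ∑ x, S.pB b * S.ku b u * S.pT t * S.kx t x *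
      ∑ b', S'.pBV b' v' = ∑ u, ∑ b, ∑ t, ∑ x, S.pB b * S.ku b u * S.pT t * S.kx t x := by
    rw [Finset.sum_comm]
    refine Finset.sum_congr rfl fun u _ => ?_
    rw [Finset.sum_comm]
    refine Finset.sum_congr rfl fun b _ => ?_
    rw [Finset.sum_comm]
    refine Finset.sum_congr rfl fun t _ => ?_
    rw [Finset.sum_comm]
    refine Finset.sum_congr rfl fun x _ => ?_
    exact h3 _
  rw [h4]
  simp only [← Finset.mul_sum, (S.hx _).2, mul_one, S.hT.2]
  rw [Finset.sum_comm]
  simp only [← Finset.mul_sum, (S.hu _).2, mul_one, S.hB.2]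

theorem recv [Nonempty U] (S : Usr U V B T X) (S' : Usr U' V' B' T' X')
    (W : X → X' → Y → ℝ) (hW : ∀ x x', IsPMF (W x x')) {M N M' N' : ℕ} (hN : 0 < N) (hN' : 0 < N')
    (δ : ℝ) (hδ : 0 ≤ δ) (m : Fin M) (m' : Fin M') :
    Ecb S M N (fun C => Ecb S' M' N' (fun C' => ∑ v', ∑ y, ∑ u, ∑ u',
      S.ku (C.b m) u * (S'.ku (C'.b m') u' * S'.kv u' v') * W (C.xx m u) (C'.xx m' u') y *
        if gdec S S' W δ C C' y v' = u then 0 else 1)) ≤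
    Bad S S' W M N M' N' δ + δ := by
  have hE := isExp_Ecb S M hN
  have hE' := isExp_Ecb S' M' hN'
  have hkx := fun t => (S.hx t).1
  have hku := fun t => (S.hu t).1
  have hku' := fun t => (S'.hu t).1
  have hkv' := fun t => (S'.hv t).1
  set Φ : U → B → T → X → B' → V' → T' → Y → ℝ := fun u b t x b' v' t' y =>
    if Good S S' W M N M' N' δ u b t x b' v' t' y then 1 else 0 with hΦ
  have hΦn : ∀ u b t x b' v' t' y, 0 ≤ Φ u b t x b' v' t' y := by
    intros; simp only [hΦ]; split_ifs <;> norm_num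
  -- pointwise bound
  have hpt : ∀ (C : CB M N U B T X) (C' : CB M' N' U' B' T' X') v' y u u',
      (if gdec S S' W δ C C' y v' = u then (0 : ℝ) else 1) ≤
      (if Good S S' W M N M' N' δ u (C.b m) (C.tt m u) (C.xx m u) (C'.b m') v' (C'.tt m' u') y
        then 0 else 1) +
      ∑ m1, ∑ u1, if u1 = u then 0 else ∑ m2, ∑ c2,
        Φ u1 (C.b m1) (C.tt m1 u1) (C.xx m1 u1) (C'.b m2) v' (C'.t (m2, c2)) y := by
    intro C C' v' y u u'
    have hnn : ∀ m1 u1, 0 ≤ (if u1 = u then 0 else ∑ m2, ∑ c2,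
        Φ u1 (C.b m1) (C.tt m1 u1) (C.xx m1 u1) (C'.b m2) v' (C'.t (m2, c2)) y) := by
      intro m1 u1
      split_ifs
      · exact le_rfl
      · exact Finset.sum_nonneg fun _ _ => Finset.sum_nonneg fun _ _ => hΦn _ _ _ _ _ _ _ _
    have hnn2 := Finset.sum_nonneg fun m1 (_ : m1 ∈ Finset.univ) =>
      Finset.sum_nonneg fun u1 (_ : u1 ∈ Finset.univ) => hnn m1 u1
    by_cases hg : Good S S' W M N M' N' δ u (C.b m) (C.tt m u) (C.xx m u) (C'.b m') v'
        (C'.tt m' u') y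
    · rw [if_pos hg, zero_add]
      by_cases hall : ∀ u1, (∃ m1 m2 c2, Good S S' W M N M' N' δ u1 (C.b m1) (C.tt m1 u1) (C.xx m1 u1)
        (C'.b m2) v' (C'.t (m2, c2)) y) → u1 = u
      · have : gdec S S' W δ C C' y v' = u := dec_eq _ _ ⟨m, m', C'.h (m', u'), hg⟩ hall
        rw [if_pos this]
        exact hnn2
      · push Not at hall
        obtain ⟨u1, ⟨m1, m2, c2, hgood⟩, hne⟩ := hall
        have h1 : (1 : ℝ) ≤ ∑ m1, ∑ u1, if u1 = u then 0 else ∑ m2, ∑ c2,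
            Φ u1 (C.b m1) (C.tt m1 u1) (C.xx m1 u1) (C'.b m2) v' (C'.t (m2, c2)) y := by
          refine le_trans ?_ (Finset.single_le_sum (f := fun m1 => ∑ u1, if u1 = u then 0 else
            ∑ m2, ∑ c2, Φ u1 (C.b m1) (C.tt m1 u1) (C.xx m1 u1) (C'.b m2) v' (C'.t (m2, c2)) y)
            (fun m1 _ => Finset.sum_nonneg fun u1 _ => hnn m1 u1) (Finset.mem_univ m1))
          refine le_trans ?_ (Finset.single_le_sum (f := fun u1 => if u1 = u then 0 else
            ∑ m2, ∑ c2, Φ u1 (C.b m1) (C.tt m1 u1) (C.xx m1 u1) (C'.b m2) v' (C'.t (m2, c2)) y)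
            (fun u1 _ => hnn m1 u1) (Finset.mem_univ u1))
          simp only [if_neg hne]
          refine le_trans ?_ (Finset.single_le_sum (f := fun m2 => ∑ c2,
            Φ u1 (C.b m1) (C.tt m1 u1) (C.xx m1 u1) (C'.b m2) v' (C'.t (m2, c2)) y)
            (fun m2 _ => Finset.sum_nonneg fun c2 _ => hΦn _ _ _ _ _ _ _ _) (Finset.mem_univ m2))
          refine le_trans ?_ (Finset.single_le_sum (f := fun c2 =>
            Φ u1 (C.b m1) (C.tt m1 u1) (C.xx m1 u1) (C'.b m2) v' (C'.t (m2, c2)) y)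
            (fun c2 _ => hΦn _ _ _ _ _ _ _ _) (Finset.mem_univ c2))
          simp only [hΦ, if_pos hgood]
          exact le_rfl
        refine le_trans ?_ h1
        split_ifs <;> norm_num
    · rw [if_neg hg]
      have : (if gdec S S' W δ C C' y v' = u then (0 : ℝ) else 1) ≤ 1 := by split_ifs <;> norm_num
      linarith
  -- split
  have hsplit : Ecb S M N (fun C => Ecb S' M' N' (fun C' => ∑ v', ∑ y, ∑ u, ∑ u',
      S.ku (C.b m) u * (S'.ku (C'.b m') u' * S'.kv u' v') * W (C.xx m u) (C'.xx m' u') y *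
        if gdec S S' W δ C C' y v' = u then 0 else 1)) ≤
      Ecb S M N (fun C => Ecb S' M' N' (fun C' => ∑ v', ∑ y, ∑ u, ∑ u',
        S.ku (C.b m) u * (S'.ku (C'.b m') u' * S'.kv u' v') * W (C.xx m u) (C'.xx m' u') y *
        if Good S S' W M N M' N' δ u (C.b m) (C.tt m u) (C.xx m u) (C'.b m') v' (C'.tt m' u') y
          then 0 else 1)) +
      Ecb S M N (fun C => Ecb S' M' N' (fun C' => ∑ v', ∑ y, ∑ u, ∑ u',
        S.ku (C.b m) u * (S'.ku (C'.b m') u' * S'.kv u' v') * W (C.xx m u) (C'.xx m' u') y *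
        ∑ m1, ∑ u1, if u1 = u then 0 else ∑ m2, ∑ c2,
          Φ u1 (C.b m1) (C.tt m1 u1) (C.xx m1 u1) (C'.b m2) v' (C'.t (m2, c2)) y)) := by
    rw [← hE.add]
    refine hE.mono fun C => ?_
    rw [← hE'.add]
    refine hE'.mono fun C' => ?_
    simp only [← Finset.sum_add_distrib, ← mul_add]
    refine Finset.sum_le_sum fun v' _ => Finset.sum_le_sum fun y _ => Finset.sum_le_sum fun u _ =>
      Finset.sum_le_sum fun u' _ => ?_
    exact mul_le_mul_of_nonneg_left (hpt C C' v' y u u') (mul_nonneg (mul_nonneg (hku _ _)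
      (mul_nonneg (hku' _ _) (hkv' _ _))) ((hW _ _).1 _))
  refine hsplit.trans (add_le_add (le_of_eq ?_) ?_)
  · -- true part
    simp only [hE'.sum, hE.sum, Bad]
    refine Finset.sum_congr rfl fun v' _ => Finset.sum_congr rfl fun y _ =>
      Finset.sum_congr rfl fun u _ => Finset.sum_congr rfl fun u' _ => ?_
    have h1 : ∀ C : CB M N U B T X, Ecb S' M' N' (fun C' =>
        S.ku (C.b m) u * (S'.ku (C'.b m') u' * S'.kv u' v') * W (C.xx m u) (C'.xx m' u') y *
        if Good S S' W M N M' N' δ u (C.b m) (C.tt m u) (C.xx m u) (C'.b m') v' (C'.tt m' u') y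
          then 0 else 1) = _ := fun C =>
      Ecb_true S' M' hN' m' u' (fun b' t' x' =>
        S.ku (C.b m) u * (S'.ku b' u' * S'.kv u' v') * W (C.xx m u) x' y *
        if Good S S' W M N M' N' δ u (C.b m) (C.tt m u) (C.xx m u) b' v' t' y then 0 else 1)
    simp only [h1]
    refine (Ecb_true S M hN m u (fun b t x => ∑ b', ∑ t', ∑ x', S'.pB b' * S'.pT t' * S'.kx t' x' *
      (S.ku b u * (S'.ku b' u' * S'.kv u' v') * W x x' y *
        if Good S S' W M N M' N' δ u b t x b' v' t' y then 0 else 1))).trans ?_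
    simp only [Finset.mul_sum]
  · -- candidates
    have hcand : Ecb S M N (fun C => Ecb S' M' N' (fun C' => ∑ v', ∑ y, ∑ u, ∑ u',
        S.ku (C.b m) u * (S'.ku (C'.b m') u' * S'.kv u' v') * W (C.xx m u) (C'.xx m' u') y *
        ∑ m1, ∑ u1, if u1 = u then 0 else ∑ m2, ∑ c2,
          Φ u1 (C.b m1) (C.tt m1 u1) (C.xx m1 u1) (C'.b m2) v' (C'.t (m2, c2)) y)) =
        ∑ v', ∑ y, ∑ u, Ecb S M N (fun C => ∑ m1, ∑ u1, if u1 = u then 0 else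
          S.ku (C.b m) u * (∑ u', Ecb S' M' N' (fun C' => ∑ m2, ∑ c2,
            S'.ku (C'.b m') u' * S'.kv u' v' * (W (C.xx m u) (C'.xx m' u') y *
            Φ u1 (C.b m1) (C.tt m1 u1) (C.xx m1 u1) (C'.b m2) v' (C'.t (m2, c2)) y)))) := by
      have hpull : ∀ v' y u (C : CB M N U B T X),
        (∑ m1, ∑ u1, if u1 = u then 0 else
          S.ku (C.b m) u * (∑ u', Ecb S' M' N' (fun C' => ∑ m2, ∑ c2,
            S'.ku (C'.b m') u' * S'.kv u' v' * (W (C.xx m u) (C'.xx m' u') y *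
            Φ u1 (C.b m1) (C.tt m1 u1) (C.xx m1 u1) (C'.b m2) v' (C'.t (m2, c2)) y)))) =
        Ecb S' M' N' (fun C' => ∑ u',
        S.ku (C.b m) u * (S'.ku (C'.b m') u' * S'.kv u' v') * W (C.xx m u) (C'.xx m' u') y *
        ∑ m1, ∑ u1, if u1 = u then 0 else ∑ m2, ∑ c2,
          Φ u1 (C.b m1) (C.tt m1 u1) (C.xx m1 u1) (C'.b m2) v' (C'.t (m2, c2)) y) := by
        intro v' y u C
        have hite : ∀ m1 u1, (if u1 = u then 0 else
          S.ku (C.b m) u * (∑ u', Ecb S' M' N' (fun C' => ∑ m2, ∑ c2,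
            S'.ku (C'.b m') u' * S'.kv u' v' * (W (C.xx m u) (C'.xx m' u') y *
            Φ u1 (C.b m1) (C.tt m1 u1) (C.xx m1 u1) (C'.b m2) v' (C'.t (m2, c2)) y)))) =
          Ecb S' M' N' (fun C' => if u1 = u then 0 else S.ku (C.b m) u * ∑ u', ∑ m2, ∑ c2,
            S'.ku (C'.b m') u' * S'.kv u' v' * (W (C.xx m u) (C'.xx m' u') y *
            Φ u1 (C.b m1) (C.tt m1 u1) (C.xx m1 u1) (C'.b m2) v' (C'.t (m2, c2)) y)) := by
          intro m1 u1
          split_ifs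
          · rw [hE'.const]
          · rw [hE'.smul, hE'.sum]
        simp only [hite]
        simp only [← hE'.sum]
        congr 1
        funext C'
        have : ∀ u', S.ku (C.b m) u * (S'.ku (C'.b m') u' * S'.kv u' v') *
            W (C.xx m u) (C'.xx m' u') y *
            (∑ m1, ∑ u1, if u1 = u then 0 else ∑ m2, ∑ c2,
            Φ u1 (C.b m1) (C.tt m1 u1) (C.xx m1 u1) (C'.b m2) v' (C'.t (m2, c2)) y) =
            ∑ m1, ∑ u1, if u1 = u then 0 else S.ku (C.b m) u * ∑ m2, ∑ c2,
            S'.ku (C'.b m') u' * S'.kv u' v' * (W (C.xx m u) (C'.xx m' u') y *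
            Φ u1 (C.b m1) (C.tt m1 u1) (C.xx m1 u1) (C'.b m2) v' (C'.t (m2, c2)) y) := by
          intro u'
          simp only [Finset.mul_sum, mul_ite, mul_zero]
          refine Finset.sum_congr rfl fun _ _ => Finset.sum_congr rfl fun _ _ => ?_
          split_ifs
          · rfl
          · exact Finset.sum_congr rfl fun _ _ => Finset.sum_congr rfl fun _ _ => by ring
        simp only [this]
        symm
        rw [Finset.sum_comm]
        refine Finset.sum_congr rfl fun m1 _ => ?_
        rw [Finset.sum_comm]
        refine Finset.sum_congr rfl fun u1 _ => ?_
        by_cases hh : u1 = u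
        · simp [hh]
        · simp only [if_neg hh]
          rw [← Finset.mul_sum]
      simp only [hpull]
      simp only [← hE.sum, ← hE'.sum]
    rw [hcand]
    have hbd : ∀ v' y, ∑ u, Ecb S M N (fun C => ∑ m1, ∑ u1, if u1 = u then 0 else
          S.ku (C.b m) u * (∑ u', Ecb S' M' N' (fun C' => ∑ m2, ∑ c2,
            S'.ku (C'.b m') u' * S'.kv u' v' * (W (C.xx m u) (C'.xx m' u') y *
            Φ u1 (C.b m1) (C.tt m1 u1) (C.xx m1 u1) (C'.b m2) v' (C'.t (m2, c2)) y)))) ≤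
        ∑ u, ∑ b, ∑ t, ∑ x, ∑ b', ∑ t', δ * Pa S S' W u b t x b' v' t' y := by
      intro v' y
      refine (user1 S hN m (fun u1 b t x' x => ∑ u', Ecb S' M' N' (fun C' => ∑ m2, ∑ c2,
            S'.ku (C'.b m') u' * S'.kv u' v' * (W x (C'.xx m' u') y *
            Φ u1 b t x' (C'.b m2) v' (C'.t (m2, c2)) y))) ?_).trans ?_
      · intro u b t x' x
        exact Finset.sum_nonneg fun u' _ => hE'.nonneg fun C' => Finset.sum_nonneg fun _ _ =>
          Finset.sum_nonneg fun _ _ => mul_nonneg (mul_nonneg (hku' _ _) (hkv' _ _))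
            (mul_nonneg ((hW _ _).1 _) (hΦn _ _ _ _ _ _ _ _))
      refine Finset.sum_le_sum fun u _ => Finset.sum_le_sum fun b _ => Finset.sum_le_sum fun t _ =>
        Finset.sum_le_sum fun x' _ => ?_
      have h2 : ∀ x, S.Q1 M N b t x' x * (∑ u', Ecb S' M' N' (fun C' => ∑ m2, ∑ c2,
            S'.ku (C'.b m') u' * S'.kv u' v' * (W x (C'.xx m' u') y *
            Φ u b t x' (C'.b m2) v' (C'.t (m2, c2)) y))) ≤
          S.Q1 M N b t x' x * ∑ b2, ∑ t2, ∑ x2, S'.Q2 M' N' v' b2 t2 x2 *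
            (W x x2 y * Φ u b t x' b2 v' t2 y) := fun x =>
        mul_le_mul_of_nonneg_left (user2 S' hN' m' v' (fun b2 t2 x2 => W x x2 y *
          Φ u b t x' b2 v' t2 y) fun _ _ _ => mul_nonneg ((hW _ _).1 _) (hΦn _ _ _ _ _ _ _ _))
          (S.Q1_nonneg _ _ _ _ _ _)
      refine (Finset.sum_le_sum fun x _ => h2 x).trans ?_
      have h3 : ∑ x, S.Q1 M N b t x' x * ∑ b2, ∑ t2, ∑ x2, S'.Q2 M' N' v' b2 t2 x2 *
            (W x x2 y * Φ u b t x' b2 v' t2 y) =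
          ∑ b2, ∑ t2, Rtot S S' W M N M' N' b t x' b2 v' t2 y * Φ u b t x' b2 v' t2 y := by
        simp only [Rtot, Finset.mul_sum, Finset.sum_mul]
        rw [Finset.sum_comm]
        refine Finset.sum_congr rfl fun b2 _ => ?_
        rw [Finset.sum_comm]
        refine Finset.sum_congr rfl fun t2 _ => ?_
        exact Finset.sum_congr rfl fun _ _ => Finset.sum_congr rfl fun _ _ => by ring
      rw [h3]
      refine Finset.sum_le_sum fun b2 _ => Finset.sum_le_sum fun t2 _ => ?_
      have hPn : 0 ≤ Pa S S' W u b t x' b2 v' t2 y := by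
        unfold Pa
        exact mul_nonneg (mul_nonneg (mul_nonneg (mul_nonneg (mul_nonneg (mul_nonneg (S.hB.1 _)
          (hku _ _)) (S.hT.1 _)) (hkx _ _)) (S'.pBV_nonneg _ _)) (S'.hT.1 _))
          (Finset.sum_nonneg fun _ _ => mul_nonneg ((S'.hx _).1 _) ((hW _ _).1 _))
      simp only [hΦ]
      split_ifs with hg
      · rw [mul_one]; exact hg
      · rw [mul_zero]; exact mul_nonneg hδ hPn
    refine (Finset.sum_le_sum fun v' _ => Finset.sum_le_sum fun y _ => hbd v' y).trans (le_of_eq ?_)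
    simp only [← Finset.mul_sum]
    rw [sum_Pa S S' W hW, mul_one]

end Recv

section OneShot

theorem argmin_derand {U : Type} [Fintype U] {M : ℕ} (hM : 0 < M) (p : U → ℝ)
    (k : Fin M → U → ℝ) (hk : ∀ m u, 0 ≤ k m u) (e : U → Fin M → ℝ)
    (he0 : ∀ u m, 0 ≤ e u m) (he1 : ∀ u m, e u m ≤ 1) :
    ∃ φ : U → Fin M, ∑ u, p u * e u (φ u) ≤
      (1 / (M : ℝ)) * ∑ m, ∑ u, k m u * e u m + ∑ u, max 0 (p u - (1 / (M : ℝ)) * ∑ m, k m u) := by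
  have : Nonempty (Fin M) := ⟨⟨0, hM⟩⟩
  choose φ hφ using fun u => Finite.exists_min (e u)
  refine ⟨φ, ?_⟩
  rw [Finset.sum_comm, Finset.mul_sum, ← Finset.sum_add_distrib]
  refine Finset.sum_le_sum fun u _ => ?_
  have h1 : (1 / (M : ℝ)) * ∑ m, k m u * e u (φ u) ≤ (1 / (M : ℝ)) * ∑ m, k m u * e u m := by
    refine mul_le_mul_of_nonneg_left ?_ (by positivity)
    exact Finset.sum_le_sum fun m _ => mul_le_mul_of_nonneg_left (hφ u m) (hk m u)
  rw [← Finset.sum_mul] at h1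
  have h2 : (p u - (1 / (M : ℝ)) * ∑ m, k m u) * e u (φ u) ≤
      max 0 (p u - (1 / (M : ℝ)) * ∑ m, k m u) := by
    calc _ ≤ max 0 (p u - (1 / (M : ℝ)) * ∑ m, k m u) * e u (φ u) :=
          mul_le_mul_of_nonneg_right (le_max_right _ _) (he0 _ _)
      _ ≤ max 0 (p u - (1 / (M : ℝ)) * ∑ m, k m u) * 1 :=
          mul_le_mul_of_nonneg_left (he1 _ _) (le_max_left _ _)
      _ = _ := mul_one _
  linarith

theorem IsExp.abs_le_sqrt {Ω : Type} {E : (Ω → ℝ) → ℝ} (h : IsExp E) (Z : Ω → ℝ) :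
    E (fun o => |Z o|) ≤ Real.sqrt (E (fun o => Z o ^ 2)) := by
  set t := E (fun o => |Z o|) with ht
  have h0 : 0 ≤ E (fun o => Z o ^ 2 + ((-2 * t) * |Z o| + t ^ 2)) :=
    h.nonneg fun o => by
      have := sq_nonneg (|Z o| - t)
      nlinarith [sq_abs (Z o)]
  rw [h.add, h.add, h.smul, h.const] at h0
  apply Real.le_sqrt_of_sq_le
  rw [← ht] at h0
  nlinarith

theorem var_mean {B : Type} [Fintype B] (p : B → ℝ) (hp : IsPMF p) {M : ℕ} (hM : 0 < M)
    (a : B → ℝ) :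
    ewt (fun _ : Fin M => p) (fun b => ((∑ x, p x * a x) - (1 / (M : ℝ)) * ∑ m, a (b m)) ^ 2) ≤
      (∑ x, p x * a x ^ 2) / M := by
  set μ := ∑ x, p x * a x with hμ
  have hE : IsExp (ewt (fun _ : Fin M => p)) := isExp_ewt fun _ => hp
  have hM' : (M : ℝ) ≠ 0 := by positivity
  have h1 : ∀ b : Fin M → B, (μ - (1 / (M : ℝ)) * ∑ m, a (b m)) ^ 2 =
      (1 / (M : ℝ)) ^ 2 * ∑ m, ∑ m', (a (b m) - μ) * (a (b m') - μ) := by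
    intro b
    have : ∑ m, ∑ m', (a (b m) - μ) * (a (b m') - μ) = (∑ m, (a (b m) - μ)) ^ 2 := by
      rw [sq, Finset.sum_mul_sum]
    rw [this, Finset.sum_sub_distrib]
    simp only [Finset.sum_const, Finset.card_univ, Fintype.card_fin, nsmul_eq_mul]
    field_simp
    ring
  simp only [h1]
  rw [hE.smul, hE.sum]
  simp only [hE.sum]
  have h0 : ∑ x, p x * (a x - μ) = 0 := by
    simp only [mul_sub, Finset.sum_sub_distrib, ← Finset.sum_mul, hp.2, one_mul, ← hμ, sub_self]
  have h2 : ∀ m m' : Fin M, ewt (fun _ : Fin M => p) (fun b => (a (b m) - μ) * (a (b m') - μ)) =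
      if m = m' then ∑ x, p x * (a x - μ) ^ 2 else 0 := by
    intro m m'
    split_ifs with hmm
    · subst hmm
      have := E1 (fun _ : Fin M => p) (fun _ => hp.2) m (fun x => (a x - μ) * (a x - μ))
      refine this.trans (Finset.sum_congr rfl fun _ _ => by ring)
    · have := E2 (fun _ : Fin M => p) (fun _ => hp.2) m m' hmm (fun x x' => (a x - μ) * (a x' - μ))
      refine this.trans ?_
      have : ∀ x x', p x * p x' * ((a x - μ) * (a x' - μ)) =
          (p x * (a x - μ)) * (p x' * (a x' - μ)) := fun _ _ => by ring
      simp only [this, ← Finset.mul_sum, h0, mul_zero, Finset.sum_const_zero]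
  simp only [h2, Finset.sum_ite_eq, Finset.mem_univ, if_true, Finset.sum_const, Finset.card_univ,
    Fintype.card_fin, nsmul_eq_mul]
  have h3 : ∑ x, p x * (a x - μ) ^ 2 = ∑ x, p x * a x ^ 2 - μ ^ 2 := by
    have : ∀ x, p x * (a x - μ) ^ 2 = p x * a x ^ 2 - 2 * μ * (p x * a x) + μ ^ 2 * p x :=
      fun _ => by ring
    simp only [this, Finset.sum_add_distrib, Finset.sum_sub_distrib, ← Finset.mul_sum, hp.2, ← hμ]
    ring
  rw [h3]
  have : (1 / (M : ℝ)) ^ 2 * (M * (∑ x, p x * a x ^ 2 - μ ^ 2)) =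
    (∑ x, p x * a x ^ 2) / M - μ ^ 2 / M := by field_simp
  rw [this]
  have : 0 ≤ μ ^ 2 / M := by positivity
  linarith

variable {U V B T X U' V' B' T' X' Y Y1 Y2 : Type} [Fintype U] [Fintype V] [Fintype B] [Fintype T]
  [Fintype X] [Fintype U'] [Fintype V'] [Fintype B'] [Fintype T'] [Fintype X'] [Fintype Y]
  [Fintype Y1] [Fintype Y2]

/-- The covering cost. -/
noncomputable def SC (S : Usr U V B T X) (M : ℕ) (γ : ℝ) : ℝ :=
  (∑ b, ∑ u, S.pB b * S.ku b u * if γ * S.pU u < S.ku b u then 1 else 0) + Real.sqrt (γ / M)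

theorem Usr.pU_sum (S : Usr U V B T X) : ∑ u, S.pU u = 1 := by
  unfold Usr.pU
  rw [Finset.sum_comm]
  simp only [← Finset.mul_sum, (S.hu _).2, mul_one, S.hB.2]

theorem soft_cover (S : Usr U V B T X) {M N : ℕ} (hM : 0 < M) (hN : 0 < N) (γ : ℝ) (hγ : 0 ≤ γ) :
    Ecb S M N (fun C => ∑ u, max 0 (S.pU u - (1 / (M : ℝ)) * ∑ m, S.ku (C.b m) u)) ≤ SC S M γ := by
  have hE : IsExp (ewt (fun _ : Fin M => S.pB)) := isExp_ewt fun _ => S.hB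
  have h0 : Ecb S M N (fun C => ∑ u, max 0 (S.pU u - (1 / (M : ℝ)) * ∑ m, S.ku (C.b m) u)) =
      ewt (fun _ : Fin M => S.pB) (fun b => ∑ u, max 0 (S.pU u - (1 / (M : ℝ)) *
        ∑ m, S.ku (b m) u)) := by
    have h2 : IsExp (ewt (fun (_ : Fin M × U) (_ : Fin N) => 1 / (N : ℝ))) :=
      isExp_ewt fun _ => unif_pmf hN
    have h3 : IsExp (ewt (fun _ : Fin M × Fin N => S.pT)) := isExp_ewt fun _ => S.hT
    have h4 : IsExp (ewt (fun (i : Fin M × U × T) => S.kx i.2.2)) := isExp_ewt fun i => S.hx _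
    unfold Ecb
    simp only [h2.const, h3.const, h4.const]
  rw [h0, hE.sum]
  have key : ∀ u, ewt (fun _ : Fin M => S.pB) (fun b => max 0 (S.pU u - (1 / (M : ℝ)) *
        ∑ m, S.ku (b m) u)) ≤
      (∑ b, S.pB b * S.ku b u * if γ * S.pU u < S.ku b u then 1 else 0) +
        S.pU u * Real.sqrt (γ / M) := by
    intro u
    set a : B → ℝ := fun b => if γ * S.pU u < S.ku b u then 0 else S.ku b u with ha
    have hab : ∀ b, a b ≤ S.ku b u := by
      intro b; simp only [ha]; split_ifs
      · exact (S.hu b).1 u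
      · exact le_rfl
    have ha0 : ∀ b, 0 ≤ a b := by
      intro b; simp only [ha]; split_ifs
      · exact le_rfl
      · exact (S.hu b).1 u
    have haγ : ∀ b, a b ≤ γ * S.pU u := by
      intro b; simp only [ha]; split_ifs with hh
      · exact mul_nonneg hγ (S.pU_nonneg u)
      · exact not_lt.1 hh
    set μ := ∑ b, S.pB b * a b with hμ
    have hpU : S.pU u = μ + ∑ b, S.pB b * S.ku b u * if γ * S.pU u < S.ku b u then 1 else 0 := by
      rw [hμ, ← Finset.sum_add_distrib]
      conv_lhs => unfold Usr.pU
      refine Finset.sum_congr rfl fun b _ => ?_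
      simp only [ha]; split_ifs <;> ring
    have hpt : ∀ b : Fin M → B, max 0 (S.pU u - (1 / (M : ℝ)) * ∑ m, S.ku (b m) u) ≤
        (∑ b, S.pB b * S.ku b u * if γ * S.pU u < S.ku b u then 1 else 0) +
        |μ - (1 / (M : ℝ)) * ∑ m, a (b m)| := by
      intro b
      have h1 : 0 ≤ ∑ b, S.pB b * S.ku b u * if γ * S.pU u < S.ku b u then (1 : ℝ) else 0 :=
        Finset.sum_nonneg fun b _ => mul_nonneg (mul_nonneg (S.hB.1 _) ((S.hu _).1 _))
          (by split_ifs <;> norm_num)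
      have h2 : (1 / (M : ℝ)) * ∑ m, a (b m) ≤ (1 / (M : ℝ)) * ∑ m, S.ku (b m) u :=
        mul_le_mul_of_nonneg_left (Finset.sum_le_sum fun m _ => hab _) (by positivity)
      have h3 := le_abs_self (μ - (1 / (M : ℝ)) * ∑ m, a (b m))
      have h4 := abs_nonneg (μ - (1 / (M : ℝ)) * ∑ m, a (b m))
      refine max_le (by linarith) ?_
      linarith
    refine (hE.mono hpt).trans ?_
    rw [hE.add, hE.const]
    refine add_le_add le_rfl ((hE.abs_le_sqrt _).trans ?_)
    refine (Real.sqrt_le_sqrt (var_mean S.pB S.hB hM a)).trans ?_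
    have h5 : (∑ x, S.pB x * a x ^ 2) / M ≤ S.pU u ^ 2 * (γ / M) := by
      rw [← mul_div_assoc]
      refine div_le_div_of_nonneg_right ?_ (by positivity)
      calc ∑ x, S.pB x * a x ^ 2 ≤ ∑ x, S.pB x * S.ku x u * (γ * S.pU u) := by
            refine Finset.sum_le_sum fun x _ => ?_
            rw [mul_assoc]
            refine mul_le_mul_of_nonneg_left ?_ (S.hB.1 x)
            rw [sq]
            exact mul_le_mul (hab x) (haγ x) (ha0 x) ((S.hu x).1 u)
        _ = S.pU u ^ 2 * γ := by
            rw [← Finset.sum_mul]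
            change S.pU u * _ = _
            ring
    refine (Real.sqrt_le_sqrt h5).trans (le_of_eq ?_)
    rw [Real.sqrt_mul (sq_nonneg _), Real.sqrt_sq (S.pU_nonneg u)]
  refine (Finset.sum_le_sum fun u _ => key u).trans (le_of_eq ?_)
  rw [Finset.sum_add_distrib, ← Finset.sum_mul, S.pU_sum, one_mul, Finset.sum_comm]
  rfl

/-- Marginal channel. -/
noncomputable def Wm (ρ : Y → Y1) (ch : X → X' → Y → ℝ) (x : X) (x' : X') (y1 : Y1) : ℝ :=
  ∑ y, if ρ y = y1 then ch x x' y else 0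

theorem Wm_push (ρ : Y → Y1) (ch : X → X' → Y → ℝ) (x : X) (x' : X') (F : Y1 → ℝ) :
    ∑ y1, Wm ρ ch x x' y1 * F y1 = ∑ y, ch x x' y * F (ρ y) := by
  unfold Wm
  simp only [Finset.sum_mul]
  rw [Finset.sum_comm]
  refine Finset.sum_congr rfl fun y _ => ?_
  simp [ite_mul]

theorem Wm_pmf (ρ : Y → Y1) (ch : X → X' → Y → ℝ) (hch : ∀ x x', IsPMF (ch x x')) (x : X)
    (x' : X') : IsPMF (Wm ρ ch x x') := by
  refine ⟨fun y1 => Finset.sum_nonneg fun y _ => ?_, ?_⟩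
  · split_ifs
    · exact (hch _ _).1 _
    · exact le_rfl
  · have := Wm_push ρ ch x x' (fun _ => 1)
    simpa [(hch x x').2] using this

/-- Error probability of a one-shot code, with product source laws. -/
noncomputable def Perr1 (S : Usr U V B T X) (S' : Usr U' V' B' T' X') (ch : X → X' → Y → ℝ)
    (ρ : Y → Y1) (ρ' : Y → Y2) (f : U → X) (f' : U' → X') (g : Y1 → V' → U) (g' : Y2 → V → U') :
    ℝ := ∑ u, ∑ v, ∑ u', ∑ v', ∑ y, (S.pU u * S.kv u v) * (S'.pU u' * S'.kv u' v') *
      ch (f u) (f' u') y * (if g (ρ y) v' = u ∧ g' (ρ' y) v = u' then 0 else 1)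

theorem one_shot [Nonempty U] [Nonempty U'] (S : Usr U V B T X) (S' : Usr U' V' B' T' X')
    (ch : X → X' → Y → ℝ) (hch : ∀ x x', IsPMF (ch x x'))
    (ρ : Y → Y1) (ρ' : Y → Y2) {M N M' N' : ℕ} (hM : 0 < M) (hN : 0 < N) (hM' : 0 < M')
    (hN' : 0 < N') (δ γ γ' : ℝ) (hδ : 0 ≤ δ) (hγ : 0 ≤ γ) (hγ' : 0 ≤ γ') :
    ∃ f f' g g', Perr1 S S' ch ρ ρ' f f' g g' ≤ SC S M γ + SC S' M' γ' +
      ((Bad S S' (Wm ρ ch) M N M' N' δ + δ) +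
       (Bad S' S (Wm ρ' (fun x' x => ch x x')) M' N' M N δ + δ)) := by
  set W := Wm ρ ch with hW
  set W' := Wm ρ' (fun x' x => ch x x') with hW'
  have hWp : ∀ x x', IsPMF (W x x') := Wm_pmf ρ ch hch
  have hWp' : ∀ x x', IsPMF (W' x x') := Wm_pmf ρ' _ fun x' x => hch x x'
  have hE := isExp_Ecb S M hN
  have hE' := isExp_Ecb S' M' hN'
  have hkv := fun t => (S.hv t).1
  have hku := fun t => (S.hu t).1
  have hku' := fun t => (S'.hu t).1
  have hkv' := fun t => (S'.hv t).1
  -- conditional error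
  set er : CB M N U B T X → CB M' N' U' B' T' X' → U → Fin M → U' → Fin M' → ℝ :=
    fun C C' u m u' m' => ∑ v, ∑ v', ∑ y, S.kv u v * S'.kv u' v' *
      ch (C.xx m u) (C'.xx m' u') y *
      (if gdec S S' W δ C C' (ρ y) v' = u ∧ gdec S' S W' δ C' C (ρ' y) v = u' then 0 else 1)
    with her
  have her0 : ∀ C C' u m u' m', 0 ≤ er C C' u m u' m' := by
    intro C C' u m u' m'
    refine Finset.sum_nonneg fun v _ => Finset.sum_nonneg fun v' _ => Finset.sum_nonneg fun y _ => ?_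
    refine mul_nonneg (mul_nonneg (mul_nonneg (hkv _ _) (hkv' _ _)) ((hch _ _).1 _)) ?_
    split_ifs <;> norm_num
  have her1 : ∀ C C' u m u' m', er C C' u m u' m' ≤ 1 := by
    intro C C' u m u' m'
    have : er C C' u m u' m' ≤ ∑ v, ∑ v', ∑ y, S.kv u v * S'.kv u' v' *
        ch (C.xx m u) (C'.xx m' u') y := by
      refine Finset.sum_le_sum fun v _ => Finset.sum_le_sum fun v' _ => Finset.sum_le_sum fun y _ => ?_
      refine mul_le_of_le_one_right
        (mul_nonneg (mul_nonneg (hkv _ _) (hkv' _ _)) ((hch _ _).1 _)) ?_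
      split_ifs <;> norm_num
    refine this.trans (le_of_eq ?_)
    simp only [← Finset.mul_sum, (hch _ _).2, mul_one, (S'.hv _).2, (S.hv _).2]
  have hersplit : ∀ C C' u m u' m', er C C' u m u' m' ≤
      (∑ v', ∑ y, S'.kv u' v' * W (C.xx m u) (C'.xx m' u') y *
        if gdec S S' W δ C C' y v' = u then 0 else 1) +
      (∑ v, ∑ y, S.kv u v * W' (C'.xx m' u') (C.xx m u) y *
        if gdec S' S W' δ C' C y v = u' then 0 else 1) := by
    intro C C' u m u' m'
    have h1 : ∀ v', ∑ y, S'.kv u' v' * W (C.xx m u) (C'.xx m' u') y *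
        (if gdec S S' W δ C C' y v' = u then (0 : ℝ) else 1) =
        ∑ y, S'.kv u' v' * (ch (C.xx m u) (C'.xx m' u') y *
          (if gdec S S' W δ C C' (ρ y) v' = u then (0 : ℝ) else 1)) := by
      intro v'
      simp only [mul_assoc]
      rw [← Finset.mul_sum, ← Finset.mul_sum, hW, Wm_push ρ ch _ _
        (fun y => if gdec S S' W δ C C' y v' = u then (0 : ℝ) else 1)]
    have h2 : ∀ v, ∑ y, S.kv u v * W' (C'.xx m' u') (C.xx m u) y *
        (if gdec S' S W' δ C' C y v = u' then (0 : ℝ) else 1) =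
        ∑ y, S.kv u v * (ch (C.xx m u) (C'.xx m' u') y *
          (if gdec S' S W' δ C' C (ρ' y) v = u' then (0 : ℝ) else 1)) := by
      intro v
      simp only [mul_assoc]
      rw [← Finset.mul_sum, ← Finset.mul_sum, hW', Wm_push ρ' _ _ _
        (fun y => if gdec S' S W' δ C' C y v = u' then (0 : ℝ) else 1)]
    simp only [h1, h2]
    have h3 : ∑ v', ∑ y, S'.kv u' v' * (ch (C.xx m u) (C'.xx m' u') y *
          (if gdec S S' W δ C C' (ρ y) v' = u then (0 : ℝ) else 1)) =
        ∑ v, ∑ v', ∑ y, S.kv u v * (S'.kv u' v' * (ch (C.xx m u) (C'.xx m' u') y *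
          (if gdec S S' W δ C C' (ρ y) v' = u then (0 : ℝ) else 1))) := by
      simp only [← Finset.mul_sum]
      rw [← Finset.sum_mul, (S.hv u).2, one_mul]
    have h4 : ∑ v, ∑ y, S.kv u v * (ch (C.xx m u) (C'.xx m' u') y *
          (if gdec S' S W' δ C' C (ρ' y) v = u' then (0 : ℝ) else 1)) =
        ∑ v, ∑ v', ∑ y, S'.kv u' v' * (S.kv u v * (ch (C.xx m u) (C'.xx m' u') y *
          (if gdec S' S W' δ C' C (ρ' y) v = u' then (0 : ℝ) else 1))) := by
      simp only [← Finset.mul_sum]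
      refine Finset.sum_congr rfl fun v _ => ?_
      rw [← Finset.sum_mul, (S'.hv u').2, one_mul]
    rw [h3, h4]
    simp only [← Finset.sum_add_distrib]
    refine Finset.sum_le_sum fun v _ => Finset.sum_le_sum fun v' _ => Finset.sum_le_sum fun y _ => ?_
    have h5 : 0 ≤ S.kv u v * S'.kv u' v' * ch (C.xx m u) (C'.xx m' u') y :=
      mul_nonneg (mul_nonneg (hkv _ _) (hkv' _ _)) ((hch _ _).1 _)
    have h6 : (if gdec S S' W δ C C' (ρ y) v' = u ∧ gdec S' S W' δ C' C (ρ' y) v = u' then (0 : ℝ)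
        else 1) ≤ (if gdec S S' W δ C C' (ρ y) v' = u then (0 : ℝ) else 1) +
        (if gdec S' S W' δ C' C (ρ' y) v = u' then (0 : ℝ) else 1) := by
      by_cases ha : gdec S S' W δ C C' (ρ y) v' = u <;>
      by_cases hb : gdec S' S W' δ C' C (ρ' y) v = u' <;> simp [ha, hb]
    refine (mul_le_mul_of_nonneg_left h6 h5).trans (le_of_eq (by ring))
  -- derandomised source maps
  set D : CB M N U B T X → ℝ := fun C =>
    ∑ u, max 0 (S.pU u - (1 / (M : ℝ)) * ∑ m, S.ku (C.b m) u) with hD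
  set D' : CB M' N' U' B' T' X' → ℝ := fun C =>
    ∑ u, max 0 (S'.pU u - (1 / (M' : ℝ)) * ∑ m, S'.ku (C.b m) u) with hD'
  have hMR : (M : ℝ) ≠ 0 := by positivity
  have hMR' : (M' : ℝ) ≠ 0 := by positivity
  have hder : ∀ C C', ∃ f f' g g', Perr1 S S' ch ρ ρ' f f' g g' ≤
      (1 / (M : ℝ)) * ∑ m, (1 / (M' : ℝ)) * ∑ m', (∑ u, ∑ u', S.ku (C.b m) u * S'.ku (C'.b m') u' *
        er C C' u m u' m') + D C + D' C' := by
    intro C C'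
    obtain ⟨φ, hφ⟩ := argmin_derand hM S.pU (fun m u => S.ku (C.b m) u) (fun m u => hku _ _)
      (fun u m => (1 / (M' : ℝ)) * ∑ m', ∑ u', S'.ku (C'.b m') u' * er C C' u m u' m')
      (fun u m => mul_nonneg (by positivity) (Finset.sum_nonneg fun m' _ => Finset.sum_nonneg
        fun u' _ => mul_nonneg (hku' _ _) (her0 _ _ _ _ _ _))) (fun u m => by
        have : ∑ m', ∑ u', S'.ku (C'.b m') u' * er C C' u m u' m' ≤ M' := by
          have : ∀ m', ∑ u', S'.ku (C'.b m') u' * er C C' u m u' m' ≤ 1 := fun m' => by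
            rw [← (S'.hu (C'.b m')).2]
            exact Finset.sum_le_sum fun u' _ => mul_le_of_le_one_right (hku' _ _) (her1 _ _ _ _ _ _)
          refine (Finset.sum_le_sum fun m' _ => this m').trans ?_
          simp
        calc _ ≤ (1 / (M' : ℝ)) * M' := mul_le_mul_of_nonneg_left this (by positivity)
          _ = 1 := by field_simp)
    obtain ⟨φ', hφ'⟩ := argmin_derand hM' S'.pU (fun m u => S'.ku (C'.b m) u) (fun m u => hku' _ _)
      (fun u' m' => ∑ u, S.pU u * er C C' u (φ u) u' m')
      (fun u m => Finset.sum_nonneg fun u' _ => mul_nonneg (S.pU_nonneg _) (her0 _ _ _ _ _ _))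
      (fun u m => by
        rw [← S.pU_sum]
        exact Finset.sum_le_sum fun u' _ => mul_le_of_le_one_right (S.pU_nonneg _)
          (her1 _ _ _ _ _ _))
    refine ⟨fun u => C.xx (φ u) u, fun u => C'.xx (φ' u) u, gdec S S' W δ C C',
      gdec S' S W' δ C' C, ?_⟩
    have e1 : Perr1 S S' ch ρ ρ' (fun u => C.xx (φ u) u) (fun u => C'.xx (φ' u) u)
        (gdec S S' W δ C C') (gdec S' S W' δ C' C) =
        ∑ u', S'.pU u' * ∑ u, S.pU u * er C C' u (φ u) u' (φ' u') := by
      simp only [Finset.mul_sum]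
      rw [Finset.sum_comm]
      unfold Perr1
      refine Finset.sum_congr rfl fun u _ => ?_
      rw [Finset.sum_comm]
      refine Finset.sum_congr rfl fun u' _ => ?_
      simp only [her, Finset.mul_sum]
      exact Finset.sum_congr rfl fun _ _ => Finset.sum_congr rfl fun _ _ =>
        Finset.sum_congr rfl fun _ _ => by ring
    have e2 : (1 / (M' : ℝ)) * ∑ m', ∑ u', S'.ku (C'.b m') u' *
        ∑ u, S.pU u * er C C' u (φ u) u' m' = ∑ u, S.pU u * ((1 / (M' : ℝ)) *
          ∑ m', ∑ u', S'.ku (C'.b m') u' * er C C' u (φ u) u' m') := by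
      simp only [Finset.mul_sum]
      rw [Finset.sum_comm' (t' := Finset.univ) (s' := fun _ => Finset.univ) (by simp)]
      have : ∀ m', ∑ u', ∑ u, (1 / (M' : ℝ)) * (S'.ku (C'.b m') u' *
          (S.pU u * er C C' u (φ u) u' m')) =
        ∑ u, ∑ u', (1 / (M' : ℝ)) * (S'.ku (C'.b m') u' *
          (S.pU u * er C C' u (φ u) u' m')) := fun m' => Finset.sum_comm
      rw [Finset.sum_comm]
      simp only [this]
      rw [Finset.sum_comm]
      exact Finset.sum_congr rfl fun _ _ => Finset.sum_congr rfl fun _ _ =>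
        Finset.sum_congr rfl fun _ _ => by ring
    have e3 : (1 / (M : ℝ)) * ∑ m, ∑ u, S.ku (C.b m) u * ((1 / (M' : ℝ)) * ∑ m', ∑ u',
        S'.ku (C'.b m') u' * er C C' u m u' m') =
        (1 / (M : ℝ)) * ∑ m, (1 / (M' : ℝ)) * ∑ m', (∑ u, ∑ u', S.ku (C.b m) u *
          S'.ku (C'.b m') u' * er C C' u m u' m') := by
      congr 1
      refine Finset.sum_congr rfl fun m _ => ?_
      simp only [Finset.mul_sum]
      rw [Finset.sum_comm]
      exact Finset.sum_congr rfl fun _ _ => Finset.sum_congr rfl fun _ _ =>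
        Finset.sum_congr rfl fun _ _ => by ring
    rw [e1]
    beta_reduce at hφ hφ'
    rw [e2] at hφ'
    rw [e3] at hφ
    simp only [hD, hD']
    linarith
  -- average over codebooks
  have hav : Ecb S M N (fun C => Ecb S' M' N' (fun C' =>
      (1 / (M : ℝ)) * ∑ m, (1 / (M' : ℝ)) * ∑ m', (∑ u, ∑ u', S.ku (C.b m) u * S'.ku (C'.b m') u' *
        er C C' u m u' m') + D C + D' C')) ≤ SC S M γ + SC S' M' γ' +
      ((Bad S S' W M N M' N' δ + δ) + (Bad S' S W' M' N' M N δ + δ)) := by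
    simp only [hE'.add, hE.add, hE'.const, hE.const]
    have c1 : Ecb S M N D ≤ SC S M γ := soft_cover S hM hN γ hγ
    have c2 : Ecb S' M' N' D' ≤ SC S' M' γ' := soft_cover S' hM' hN' γ' hγ'
    have c3 : Ecb S M N (fun C => Ecb S' M' N' (fun C' =>
      (1 / (M : ℝ)) * ∑ m, (1 / (M' : ℝ)) * ∑ m', (∑ u, ∑ u', S.ku (C.b m) u * S'.ku (C'.b m') u' *
        er C C' u m u' m'))) ≤
        (Bad S S' W M N M' N' δ + δ) + (Bad S' S W' M' N' M N δ + δ) := by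
      simp only [hE'.smul, hE.smul, hE'.sum, hE.sum]
      set R := (Bad S S' W M N M' N' δ + δ) + (Bad S' S W' M' N' M N δ + δ) with hR
      have hmm : ∀ m m', ∑ u, ∑ u', Ecb S M N (fun C => Ecb S' M' N' (fun C' =>
          S.ku (C.b m) u * S'.ku (C'.b m') u' * er C C' u m u' m')) ≤ R := by
        intro m m'
        have r1 := recv S S' W hWp hN hN' δ hδ m m'
        have r2 := recv S' S W' hWp' hN' hN δ hδ m' m
        rw [hE'.comm hE] at r2
        refine le_trans ?_ (add_le_add r1 r2)
        rw [← hE.add]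
        simp only [← hE'.add, ← hE.sum, ← hE'.sum]
        refine hE.mono fun C => hE'.mono fun C' => ?_
        refine (Finset.sum_le_sum fun u _ => Finset.sum_le_sum fun u' _ =>
          mul_le_mul_of_nonneg_left (hersplit C C' u m u' m')
            (mul_nonneg (hku _ _) (hku' _ _))).trans (le_of_eq ?_)
        simp only [mul_add, Finset.sum_add_distrib, Finset.mul_sum]
        congr 1
        · have q1 : ∀ u, ∑ u', ∑ v', ∑ y, S.ku (C.b m) u * S'.ku (C'.b m') u' *
              (S'.kv u' v' * W (C.xx m u) (C'.xx m' u') y *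
              if gdec S S' W δ C C' y v' = u then 0 else 1) = ∑ v', ∑ y, ∑ u',
              S.ku (C.b m) u * S'.ku (C'.b m') u' *
              (S'.kv u' v' * W (C.xx m u) (C'.xx m' u') y *
              if gdec S S' W δ C C' y v' = u then 0 else 1) := by
            intro u
            rw [Finset.sum_comm]
            refine Finset.sum_congr rfl fun _ _ => ?_
            rw [Finset.sum_comm]
          simp only [q1]
          rw [Finset.sum_comm]
          refine Finset.sum_congr rfl fun _ _ => ?_
          rw [Finset.sum_comm]
          refine Finset.sum_congr rfl fun _ _ => Finset.sum_congr rfl fun _ _ =>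
            Finset.sum_congr rfl fun _ _ => ?_
          ring
        · rw [Finset.sum_comm]
          have q1 : ∀ u', ∑ u, ∑ v, ∑ y, S.ku (C.b m) u * S'.ku (C'.b m') u' *
              (S.kv u v * W' (C'.xx m' u') (C.xx m u) y *
              if gdec S' S W' δ C' C y v = u' then 0 else 1) = ∑ v, ∑ y, ∑ u,
              S.ku (C.b m) u * S'.ku (C'.b m') u' *
              (S.kv u v * W' (C'.xx m' u') (C.xx m u) y *
              if gdec S' S W' δ C' C y v = u' then 0 else 1) := by
            intro u
            rw [Finset.sum_comm]
            refine Finset.sum_congr rfl fun _ _ => ?_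
            rw [Finset.sum_comm]
          simp only [q1]
          rw [Finset.sum_comm]
          refine Finset.sum_congr rfl fun _ _ => ?_
          rw [Finset.sum_comm]
          refine Finset.sum_congr rfl fun _ _ => Finset.sum_congr rfl fun _ _ =>
            Finset.sum_congr rfl fun _ _ => ?_
          ring
      calc _ ≤ (1 / (M : ℝ)) * ∑ _m : Fin M, (1 / (M' : ℝ)) * ∑ _m' : Fin M', R := by
            refine mul_le_mul_of_nonneg_left (Finset.sum_le_sum fun m _ =>
              mul_le_mul_of_nonneg_left (Finset.sum_le_sum fun m' _ => hmm m m') ?_) ?_ <;>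
              positivity
        _ = R := by
            simp only [Finset.sum_const, Finset.card_univ, Fintype.card_fin, nsmul_eq_mul]
            field_simp
    linarith
  obtain ⟨C, hC⟩ := hE.exists_le hav
  obtain ⟨C', hC'⟩ := hE'.exists_le hC
  obtain ⟨f, f', g, g', hh⟩ := hder C C'
  exact ⟨f, f', g, g', hh.trans hC'⟩

end OneShot

set_option linter.unusedSectionVars false
section NLetter
variable {U V B T X U' V' B' T' X' Y Y1 Y2 Q : Type} [Fintype U] [Fintype V] [Fintype B] [Fintype T]
  [Fintype X] [Fintype U'] [Fintype V'] [Fintype B'] [Fintype T'] [Fintype X'] [Fintype Y]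
  [Fintype Y1] [Fintype Y2] [Fintype Q]

namespace Usr
/-- Input law of the false candidates, own user. -/
noncomputable def kap (S : Usr U V B T X) (c : Fin 2) (t : T) (x : X) : ℝ :=
  if c = 0 then S.kx t x else S.pX x
/-- Input law of the false candidates, interfering user. -/
noncomputable def kap2 (S : Usr U V B T X) (c : Fin 3) (t : T) (x : X) : ℝ :=
  if c = 0 then S.kx t x else S.pX x
/-- Description law of the false candidates, interfering user. -/
noncomputable def bet (S : Usr U V B T X) (c : Fin 3) (b : B) (v : V) : ℝ :=
  if c = 2 then S.pB b * S.pV v else S.pBV b v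

theorem kap_nonneg (S : Usr U V B T X) (c : Fin 2) (t : T) (x : X) : 0 ≤ S.kap c t x := by
  unfold kap; split_ifs
  · exact (S.hx t).1 x
  · exact S.pX_nonneg x
theorem kap2_nonneg (S : Usr U V B T X) (c : Fin 3) (t : T) (x : X) : 0 ≤ S.kap2 c t x := by
  unfold kap2; split_ifs
  · exact (S.hx t).1 x
  · exact S.pX_nonneg x
theorem bet_nonneg (S : Usr U V B T X) (c : Fin 3) (b : B) (v : V) : 0 ≤ S.bet c b v := by
  unfold bet; split_ifs
  · exact mul_nonneg (S.hB.1 b) (S.pV_nonneg v)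
  · exact S.pBV_nonneg b v
end Usr

noncomputable def KK1 (M N : ℕ) (c : Fin 2) : ℝ := if c = 0 then 1 / (N : ℝ) else 1 + M
noncomputable def KK2 (M N : ℕ) (c : Fin 3) : ℝ :=
  if c = 0 then 1 else if c = 1 then N else M * N

theorem KK1_nonneg (M N : ℕ) (c : Fin 2) : 0 ≤ KK1 M N c := by
  unfold KK1; split_ifs <;> positivity
theorem KK2_nonneg (M N : ℕ) (c : Fin 3) : 0 ≤ KK2 M N c := by
  unfold KK2; split_ifs <;> positivity

/-- Reference measure of one type of false candidates. -/
noncomputable def RR (S : Usr U V B T X) (S' : Usr U' V' B' T' X') (W : X → X' → Y → ℝ)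
    (c : Fin 2) (c' : Fin 3)
    (b : B) (t : T) (x : X) (b' : B') (v' : V') (t' : T') (y : Y) : ℝ :=
  S.pB b * S.pT t * S.kx t x * (S'.pT t' * S'.bet c' b' v') *
    ∑ z, ∑ z', S.kap c t z * S'.kap2 c' t' z' * W z z' y

theorem RR_nonneg (S : Usr U V B T X) (S' : Usr U' V' B' T' X') (W : X → X' → Y → ℝ)
    (hW : ∀ x x', IsPMF (W x x')) (c : Fin 2) (c' : Fin 3)
    (b : B) (t : T) (x : X) (b' : B') (v' : V') (t' : T') (y : Y) :
    0 ≤ RR S S' W c c' b t x b' v' t' y := by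
  unfold RR
  refine mul_nonneg (mul_nonneg (mul_nonneg (mul_nonneg (S.hB.1 _) (S.hT.1 _)) ((S.hx _).1 _))
    (mul_nonneg (S'.hT.1 _) (S'.bet_nonneg _ _ _))) ?_
  exact Finset.sum_nonneg fun _ _ => Finset.sum_nonneg fun _ _ =>
    mul_nonneg (mul_nonneg (S.kap_nonneg _ _ _) (S'.kap2_nonneg _ _ _)) ((hW _ _).1 _)

theorem Pa_nonneg (S : Usr U V B T X) (S' : Usr U' V' B' T' X') (W : X → X' → Y → ℝ)
    (hW : ∀ x x', IsPMF (W x x'))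
    (u : U) (b : B) (t : T) (x : X) (b' : B') (v' : V') (t' : T') (y : Y) :
    0 ≤ Pa S S' W u b t x b' v' t' y := by
  unfold Pa
  exact mul_nonneg (mul_nonneg (mul_nonneg (mul_nonneg (mul_nonneg (mul_nonneg (S.hB.1 _)
    ((S.hu _).1 _)) (S.hT.1 _)) ((S.hx _).1 _)) (S'.pBV_nonneg _ _)) (S'.hT.1 _))
    (Finset.sum_nonneg fun _ _ => mul_nonneg ((S'.hx _).1 _) ((hW _ _).1 _))

theorem Rtot_eq (S : Usr U V B T X) (S' : Usr U' V' B' T' X') (W : X → X' → Y → ℝ)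
    (M N M' N' : ℕ) (b : B) (t : T) (x : X) (b' : B') (v' : V') (t' : T') (y : Y) :
    Rtot S S' W M N M' N' b t x b' v' t' y =
      ∑ c : Fin 2 × Fin 3, KK1 M N c.1 * KK2 M' N' c.2 * RR S S' W c.1 c.2 b t x b' v' t' y := by
  unfold Rtot RR
  simp only [Finset.mul_sum]
  rw [Finset.sum_comm (s := (Finset.univ : Finset (Fin 2 × Fin 3)))]
  refine Finset.sum_congr rfl fun z _ => ?_
  rw [Finset.sum_comm (s := (Finset.univ : Finset (Fin 2 × Fin 3)))]
  refine Finset.sum_congr rfl fun z' _ => ?_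
  rw [Fintype.sum_prod_type]
  simp [Fin.sum_univ_succ, KK1, KK2, Usr.kap, Usr.kap2, Usr.bet, Usr.Q1, Usr.Q2]
  ring

theorem union_ind {ι : Type} [Fintype ι] [Nonempty ι] (x : ι → ℝ) (hx : ∀ i, 0 ≤ x i) (P : ℝ)
    (hP : 0 < P) (h : P < ∑ i, x i) (s : ι → ℝ) (hs : ∀ i, 0 ≤ s i) :
    1 ≤ ∑ i, (Fintype.card ι * x i / P) ^ s i := by
  have hc : (0 : ℝ) < Fintype.card ι := by exact_mod_cast Fintype.card_pos
  have : ∃ i, P / Fintype.card ι ≤ x i := by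
    by_contra! hh
    have h2 : ∑ i, x i ≤ ∑ _i : ι, P / Fintype.card ι := Finset.sum_le_sum fun i _ => (hh i).le
    rw [Finset.sum_const, Finset.card_univ, nsmul_eq_mul, mul_div_cancel₀ _ hc.ne'] at h2
    linarith
  obtain ⟨i, hi⟩ := this
  have h1 : 1 ≤ Fintype.card ι * x i / P := by
    rw [le_div_iff₀ hP, one_mul]
    rw [div_le_iff₀ hc] at hi
    linarith
  refine (Real.one_le_rpow h1 (hs i)).trans ?_
  exact Finset.single_le_sum (f := fun i => (Fintype.card ι * x i / P) ^ s i)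
    (fun j _ => Real.rpow_nonneg (div_nonneg (mul_nonneg hc.le (hx j)) hP.le) _) (Finset.mem_univ i)

theorem Bad_eq (S : Usr U V B T X) (S' : Usr U' V' B' T' X') (W : X → X' → Y → ℝ)
    (M N M' N' : ℕ) (δ : ℝ) : Bad S S' W M N M' N' δ =
    ∑ v', ∑ y, ∑ u, ∑ b, ∑ t, ∑ x, ∑ b', ∑ t', Pa S S' W u b t x b' v' t' y *
      if Good S S' W M N M' N' δ u b t x b' v' t' y then 0 else 1 := by
  unfold Bad
  refine Finset.sum_congr rfl fun v' _ => Finset.sum_congr rfl fun y _ =>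
    Finset.sum_congr rfl fun u _ => ?_
  rw [Finset.sum_comm]; refine Finset.sum_congr rfl fun b _ => ?_
  rw [Finset.sum_comm]; refine Finset.sum_congr rfl fun t _ => ?_
  rw [Finset.sum_comm]; refine Finset.sum_congr rfl fun x _ => ?_
  rw [Finset.sum_comm]; refine Finset.sum_congr rfl fun b' _ => ?_
  rw [Finset.sum_comm]; refine Finset.sum_congr rfl fun t' _ => ?_
  unfold Pa Usr.pBV
  simp only [Finset.mul_sum, Finset.sum_mul]
  rw [Finset.sum_comm]
  exact Finset.sum_congr rfl fun _ _ => Finset.sum_congr rfl fun _ _ => by ring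

/-- Chernoff moment. -/
noncomputable def mom (S : Usr U V B T X) (S' : Usr U' V' B' T' X') (W : X → X' → Y → ℝ)
    (c : Fin 2) (c' : Fin 3) (s : ℝ) : ℝ :=
  ∑ v', ∑ y, ∑ u, ∑ b, ∑ t, ∑ x, ∑ b', ∑ t', Pa S S' W u b t x b' v' t' y *
    (RR S S' W c c' b t x b' v' t' y / Pa S S' W u b t x b' v' t' y) ^ s

theorem Bad_le (S : Usr U V B T X) (S' : Usr U' V' B' T' X') (W : X → X' → Y → ℝ)
    (hW : ∀ x x', IsPMF (W x x')) (M N M' N' : ℕ) (δ : ℝ) (hδ : 0 < δ)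
    (s : Fin 2 × Fin 3 → ℝ) (hs : ∀ c, 0 ≤ s c) : Bad S S' W M N M' N' δ ≤
    ∑ c : Fin 2 × Fin 3, (6 * (KK1 M N c.1 * KK2 M' N' c.2) / δ) ^ s c *
      mom S S' W c.1 c.2 (s c) := by
  rw [Bad_eq]
  unfold mom
  simp only [Finset.mul_sum]
  rw [Finset.sum_comm (s := (Finset.univ : Finset (Fin 2 × Fin 3)))]; refine Finset.sum_le_sum fun v' _ => ?_
  rw [Finset.sum_comm (s := (Finset.univ : Finset (Fin 2 × Fin 3)))]; refine Finset.sum_le_sum fun y _ => ?_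
  rw [Finset.sum_comm (s := (Finset.univ : Finset (Fin 2 × Fin 3)))]; refine Finset.sum_le_sum fun u _ => ?_
  rw [Finset.sum_comm (s := (Finset.univ : Finset (Fin 2 × Fin 3)))]; refine Finset.sum_le_sum fun b _ => ?_
  rw [Finset.sum_comm (s := (Finset.univ : Finset (Fin 2 × Fin 3)))]; refine Finset.sum_le_sum fun t _ => ?_
  rw [Finset.sum_comm (s := (Finset.univ : Finset (Fin 2 × Fin 3)))]; refine Finset.sum_le_sum fun x _ => ?_
  rw [Finset.sum_comm (s := (Finset.univ : Finset (Fin 2 × Fin 3)))]; refine Finset.sum_le_sum fun b' _ => ?_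
  rw [Finset.sum_comm (s := (Finset.univ : Finset (Fin 2 × Fin 3)))]; refine Finset.sum_le_sum fun t' _ => ?_
  set P := Pa S S' W u b t x b' v' t' y with hP
  have hP0 : 0 ≤ P := Pa_nonneg S S' W hW _ _ _ _ _ _ _ _
  have hR : ∀ c : Fin 2 × Fin 3, 0 ≤ RR S S' W c.1 c.2 b t x b' v' t' y := fun c =>
    RR_nonneg S S' W hW _ _ _ _ _ _ _ _ _
  have hK : ∀ c : Fin 2 × Fin 3, 0 ≤ KK1 M N c.1 * KK2 M' N' c.2 := fun c =>
    mul_nonneg (KK1_nonneg _ _ _) (KK2_nonneg _ _ _)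
  have hfac : ∀ c : Fin 2 × Fin 3, (6 * (KK1 M N c.1 * KK2 M' N' c.2) / δ) ^ s c *
      (P * (RR S S' W c.1 c.2 b t x b' v' t' y / P) ^ s c) =
      P * ((6 * (KK1 M N c.1 * KK2 M' N' c.2) / δ) * (RR S S' W c.1 c.2 b t x b' v' t' y / P)) ^ s c := by
    intro c
    rw [Real.mul_rpow (div_nonneg (mul_nonneg (by norm_num) (hK c)) hδ.le) (div_nonneg (hR c) hP0)]
    ring
  simp only [hfac]
  rw [← Finset.mul_sum]
  rcases hP0.eq_or_lt with hP1 | hP1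
  · rw [← hP1, zero_mul, zero_mul]
  refine mul_le_mul_of_nonneg_left ?_ hP0
  have hnn : 0 ≤ ∑ c : Fin 2 × Fin 3, ((6 * (KK1 M N c.1 * KK2 M' N' c.2) / δ) *
      (RR S S' W c.1 c.2 b t x b' v' t' y / P)) ^ s c :=
    Finset.sum_nonneg fun c _ => Real.rpow_nonneg (mul_nonneg (div_nonneg (mul_nonneg (by norm_num)
      (hK c)) hδ.le) (div_nonneg (hR c) hP0)) _
  split_ifs with hg
  · exact hnn
  unfold Good at hg
  rw [not_le, Rtot_eq] at hg
  have := union_ind (fun c : Fin 2 × Fin 3 => KK1 M N c.1 * KK2 M' N' c.2 *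
    RR S S' W c.1 c.2 b t x b' v' t' y) (fun c => mul_nonneg (hK c) (hR c)) _ (mul_pos hδ hP1) hg s hs
  refine this.trans (le_of_eq (Finset.sum_congr rfl fun c _ => ?_))
  congr 1
  simp only [Fintype.card_prod, Fintype.card_fin]
  push_cast
  field_simp

/-! ### Memoryless extension -/

theorem ipmf {n : ℕ} {A : Type} [Fintype A] (p : Fin n → A → ℝ) (hp : ∀ i, IsPMF (p i)) :
    IsPMF (fun a : Fin n → A => ∏ i, p i (a i)) :=
  ⟨fun _ => Finset.prod_nonneg fun i _ => (hp i).1 _, E0 p fun i => (hp i).2⟩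

/-- Memoryless extension of user data. -/
noncomputable def Usr.pow {n : ℕ} (S : Fin n → Usr U V B T X) :
    Usr (Fin n → U) (Fin n → V) (Fin n → B) (Fin n → T) (Fin n → X) where
  pB b := ∏ i, (S i).pB (b i)
  ku b u := ∏ i, (S i).ku (b i) (u i)
  kv u v := ∏ i, (S i).kv (u i) (v i)
  pT t := ∏ i, (S i).pT (t i)
  kx t x := ∏ i, (S i).kx (t i) (x i)
  hB := ipmf _ fun i => (S i).hB
  hu b := ipmf (fun i => (S i).ku (b i)) fun i => (S i).hu _
  hv u := ipmf (fun i => (S i).kv (u i)) fun i => (S i).hv _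
  hT := ipmf _ fun i => (S i).hT
  hx t := ipmf (fun i => (S i).kx (t i)) fun i => (S i).hx _

variable {n : ℕ} (S : Fin n → Usr U V B T X) (S' : Fin n → Usr U' V' B' T' X')

theorem pow_pU (u : Fin n → U) : (Usr.pow S).pU u = ∏ i, (S i).pU (u i) := by
  unfold Usr.pU
  rw [← prodsum (fun i b => (S i).pB b * (S i).ku b (u i))]
  simp only [Finset.prod_mul_distrib]
  rfl

theorem pow_pX (x : Fin n → X) : (Usr.pow S).pX x = ∏ i, (S i).pX (x i) := by
  unfold Usr.pX
  rw [← prodsum (fun i t => (S i).pT t * (S i).kx t (x i))]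
  simp only [Finset.prod_mul_distrib]
  rfl

theorem pow_pBV (b : Fin n → B) (v : Fin n → V) :
    (Usr.pow S).pBV b v = ∏ i, (S i).pBV (b i) (v i) := by
  unfold Usr.pBV
  rw [← prodsum (fun i u => (S i).pB (b i) * (S i).ku (b i) u * (S i).kv u (v i))]
  simp only [Finset.prod_mul_distrib]
  rfl

theorem pow_pV (v : Fin n → V) : (Usr.pow S).pV v = ∏ i, (S i).pV (v i) := by
  unfold Usr.pV
  rw [← prodsum (fun i b => (S i).pBV b (v i))]
  simp only [pow_pBV]

theorem pow_kap (c : Fin 2) (t : Fin n → T) (x : Fin n → X) :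
    (Usr.pow S).kap c t x = ∏ i, (S i).kap c (t i) (x i) := by
  unfold Usr.kap
  split_ifs
  · rfl
  · exact pow_pX S x

theorem pow_kap2 (c : Fin 3) (t : Fin n → T) (x : Fin n → X) :
    (Usr.pow S).kap2 c t x = ∏ i, (S i).kap2 c (t i) (x i) := by
  unfold Usr.kap2
  split_ifs
  · rfl
  · exact pow_pX S x

theorem pow_bet (c : Fin 3) (b : Fin n → B) (v : Fin n → V) :
    (Usr.pow S).bet c b v = ∏ i, (S i).bet c (b i) (v i) := by
  unfold Usr.bet
  split_ifs
  · rw [Finset.prod_mul_distrib, pow_pV]; rfl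
  · exact pow_pBV S b v

/-- Memoryless channel. -/
def Wpow (n : ℕ) (W : X → X' → Y → ℝ) (x : Fin n → X) (x' : Fin n → X') (y : Fin n → Y) : ℝ :=
  ∏ i, W (x i) (x' i) (y i)

theorem Wpow_pmf (n : ℕ) (W : X → X' → Y → ℝ) (hW : ∀ x x', IsPMF (W x x')) (x : Fin n → X)
    (x' : Fin n → X') : IsPMF (Wpow n W x x') :=
  ipmf (fun i => W (x i) (x' i)) fun i => hW _ _

theorem pow_Pa (W : X → X' → Y → ℝ) (u : Fin n → U) (b : Fin n → B) (t : Fin n → T)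
    (x : Fin n → X) (b' : Fin n → B') (v' : Fin n → V') (t' : Fin n → T') (y : Fin n → Y) :
    Pa (Usr.pow S) (Usr.pow S') (Wpow n W) u b t x b' v' t' y =
      ∏ i, Pa (S i) (S' i) W (u i) (b i) (t i) (x i) (b' i) (v' i) (t' i) (y i) := by
  unfold Pa
  simp only [Finset.prod_mul_distrib]
  rw [pow_pBV, ← prodsum (fun i x' => (S' i).kx (t' i) x' * W (x i) x' (y i))]
  simp only [Finset.prod_mul_distrib]
  rfl

theorem pow_RR (W : X → X' → Y → ℝ) (c : Fin 2) (c' : Fin 3) (b : Fin n → B) (t : Fin n → T)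
    (x : Fin n → X) (b' : Fin n → B') (v' : Fin n → V') (t' : Fin n → T') (y : Fin n → Y) :
    RR (Usr.pow S) (Usr.pow S') (Wpow n W) c c' b t x b' v' t' y =
      ∏ i, RR (S i) (S' i) W c c' (b i) (t i) (x i) (b' i) (v' i) (t' i) (y i) := by
  unfold RR
  simp only [Finset.prod_mul_distrib]
  rw [← prodsum (fun i z => ∑ z', (S i).kap c (t i) z * (S' i).kap2 c' (t' i) z' * W z z' (y i))]
  have : ∀ z : Fin n → X, ∏ i, ∑ z', (S i).kap c (t i) (z i) * (S' i).kap2 c' (t' i) z' *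
      W (z i) z' (y i) = ∑ z', (Usr.pow S).kap c t z * (Usr.pow S').kap2 c' t' z' *
        Wpow n W z z' y := by
    intro z
    rw [← prodsum (fun i z' => (S i).kap c (t i) (z i) * (S' i).kap2 c' (t' i) z' *
      W (z i) z' (y i))]
    simp only [Finset.prod_mul_distrib, pow_kap, pow_kap2]
    rfl
  simp only [this, pow_bet]
  rfl

theorem prodsum8 {A1 A2 A3 A4 A5 A6 A7 A8 : Type} [Fintype A1] [Fintype A2] [Fintype A3]
    [Fintype A4] [Fintype A5] [Fintype A6] [Fintype A7] [Fintype A8]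
    (F : Fin n → A1 → A2 → A3 → A4 → A5 → A6 → A7 → A8 → ℝ) :
    ∑ a1 : Fin n → A1, ∑ a2 : Fin n → A2, ∑ a3 : Fin n → A3, ∑ a4 : Fin n → A4,
    ∑ a5 : Fin n → A5, ∑ a6 : Fin n → A6, ∑ a7 : Fin n → A7, ∑ a8 : Fin n → A8,
      ∏ i, F i (a1 i) (a2 i) (a3 i) (a4 i) (a5 i) (a6 i) (a7 i) (a8 i) =
    ∏ i, ∑ a1, ∑ a2, ∑ a3, ∑ a4, ∑ a5, ∑ a6, ∑ a7, ∑ a8, F i a1 a2 a3 a4 a5 a6 a7 a8 := by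
  rw [← prodsum]; refine Finset.sum_congr rfl fun a1 _ => ?_
  rw [← prodsum (fun i a => _)]; refine Finset.sum_congr rfl fun a2 _ => ?_
  rw [← prodsum (fun i a => _)]; refine Finset.sum_congr rfl fun a3 _ => ?_
  rw [← prodsum (fun i a => _)]; refine Finset.sum_congr rfl fun a4 _ => ?_
  rw [← prodsum (fun i a => _)]; refine Finset.sum_congr rfl fun a5 _ => ?_
  rw [← prodsum (fun i a => _)]; refine Finset.sum_congr rfl fun a6 _ => ?_
  rw [← prodsum (fun i a => _)]; refine Finset.sum_congr rfl fun a7 _ => ?_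
  rw [← prodsum (fun i a => _)]

theorem pow_mom (W : X → X' → Y → ℝ) (hW : ∀ x x', IsPMF (W x x')) (c : Fin 2) (c' : Fin 3)
    (s : ℝ) : mom (Usr.pow S) (Usr.pow S') (Wpow n W) c c' s = ∏ i, mom (S i) (S' i) W c c' s := by
  unfold mom
  rw [← prodsum8]
  refine Finset.sum_congr rfl fun v' _ => Finset.sum_congr rfl fun y _ =>
    Finset.sum_congr rfl fun u _ => Finset.sum_congr rfl fun b _ => Finset.sum_congr rfl fun t _ =>
    Finset.sum_congr rfl fun x _ => Finset.sum_congr rfl fun b' _ => Finset.sum_congr rfl fun t' _ => ?_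
  rw [pow_Pa, pow_RR, Finset.prod_mul_distrib, ← Finset.prod_div_distrib,
    Real.finsetProd_rpow _ _ fun i _ => div_nonneg (RR_nonneg _ _ W hW _ _ _ _ _ _ _ _ _)
      (Pa_nonneg _ _ W hW _ _ _ _ _ _ _ _)]

/-- Time sharing average of `Bad`. -/
theorem avg_Bad (pQ : Q → ℝ) (hQ : IsPMF pQ) (S : Q → Usr U V B T X) (S' : Q → Usr U' V' B' T' X')
    (W : X → X' → Y → ℝ) (hW : ∀ x x', IsPMF (W x x')) (n M N M' N' : ℕ) (δ : ℝ) (hδ : 0 < δ)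
    (s : Fin 2 × Fin 3 → ℝ) (hs : ∀ c, 0 ≤ s c) :
    ∑ q : Fin n → Q, (∏ i, pQ (q i)) * Bad (Usr.pow fun i => S (q i)) (Usr.pow fun i => S' (q i))
      (Wpow n W) M N M' N' δ ≤
    ∑ c : Fin 2 × Fin 3, (6 * (KK1 M N c.1 * KK2 M' N' c.2) / δ) ^ s c *
      (∑ q, pQ q * mom (S q) (S' q) W c.1 c.2 (s c)) ^ n := by
  have h1 : ∀ q : Fin n → Q, (∏ i, pQ (q i)) * Bad (Usr.pow fun i => S (q i))
      (Usr.pow fun i => S' (q i)) (Wpow n W) M N M' N' δ ≤ ∑ c : Fin 2 × Fin 3,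
      (6 * (KK1 M N c.1 * KK2 M' N' c.2) / δ) ^ s c *
        ∏ i, (pQ (q i) * mom (S (q i)) (S' (q i)) W c.1 c.2 (s c)) := by
    intro q
    refine (mul_le_mul_of_nonneg_left (Bad_le _ _ _ (Wpow_pmf n W hW) M N M' N' δ hδ s hs)
      (Finset.prod_nonneg fun i _ => hQ.1 _)).trans (le_of_eq ?_)
    rw [Finset.mul_sum]
    refine Finset.sum_congr rfl fun c _ => ?_
    rw [pow_mom _ _ W hW, Finset.prod_mul_distrib]
    ring
  refine (Finset.sum_le_sum fun q _ => h1 q).trans (le_of_eq ?_)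
  rw [Finset.sum_comm]
  refine Finset.sum_congr rfl fun c _ => ?_
  rw [← Finset.mul_sum, prodsum (fun _ q => pQ q * mom (S q) (S' q) W c.1 c.2 (s c))]
  simp

/-- Covering moment. -/
noncomputable def cmom (S : Usr U V B T X) (s : ℝ) : ℝ :=
  ∑ b, ∑ u, S.pB b * S.ku b u * (S.ku b u / S.pU u) ^ s

theorem SC_le (S : Usr U V B T X) (M : ℕ) (γ : ℝ) (hγ : 0 < γ) (s : ℝ) (hs : 0 ≤ s) :
    SC S M γ ≤ (1 / γ) ^ s * cmom S s + Real.sqrt (γ / M) := by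
  unfold SC cmom
  refine add_le_add ?_ le_rfl
  simp only [Finset.mul_sum]
  refine Finset.sum_le_sum fun b _ => Finset.sum_le_sum fun u _ => ?_
  have hk := (S.hu b).1 u
  have hb := S.hB.1 b
  have hp := S.pU_nonneg u
  have h1 : S.pB b * S.ku b u ≤ S.pU u :=
    Finset.single_le_sum (f := fun b => S.pB b * S.ku b u)
      (fun b _ => mul_nonneg (S.hB.1 b) ((S.hu b).1 u)) (Finset.mem_univ b)
  have : (1 / γ) ^ s * (S.pB b * S.ku b u * (S.ku b u / S.pU u) ^ s) =
      S.pB b * S.ku b u * ((1 / γ) * (S.ku b u / S.pU u)) ^ s := by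
    rw [Real.mul_rpow (by positivity) (by positivity)]; ring
  rw [this]
  rcases (mul_nonneg hb hk).eq_or_lt with h0 | h0
  · rw [← h0]; simp
  refine mul_le_mul_of_nonneg_left ?_ h0.le
  split_ifs with hlt
  · refine Real.one_le_rpow ?_ hs
    have : 0 < S.pU u := h0.trans_le h1
    rw [← mul_div_assoc, le_div_iff₀ this, one_div, ← div_eq_inv_mul, le_div_iff₀ hγ]
    linarith
  · positivity

theorem pow_cmom (s : ℝ) : cmom (Usr.pow S) s = ∏ i, cmom (S i) s := by
  unfold cmom
  rw [← prodsum]; refine Finset.sum_congr rfl fun b _ => ?_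
  rw [← prodsum (fun i u => (S i).pB (b i) * (S i).ku (b i) u *
    ((S i).ku (b i) u / (S i).pU u) ^ s)]
  refine Finset.sum_congr rfl fun u _ => ?_
  rw [pow_pU, Finset.prod_mul_distrib, Finset.prod_mul_distrib,
    Real.finsetProd_rpow _ _ fun i _ => div_nonneg (((S i).hu _).1 _) ((S i).pU_nonneg _),
    Finset.prod_div_distrib]
  rfl

theorem avg_SC (pQ : Q → ℝ) (hQ : IsPMF pQ) (S : Q → Usr U V B T X) (n M : ℕ) (γ : ℝ) (hγ : 0 < γ)
    (s : ℝ) (hs : 0 ≤ s) :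
    ∑ q : Fin n → Q, (∏ i, pQ (q i)) * SC (Usr.pow fun i => S (q i)) M γ ≤
      (1 / γ) ^ s * (∑ q, pQ q * cmom (S q) s) ^ n + Real.sqrt (γ / M) := by
  have h1 : ∀ q : Fin n → Q, (∏ i, pQ (q i)) * SC (Usr.pow fun i => S (q i)) M γ ≤
      (1 / γ) ^ s * ∏ i, (pQ (q i) * cmom (S (q i)) s) + (∏ i, pQ (q i)) * Real.sqrt (γ / M) := by
    intro q
    refine (mul_le_mul_of_nonneg_left (SC_le _ M γ hγ s hs)
      (Finset.prod_nonneg fun i _ => hQ.1 _)).trans (le_of_eq ?_)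
    rw [pow_cmom, Finset.prod_mul_distrib]
    ring
  refine (Finset.sum_le_sum fun q _ => h1 q).trans (le_of_eq ?_)
  rw [Finset.sum_add_distrib, ← Finset.mul_sum, ← Finset.sum_mul, E0 _ fun _ => hQ.2, one_mul,
    prodsum (fun _ q => pQ q * cmom (S q) s)]
  simp

theorem Wm_pow (ρ : Y → Y1) (ch : X → X' → Y → ℝ) (n : ℕ) :
    Wm (fun (y : Fin n → Y) i => ρ (y i)) (Wpow n ch) = Wpow n (Wm ρ ch) := by
  funext x x' y1
  unfold Wm Wpow
  rw [← prodsum (fun i y => if ρ y = y1 i then ch (x i) (x' i) y else 0)]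
  refine Finset.sum_congr rfl fun y _ => ?_
  split_ifs with h
  · refine Finset.prod_congr rfl fun i _ => ?_
    rw [if_pos (congrFun h i)]
  · have : ∃ i, ρ (y i) ≠ y1 i := by
      by_contra! hh
      exact h (funext hh)
    obtain ⟨i, hi⟩ := this
    exact (Finset.prod_eq_zero (Finset.mem_univ i) (if_neg hi)).symm

end NLetter

section Asym

theorem chern {Θ : Type} [Fintype Θ] (w r : Θ → ℝ) (hw : IsPMF w) (hr : ∀ θ, 0 ≤ r θ) (k : ℝ)
    (h : ∑ θ, w θ * Real.logb 2 (r θ) + k < 0) :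
    ∃ s : ℝ, 0 < s ∧ s ≤ 1 ∧ (2 : ℝ) ^ (s * k) * ∑ θ, w θ * r θ ^ s < 1 := by
  set l : Θ → ℝ := fun θ => Real.log (r θ) + k * Real.log 2 with hl
  have hder : HasDerivAt (fun s : ℝ => ∑ θ, w θ * Real.exp (s * l θ)) (∑ θ, w θ * l θ) 0 := by
    have : ∀ θ, HasDerivAt (fun s : ℝ => w θ * Real.exp (s * l θ)) (w θ * l θ) 0 := by
      intro θ
      have h1 : HasDerivAt (fun s : ℝ => s * l θ) (l θ) 0 := by
        simpa using (hasDerivAt_id (0 : ℝ)).mul_const (l θ)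
      have h2 := h1.exp
      simp only [zero_mul, Real.exp_zero, one_mul] at h2
      exact h2.const_mul _
    exact HasDerivAt.fun_sum fun θ _ => this θ
  have hlog2 : 0 < Real.log 2 := Real.log_pos (by norm_num)
  have hneg : ∑ θ, w θ * l θ < 0 := by
    have : ∑ θ, w θ * l θ = Real.log 2 * (∑ θ, w θ * Real.logb 2 (r θ) + k) := by
      have e1 : ∀ θ, w θ * l θ = Real.log 2 * (w θ * Real.logb 2 (r θ)) +
          w θ * (k * Real.log 2) := by
        intro θ
        simp only [hl, Real.logb]
        field_simp
      simp only [e1, Finset.sum_add_distrib, ← Finset.mul_sum, ← Finset.sum_mul, hw.2]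
      ring
    rw [this]
    exact mul_neg_of_pos_of_neg hlog2 h
  have hslope := hder.tendsto_slope_zero_right
  have hev := hslope.eventually (gt_mem_nhds hneg)
  have hIoc : ∀ᶠ t : ℝ in nhdsWithin 0 (Set.Ioi 0), t ∈ Set.Ioc (0 : ℝ) 1 :=
    Ioc_mem_nhdsGT one_pos
  obtain ⟨s, hs1, hs2⟩ := (hev.and hIoc).exists
  refine ⟨s, hs2.1, hs2.2, ?_⟩
  simp only [zero_add, zero_mul, Real.exp_zero, mul_one, hw.2, smul_eq_mul] at hs1
  have hlt : ∑ θ, w θ * Real.exp (s * l θ) < 1 := by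
    by_contra hc
    have := mul_nonneg (inv_pos.2 hs2.1).le (sub_nonneg.2 (not_lt.1 hc))
    linarith
  refine lt_of_le_of_lt ?_ hlt
  rw [Finset.mul_sum]
  refine Finset.sum_le_sum fun θ _ => ?_
  have h2k : (2 : ℝ) ^ (s * k) = Real.exp (s * (k * Real.log 2)) := by
    rw [Real.rpow_def_of_pos (by norm_num)]; ring_nf
  have : (2 : ℝ) ^ (s * k) * r θ ^ s ≤ Real.exp (s * l θ) := by
    rcases (hr θ).eq_or_lt with h0 | h0
    · rw [← h0, Real.zero_rpow hs2.1.ne', mul_zero]; exact (Real.exp_pos _).le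
    · rw [h2k, Real.rpow_def_of_pos h0, ← Real.exp_add]
      simp only [hl]
      refine le_of_eq ?_
      ring_nf
  calc (2 : ℝ) ^ (s * k) * (w θ * r θ ^ s) = w θ * ((2 : ℝ) ^ (s * k) * r θ ^ s) := by ring
    _ ≤ _ := mul_le_mul_of_nonneg_left this (hw.1 θ)

theorem geom_bound (C A k ε s lam : ℝ) (n : ℕ) (hA : 0 ≤ A) (hC : 1 ≤ C)
    (hAC : A ≤ C * (2 : ℝ) ^ ((n : ℝ) * k)) (hs : 0 < s) (hs1 : s ≤ 1) (hlam : 0 ≤ lam) :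
    (A / (2 : ℝ) ^ (-((n : ℝ) * ε))) ^ s * lam ^ n ≤ C * ((2 : ℝ) ^ (s * (k + ε)) * lam) ^ n := by
  have h2 : (0 : ℝ) < 2 := by norm_num
  have h1 : A / (2 : ℝ) ^ (-((n : ℝ) * ε)) ≤ C * (2 : ℝ) ^ ((n : ℝ) * (k + ε)) := by
    rw [div_le_iff₀ (by positivity), mul_assoc, ← Real.rpow_add h2]
    have e : (n : ℝ) * (k + ε) + -((n : ℝ) * ε) = (n : ℝ) * k := by ring
    rw [e]
    exact hAC
  have h3 : (A / (2 : ℝ) ^ (-((n : ℝ) * ε))) ^ s ≤ C * ((2 : ℝ) ^ (s * (k + ε))) ^ n := by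
    refine (Real.rpow_le_rpow (by positivity) h1 hs.le).trans ?_
    rw [Real.mul_rpow (by linarith) (by positivity)]
    refine mul_le_mul ?_ (le_of_eq ?_) (by positivity) (by linarith)
    · exact Real.rpow_le_self_of_one_le hC hs1
    · rw [← Real.rpow_natCast, ← Real.rpow_mul h2.le, ← Real.rpow_mul h2.le]
      congr 1; ring
  rw [mul_pow, ← mul_assoc]
  exact mul_le_mul_of_nonneg_right h3 (by positivity)

theorem ceil_bound (a : ℝ) (ha : 0 ≤ a) (n : ℕ) :
    (2 : ℝ) ^ ((n : ℝ) * a) ≤ (⌈(2 : ℝ) ^ ((n : ℝ) * a)⌉₊ : ℝ) ∧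
    (⌈(2 : ℝ) ^ ((n : ℝ) * a)⌉₊ : ℝ) ≤ 2 * (2 : ℝ) ^ ((n : ℝ) * a) ∧
    0 < ⌈(2 : ℝ) ^ ((n : ℝ) * a)⌉₊ ∧ 1 ≤ (2 : ℝ) ^ ((n : ℝ) * a) := by
  have h1 : 1 ≤ (2 : ℝ) ^ ((n : ℝ) * a) := Real.one_le_rpow (by norm_num) (by positivity)
  have h2 := Nat.ceil_lt_add_one (show 0 ≤ (2 : ℝ) ^ ((n : ℝ) * a) by linarith)
  exact ⟨Nat.le_ceil _, by linarith, Nat.ceil_pos.2 (by linarith), h1⟩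

/-- Exponents of the multiplicities. -/
noncomputable def ex1 (m Δ : ℝ) (c : Fin 2) : ℝ := if c = 0 then -Δ else m
noncomputable def ex2 (m Δ : ℝ) (c : Fin 3) : ℝ := if c = 0 then 0 else if c = 1 then Δ else m + Δ

theorem KK_bound (m Δ m' Δ' : ℝ) (hm : 0 ≤ m) (hΔ : 0 ≤ Δ) (hm' : 0 ≤ m') (hΔ' : 0 ≤ Δ') (n : ℕ)
    (c : Fin 2 × Fin 3) :
    6 * (KK1 ⌈(2 : ℝ) ^ ((n : ℝ) * m)⌉₊ ⌈(2 : ℝ) ^ ((n : ℝ) * Δ)⌉₊ c.1 *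
      KK2 ⌈(2 : ℝ) ^ ((n : ℝ) * m')⌉₊ ⌈(2 : ℝ) ^ ((n : ℝ) * Δ')⌉₊ c.2) ≤
    72 * (2 : ℝ) ^ ((n : ℝ) * (ex1 m Δ c.1 + ex2 m' Δ' c.2)) := by
  have h2 : (0 : ℝ) < 2 := by norm_num
  obtain ⟨a1, a2, a3, a4⟩ := ceil_bound m hm n
  obtain ⟨b1, b2, b3, b4⟩ := ceil_bound Δ hΔ n
  obtain ⟨c1, c2, c3, c4⟩ := ceil_bound m' hm' n
  obtain ⟨d1, d2, d3, d4⟩ := ceil_bound Δ' hΔ' n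
  have k1 : KK1 ⌈(2 : ℝ) ^ ((n : ℝ) * m)⌉₊ ⌈(2 : ℝ) ^ ((n : ℝ) * Δ)⌉₊ c.1 ≤
      3 * (2 : ℝ) ^ ((n : ℝ) * ex1 m Δ c.1) := by
    unfold KK1 ex1
    split_ifs
    · rw [mul_neg, Real.rpow_neg h2.le, one_div]
      have : ((⌈(2 : ℝ) ^ ((n : ℝ) * Δ)⌉₊ : ℝ))⁻¹ ≤ ((2 : ℝ) ^ ((n : ℝ) * Δ))⁻¹ :=
        inv_anti₀ (by positivity) b1
      have h0 : 0 < ((2 : ℝ) ^ ((n : ℝ) * Δ))⁻¹ := by positivity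
      linarith
    · linarith
  have k2 : KK2 ⌈(2 : ℝ) ^ ((n : ℝ) * m')⌉₊ ⌈(2 : ℝ) ^ ((n : ℝ) * Δ')⌉₊ c.2 ≤
      4 * (2 : ℝ) ^ ((n : ℝ) * ex2 m' Δ' c.2) := by
    unfold KK2 ex2
    split_ifs
    · simp
    · linarith
    · rw [mul_add, Real.rpow_add h2]
      nlinarith [mul_le_mul c2 d2 (by positivity) (by positivity)]
  rw [mul_add, Real.rpow_add h2]
  have := mul_le_mul k1 k2 (KK2_nonneg _ _ _) (by positivity)
  linarith

variable {U V B T X U' V' B' T' X' Y Y1 Y2 Q : Type} [Fintype U] [Fintype V] [Fintype B] [Fintype T]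
  [Fintype X] [Fintype U'] [Fintype V'] [Fintype B'] [Fintype T'] [Fintype X'] [Fintype Y]
  [Fintype Y1] [Fintype Y2] [Fintype Q]

/-- Expected log-ratio for one type of false candidates. -/
noncomputable def LL (pQ : Q → ℝ) (S : Q → Usr U V B T X) (S' : Q → Usr U' V' B' T' X')
    (W : X → X' → Y → ℝ) (c : Fin 2) (c' : Fin 3) : ℝ :=
  ∑ q, ∑ v', ∑ y, ∑ u, ∑ b, ∑ t, ∑ x, ∑ b', ∑ t',
    pQ q * Pa (S q) (S' q) W u b t x b' v' t' y *
    Real.logb 2 (RR (S q) (S' q) W c c' b t x b' v' t' y / Pa (S q) (S' q) W u b t x b' v' t' y)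

/-- Expected log-ratio for covering. -/
noncomputable def LC (pQ : Q → ℝ) (S : Q → Usr U V B T X) : ℝ :=
  ∑ q, ∑ b, ∑ u, pQ q * ((S q).pB b * (S q).ku b u) * Real.logb 2 ((S q).ku b u / (S q).pU u)

theorem mom_exp (pQ : Q → ℝ) (hQ : IsPMF pQ) (S : Q → Usr U V B T X) (S' : Q → Usr U' V' B' T' X')
    (W : X → X' → Y → ℝ) (hW : ∀ x x', IsPMF (W x x')) (c : Fin 2) (c' : Fin 3) (k : ℝ)
    (h : LL pQ S S' W c c' + k < 0) :
    ∃ s : ℝ, 0 < s ∧ s ≤ 1 ∧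
      (2 : ℝ) ^ (s * k) * (∑ q, pQ q * mom (S q) (S' q) W c c' s) < 1 := by
  let Θ := Q × V' × Y × U × B × T × X × B' × T'
  let w : Θ → ℝ := fun θ => pQ θ.1 * Pa (S θ.1) (S' θ.1) W θ.2.2.2.1 θ.2.2.2.2.1 θ.2.2.2.2.2.1
    θ.2.2.2.2.2.2.1 θ.2.2.2.2.2.2.2.1 θ.2.1 θ.2.2.2.2.2.2.2.2 θ.2.2.1
  let r : Θ → ℝ := fun θ => RR (S θ.1) (S' θ.1) W c c' θ.2.2.2.2.1 θ.2.2.2.2.2.1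
    θ.2.2.2.2.2.2.1 θ.2.2.2.2.2.2.2.1 θ.2.1 θ.2.2.2.2.2.2.2.2 θ.2.2.1 /
    Pa (S θ.1) (S' θ.1) W θ.2.2.2.1 θ.2.2.2.2.1 θ.2.2.2.2.2.1
    θ.2.2.2.2.2.2.1 θ.2.2.2.2.2.2.2.1 θ.2.1 θ.2.2.2.2.2.2.2.2 θ.2.2.1
  have hw : IsPMF w := by
    refine ⟨fun θ => mul_nonneg (hQ.1 _) (Pa_nonneg _ _ W hW _ _ _ _ _ _ _ _), ?_⟩
    simp only [Θ, w, Fintype.sum_prod_type, ← Finset.mul_sum, sum_Pa _ _ W hW, mul_one, hQ.2]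
  obtain ⟨s, h1, h2, h3⟩ := chern w r hw (fun θ => div_nonneg
    (RR_nonneg _ _ W hW _ _ _ _ _ _ _ _ _) (Pa_nonneg _ _ W hW _ _ _ _ _ _ _ _)) k (by
      refine lt_of_le_of_lt (le_of_eq ?_) h
      simp only [Θ, w, r, Fintype.sum_prod_type]
      rfl)
  refine ⟨s, h1, h2, lt_of_le_of_lt (le_of_eq ?_) h3⟩
  simp only [Θ, w, r, Fintype.sum_prod_type, mom, Finset.mul_sum, mul_assoc]

theorem cmom_exp (pQ : Q → ℝ) (hQ : IsPMF pQ) (S : Q → Usr U V B T X) (k : ℝ)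
    (h : LC pQ S + k < 0) :
    ∃ s : ℝ, 0 < s ∧ s ≤ 1 ∧ (2 : ℝ) ^ (s * k) * (∑ q, pQ q * cmom (S q) s) < 1 := by
  let Θ := Q × B × U
  let w : Θ → ℝ := fun θ => pQ θ.1 * ((S θ.1).pB θ.2.1 * (S θ.1).ku θ.2.1 θ.2.2)
  let r : Θ → ℝ := fun θ => (S θ.1).ku θ.2.1 θ.2.2 / (S θ.1).pU θ.2.2
  have hw : IsPMF w := by
    refine ⟨fun θ => mul_nonneg (hQ.1 _) (mul_nonneg ((S _).hB.1 _) (((S _).hu _).1 _)), ?_⟩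
    simp only [Θ, w, Fintype.sum_prod_type, ← Finset.mul_sum, ((S _).hu _).2, mul_one, (S _).hB.2,
      hQ.2]
  obtain ⟨s, h1, h2, h3⟩ := chern w r hw (fun θ => div_nonneg
    (((S _).hu _).1 _) ((S _).pU_nonneg _)) k (by
      refine lt_of_le_of_lt (le_of_eq ?_) h
      simp only [Θ, w, r, Fintype.sum_prod_type]
      rfl)
  refine ⟨s, h1, h2, lt_of_le_of_lt (le_of_eq ?_) h3⟩
  simp only [Θ, w, r, Fintype.sum_prod_type, cmom, Finset.mul_sum, mul_assoc]

theorem mom_nonneg (S : Usr U V B T X) (S' : Usr U' V' B' T' X')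
    (W : X → X' → Y → ℝ) (hW : ∀ x x', IsPMF (W x x')) (c : Fin 2) (c' : Fin 3) (s : ℝ) :
    0 ≤ mom S S' W c c' s := by
  unfold mom
  refine Finset.sum_nonneg fun _ _ => Finset.sum_nonneg fun _ _ => Finset.sum_nonneg fun _ _ =>
    Finset.sum_nonneg fun _ _ => Finset.sum_nonneg fun _ _ => Finset.sum_nonneg fun _ _ =>
    Finset.sum_nonneg fun _ _ => Finset.sum_nonneg fun _ _ => ?_
  exact mul_nonneg (Pa_nonneg _ _ W hW _ _ _ _ _ _ _ _) (Real.rpow_nonneg (div_nonneg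
    (RR_nonneg _ _ W hW _ _ _ _ _ _ _ _ _) (Pa_nonneg _ _ W hW _ _ _ _ _ _ _ _)) _)

theorem cmom_nonneg (S : Usr U V B T X) (s : ℝ) : 0 ≤ cmom S s := by
  unfold cmom
  refine Finset.sum_nonneg fun _ _ => Finset.sum_nonneg fun _ _ => ?_
  exact mul_nonneg (mul_nonneg (S.hB.1 _) ((S.hu _).1 _)) (Real.rpow_nonneg (div_nonneg
    ((S.hu _).1 _) (S.pU_nonneg _)) _)

/-- A sequence that is bounded by a null sequence. -/
def Null (a : ℕ → ℝ) : Prop := ∃ b : ℕ → ℝ, (∀ n, a n ≤ b n) ∧ Tendsto b atTop (nhds 0)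

theorem Null.add {a b : ℕ → ℝ} (ha : Null a) (hb : Null b) : Null (fun n => a n + b n) := by
  obtain ⟨a', h1, h2⟩ := ha
  obtain ⟨b', h3, h4⟩ := hb
  exact ⟨fun n => a' n + b' n, fun n => add_le_add (h1 n) (h3 n), by simpa using h2.add h4⟩

theorem Null.geom {a : ℕ → ℝ} (C r : ℝ) (hr : 0 ≤ r) (hr1 : r < 1) (h : ∀ n, a n ≤ C * r ^ n) :
    Null a :=
  ⟨_, h, by simpa using (tendsto_pow_atTop_nhds_zero_of_lt_one hr hr1).const_mul C⟩

theorem Null.two {ε : ℝ} (hε : 0 < ε) : Null (fun n => (2 : ℝ) ^ (-((n : ℝ) * ε))) := by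
  refine Null.geom 1 ((2 : ℝ) ^ (-ε)) (by positivity)
    (Real.rpow_lt_one_of_one_lt_of_neg (by norm_num) (by linarith)) fun n => le_of_eq ?_
  rw [one_mul, ← Real.rpow_natCast, ← Real.rpow_mul (by norm_num)]
  congr 1; ring

theorem Null.sum {ι : Type} (s : Finset ι) {a : ι → ℕ → ℝ} (h : ∀ i, Null (a i)) :
    Null (fun n => ∑ i ∈ s, a i n) := by
  choose b h1 h2 using h
  exact ⟨fun n => ∑ i ∈ s, b i n, fun n => Finset.sum_le_sum fun i _ => h1 i n,
    by simpa using tendsto_finsetSum s fun i _ => h2 i⟩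

theorem Null.mono {a b : ℕ → ℝ} (ha : Null a) (h : ∀ n, b n ≤ a n) : Null b := by
  obtain ⟨a', h1, h2⟩ := ha
  exact ⟨a', fun n => (h n).trans (h1 n), h2⟩

theorem null_Bad (pQ : Q → ℝ) (hQ : IsPMF pQ) (S : Q → Usr U V B T X)
    (S' : Q → Usr U' V' B' T' X') (W : X → X' → Y → ℝ) (hW : ∀ x x', IsPMF (W x x'))
    (m Δ m' Δ' ε : ℝ) (hm : 0 ≤ m) (hΔ : 0 ≤ Δ) (hm' : 0 ≤ m') (hΔ' : 0 ≤ Δ')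
    (h : ∀ c c', LL pQ S S' W c c' + (ex1 m Δ c + ex2 m' Δ' c' + ε) < 0) :
    Null (fun n => ∑ q : Fin n → Q, (∏ i, pQ (q i)) *
      Bad (Usr.pow fun i => S (q i)) (Usr.pow fun i => S' (q i))
      (Wpow n W) ⌈(2 : ℝ) ^ ((n : ℝ) * m)⌉₊ ⌈(2 : ℝ) ^ ((n : ℝ) * Δ)⌉₊
      ⌈(2 : ℝ) ^ ((n : ℝ) * m')⌉₊ ⌈(2 : ℝ) ^ ((n : ℝ) * Δ')⌉₊ ((2 : ℝ) ^ (-((n : ℝ) * ε)))) := by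
  choose s hs1 hs2 hs3 using fun c : Fin 2 × Fin 3 => mom_exp pQ hQ S S' W hW c.1 c.2 _ (h c.1 c.2)
  have hlam : ∀ c : Fin 2 × Fin 3, 0 ≤ ∑ q, pQ q * mom (S q) (S' q) W c.1 c.2 (s c) := fun c =>
    Finset.sum_nonneg fun q _ => mul_nonneg (hQ.1 q) (mom_nonneg _ _ W hW _ _ _)
  have key := Null.sum (Finset.univ : Finset (Fin 2 × Fin 3))
    (a := fun c n => 72 * ((2 : ℝ) ^ (s c * (ex1 m Δ c.1 + ex2 m' Δ' c.2 + ε)) *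
      ∑ q, pQ q * mom (S q) (S' q) W c.1 c.2 (s c)) ^ n)
    (fun c => Null.geom 72 _ (mul_nonneg (by positivity) (hlam c)) (hs3 c) fun n => le_rfl)
  refine key.mono fun n => ?_
  refine (avg_Bad pQ hQ S S' W hW n _ _ _ _ _ (by positivity) s fun c => (hs1 c).le).trans ?_
  refine Finset.sum_le_sum fun c _ => ?_
  exact geom_bound 72 _ _ ε (s c) _ n
    (mul_nonneg (by norm_num) (mul_nonneg (KK1_nonneg _ _ _) (KK2_nonneg _ _ _)))
    (by norm_num) (KK_bound m Δ m' Δ' hm hΔ hm' hΔ' n c) (hs1 c) (hs2 c) (hlam c)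

theorem null_SC (pQ : Q → ℝ) (hQ : IsPMF pQ) (S : Q → Usr U V B T X) (m g : ℝ) (hm : 0 ≤ m)
    (hg : LC pQ S < g) (hgm : g < m) :
    Null (fun n => ∑ q : Fin n → Q, (∏ i, pQ (q i)) * SC (Usr.pow fun i => S (q i))
      ⌈(2 : ℝ) ^ ((n : ℝ) * m)⌉₊ ((2 : ℝ) ^ ((n : ℝ) * g))) := by
  have h2 : (0 : ℝ) < 2 := by norm_num
  obtain ⟨s, hs1, hs2, hs3⟩ := cmom_exp pQ hQ S (-g) (by linarith)
  have hlam : 0 ≤ ∑ q, pQ q * cmom (S q) s :=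
    Finset.sum_nonneg fun q _ => mul_nonneg (hQ.1 q) (cmom_nonneg _ _)
  have k1 : Null (fun n => (1 / (2 : ℝ) ^ ((n : ℝ) * g)) ^ s * (∑ q, pQ q * cmom (S q) s) ^ n) := by
    refine Null.geom 1 _ (mul_nonneg (by positivity) hlam) hs3 fun n => ?_
    have := geom_bound 1 1 0 (-g) s _ n zero_le_one le_rfl (by simp) hs1 hs2 hlam
    simpa using this
  have k2 : Null (fun n => Real.sqrt ((2 : ℝ) ^ ((n : ℝ) * g) / ⌈(2 : ℝ) ^ ((n : ℝ) * m)⌉₊)) := by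
    refine (Null.two (show 0 < (m - g) / 2 by linarith)).mono fun n => ?_
    obtain ⟨a1, a2, a3, a4⟩ := ceil_bound m hm n
    apply Real.sqrt_le_iff.2 ⟨by positivity, ?_⟩
    rw [← Real.rpow_natCast, ← Real.rpow_mul h2.le]
    rw [div_le_iff₀ (by positivity)]
    refine le_trans (le_of_eq ?_) (mul_le_mul_of_nonneg_left a1 (by positivity))
    rw [← Real.rpow_add h2]
    congr 1
    push_cast
    ring
  refine (k1.add k2).mono fun n => ?_
  exact avg_SC pQ hQ S n _ _ (by positivity) s hs1.le

theorem nletter [Nonempty U] [Nonempty U'] (ch : X × X' → Y1 × Y2 → ℝ) (hch : IsKernel ch)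
    (q1 : U × V → ℝ) (q2 : U' × V' → ℝ) (hq1 : ∀ x, 0 ≤ q1 x) (hq2 : ∀ x, 0 ≤ q2 x) (pQ : Q → ℝ) (hQ : IsPMF pQ) (S : Q → Usr U V B T X)
    (S' : Q → Usr U' V' B' T' X') (hS : ∀ q u v, (S q).pU u * (S q).kv u v = q1 (u, v))
    (hS' : ∀ q u v, (S' q).pU u * (S' q).kv u v = q2 (u, v))
    (m Δ m' Δ' ε g g' : ℝ) (hε : 0 < ε) (hm : 0 ≤ m) (hΔ : 0 ≤ Δ) (hm' : 0 ≤ m') (hΔ' : 0 ≤ Δ')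
    (hg : LC pQ S < g) (hgm : g < m) (hg' : LC pQ S' < g') (hgm' : g' < m')
    (h1 : ∀ c c', LL pQ S S' (Wm Prod.fst (fun x x' => ch (x, x'))) c c' +
      (ex1 m Δ c + ex2 m' Δ' c' + ε) < 0)
    (h2 : ∀ c c', LL pQ S' S (Wm Prod.snd (fun x' x => ch (x, x'))) c c' +
      (ex1 m' Δ' c + ex2 m Δ c' + ε) < 0) :
    ReliableCross ch q1 q2 := by
  set chf : X → X' → Y1 × Y2 → ℝ := fun x x' => ch (x, x') with hchf
  have hc : ∀ x x', IsPMF (chf x x') := fun x x' => hch _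
  have n1 := null_Bad pQ hQ S S' _ (Wm_pmf Prod.fst chf hc) m Δ m' Δ' ε hm hΔ hm' hΔ' h1
  have n2 := null_Bad pQ hQ S' S _ (Wm_pmf Prod.snd (fun x' x => chf x x') fun x' x => hc x x')
    m' Δ' m Δ ε hm' hΔ' hm hΔ h2
  have n3 := null_SC pQ hQ S m g hm hg hgm
  have n4 := null_SC pQ hQ S' m' g' hm' hg' hgm'
  have n5 := Null.two hε
  obtain ⟨β, hβ1, hβ2⟩ := ((n3.add n4).add ((n1.add n5).add (n2.add n5)))
  have key : ∀ n : ℕ, ∃ f f' g g', PerrCross ch q1 q2 n f f' g g' ≤ β n := by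
    intro n
    have hE : IsExp (ewt (fun _ : Fin n => pQ)) := isExp_ewt fun _ => hQ
    set M := ⌈(2 : ℝ) ^ ((n : ℝ) * m)⌉₊
    set N := ⌈(2 : ℝ) ^ ((n : ℝ) * Δ)⌉₊
    set M' := ⌈(2 : ℝ) ^ ((n : ℝ) * m')⌉₊
    set N' := ⌈(2 : ℝ) ^ ((n : ℝ) * Δ')⌉₊
    set δ := (2 : ℝ) ^ (-((n : ℝ) * ε))
    have hav : ewt (fun _ : Fin n => pQ) (fun q =>
        SC (Usr.pow fun i => S (q i)) M ((2 : ℝ) ^ ((n : ℝ) * g)) +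
        SC (Usr.pow fun i => S' (q i)) M' ((2 : ℝ) ^ ((n : ℝ) * g')) +
        ((Bad (Usr.pow fun i => S (q i)) (Usr.pow fun i => S' (q i)) (Wpow n (Wm Prod.fst chf))
          M N M' N' δ + δ) +
        (Bad (Usr.pow fun i => S' (q i)) (Usr.pow fun i => S (q i))
          (Wpow n (Wm Prod.snd (fun x' x => chf x x'))) M' N' M N δ + δ))) ≤ β n := by
      simp only [hE.add, hE.const]
      exact hβ1 n
    obtain ⟨q, hq⟩ := hE.exists_le hav
    obtain ⟨f, f', g1, g2, hh⟩ := one_shot (Usr.pow fun i => S (q i)) (Usr.pow fun i => S' (q i))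
      (Wpow n chf) (Wpow_pmf n chf hc) (fun (y : Fin n → Y1 × Y2) i => (y i).1)
      (fun (y : Fin n → Y1 × Y2) i => (y i).2) (ceil_bound m hm n).2.2.1 (ceil_bound Δ hΔ n).2.2.1
      (ceil_bound m' hm' n).2.2.1 (ceil_bound Δ' hΔ' n).2.2.1 δ ((2 : ℝ) ^ ((n : ℝ) * g))
      ((2 : ℝ) ^ ((n : ℝ) * g')) (by positivity) (by positivity) (by positivity)
    have hw1 : Wm (fun (y : Fin n → Y1 × Y2) i => (y i).1) (Wpow n chf) =
      Wpow n (Wm Prod.fst chf) := Wm_pow Prod.fst chf n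
    have hw2 : Wm (fun (y : Fin n → Y1 × Y2) i => (y i).2) (fun x' x => Wpow n chf x x') =
      Wpow n (Wm Prod.snd (fun x' x => chf x x')) := Wm_pow Prod.snd (fun x' x => chf x x') n
    rw [hw1, hw2] at hh
    refine ⟨f, f', g1, g2, le_trans (le_of_eq ?_) (hh.trans hq)⟩
    unfold PerrCross Perr1
    refine Finset.sum_congr rfl fun u _ => Finset.sum_congr rfl fun v _ =>
      Finset.sum_congr rfl fun u' _ => Finset.sum_congr rfl fun v' _ =>
      Finset.sum_congr rfl fun y _ => ?_
    have e1 : (Usr.pow fun i => S (q i)).pU u * (Usr.pow fun i => S (q i)).kv u v =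
        ∏ i, q1 (u i, v i) := by
      rw [pow_pU]
      have e : (Usr.pow fun i => S (q i)).kv u v = ∏ i, (S (q i)).kv (u i) (v i) := rfl
      rw [e, ← Finset.prod_mul_distrib]
      exact Finset.prod_congr rfl fun i _ => hS (q i) _ _
    have e2 : (Usr.pow fun i => S' (q i)).pU u' * (Usr.pow fun i => S' (q i)).kv u' v' =
        ∏ i, q2 (u' i, v' i) := by
      rw [pow_pU]
      have e : (Usr.pow fun i => S' (q i)).kv u' v' = ∏ i, (S' (q i)).kv (u' i) (v' i) := rfl
      rw [e, ← Finset.prod_mul_distrib]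
      exact Finset.prod_congr rfl fun i _ => hS' (q i) _ _
    rw [e1, e2]
    congr 1
    congr
  choose f f' g1 g2 hk using key
  refine ⟨f, f', g1, g2, ?_⟩
  refine squeeze_zero (fun n => ?_) hk hβ2
  unfold PerrCross
  refine Finset.sum_nonneg fun u _ => Finset.sum_nonneg fun v _ => Finset.sum_nonneg fun u' _ =>
    Finset.sum_nonneg fun v' _ => Finset.sum_nonneg fun y _ => ?_
  refine mul_nonneg (mul_nonneg (mul_nonneg (Finset.prod_nonneg fun i _ => hq1 _)
    (Finset.prod_nonneg fun i _ => hq2 _)) (Finset.prod_nonneg fun i _ => (hch _).1 _)) ?_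
  split_ifs <;> norm_num

end Asym

set_option linter.unusedSectionVars false
section EntGen
variable {Ω' Θ α β γ α' β' γ' : Type} [Fintype Ω'] [Fintype Θ] [Fintype α] [Fintype β] [Fintype γ]
  [Fintype α'] [Fintype β'] [Fintype γ']

theorem pr_nonneg' {p : Ω' → ℝ} (hp : ∀ ω, 0 ≤ p ω) (X : Ω' → α) (x : α) : 0 ≤ pr p X x :=
  Finset.sum_nonneg fun ω _ => by split_ifs; exacts [hp ω, le_rfl]

theorem le_pr {p : Ω' → ℝ} (hp : ∀ ω, 0 ≤ p ω) (X : Ω' → α) (ω : Ω') : p ω ≤ pr p X (X ω) := by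
  have := Finset.single_le_sum (f := fun ω' => if X ω' = X ω then p ω' else 0)
    (fun ω' _ => by split_ifs; exacts [hp ω', le_rfl]) (Finset.mem_univ ω)
  simpa [pr] using this

theorem pr_push (p : Ω' → ℝ) (X : Ω' → α) (F : α → ℝ) :
    ∑ x, pr p X x * F x = ∑ ω, p ω * F (X ω) := by
  unfold pr
  simp only [Finset.sum_mul]
  rw [Finset.sum_comm]
  refine Finset.sum_congr rfl fun ω _ => ?_
  simp [ite_mul]

theorem ent_eq (p : Ω' → ℝ) (X : Ω' → α) :
    ent p X = -∑ ω, p ω * Real.logb 2 (pr p X (X ω)) := by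
  unfold ent
  rw [Finset.sum_neg_distrib, pr_push p X fun x => Real.logb 2 (pr p X x)]

theorem pr_pr (p : Ω' → ℝ) (R : Ω' → Θ) (f : Θ → α) (a : α) :
    pr (pr p R) f a = pr p (fun ω => f (R ω)) a := by
  have := pr_push p R fun θ => if f θ = a then 1 else 0
  simpa [pr] using this

theorem ent_tr (p : Ω' → ℝ) (R : Ω' → Θ) (P : Θ → ℝ) (hP : pr p R = P) (A : Ω' → α) (f : Θ → α')
    (h : ∀ ω ω', A ω = A ω' ↔ f (R ω) = f (R ω')) : ent p A = ent P f := by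
  subst hP
  rw [ent_eq, ent_eq, pr_push p R fun θ => Real.logb 2 (pr (pr p R) f (f θ))]
  congr 1
  refine Finset.sum_congr rfl fun ω _ => ?_
  rw [pr_pr]
  congr 2
  unfold pr
  refine Finset.sum_congr rfl fun ω' _ => ?_
  simp only [h ω' ω]

theorem cmi_tr (p : Ω' → ℝ) (R : Ω' → Θ) (P : Θ → ℝ) (hP : pr p R = P)
    (A : Ω' → α) (B : Ω' → β) (C : Ω' → γ) (f : Θ → α') (g : Θ → β') (k : Θ → γ')
    (hA : ∀ ω ω', A ω = A ω' ↔ f (R ω) = f (R ω'))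
    (hB : ∀ ω ω', B ω = B ω' ↔ g (R ω) = g (R ω'))
    (hC : ∀ ω ω', C ω = C ω' ↔ k (R ω) = k (R ω')) : cmi p A B C = cmi P f g k := by
  unfold cmi
  rw [ent_tr p R P hP (fun ω => (A ω, C ω)) (fun θ => (f θ, k θ)),
    ent_tr p R P hP (fun ω => (B ω, C ω)) (fun θ => (g θ, k θ)),
    ent_tr p R P hP (fun ω => (A ω, B ω, C ω)) (fun θ => (f θ, g θ, k θ)),
    ent_tr p R P hP C k hC]
  all_goals intro ω ω'; simp only [Prod.mk.injEq, hA ω ω', hB ω ω', hC ω ω']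

theorem pr_marg (P : Θ → ℝ) (R : Θ → α) (e : α × β ≃ Θ) (he : ∀ a b, R (e (a, b)) = a) (a : α) :
    pr P R a = ∑ b, P (e (a, b)) := by
  unfold pr
  rw [← e.sum_comp, Fintype.sum_prod_type]
  simp only [he]
  rw [Finset.sum_eq_single a]
  · simp
  · intro b _ hb; simp [hb]
  · simp

theorem cmi_eq (P : Θ → ℝ) (f : Θ → α) (g : Θ → β) (k : Θ → γ) :
    cmi P f g k = ∑ θ, P θ * (Real.logb 2 (pr P (fun θ => (f θ, g θ, k θ)) (f θ, g θ, k θ)) +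
      Real.logb 2 (pr P k (k θ)) - Real.logb 2 (pr P (fun θ => (f θ, k θ)) (f θ, k θ)) -
      Real.logb 2 (pr P (fun θ => (g θ, k θ)) (g θ, k θ))) := by
  unfold cmi
  simp only [ent_eq, mul_sub, mul_add, Finset.sum_sub_distrib, Finset.sum_add_distrib]
  ring

theorem cmi_val (P : Θ → ℝ) (hP : ∀ θ, 0 ≤ P θ) (f : Θ → α) (g : Θ → β) (k : Θ → γ)
    (J K : Θ → ℝ) (hJ : ∀ θ, 0 < P θ → 0 < J θ)
    (h : ∀ θ, 0 < P θ → pr P (fun θ => (f θ, g θ, k θ)) (f θ, g θ, k θ) * pr P k (k θ) * K θ =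
      pr P (fun θ => (f θ, k θ)) (f θ, k θ) * pr P (fun θ => (g θ, k θ)) (g θ, k θ) * J θ) :
    cmi P f g k = ∑ θ, P θ * Real.logb 2 (J θ / K θ) := by
  rw [cmi_eq]
  refine Finset.sum_congr rfl fun θ _ => ?_
  rcases (hP θ).eq_or_lt with h0 | h0
  · rw [← h0]; simp
  congr 1
  have h1 := h0.trans_le (le_pr hP (fun θ => (f θ, g θ, k θ)) θ)
  have h2 := h0.trans_le (le_pr hP k θ)
  have h3 := h0.trans_le (le_pr hP (fun θ => (f θ, k θ)) θ)
  have h4 := h0.trans_le (le_pr hP (fun θ => (g θ, k θ)) θ)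
  have h5 := hJ θ h0
  have h6 : 0 < K θ := by
    have : 0 < pr P (fun θ => (f θ, g θ, k θ)) (f θ, g θ, k θ) * pr P k (k θ) * K θ := by
      rw [h θ h0]; positivity
    exact (mul_pos_iff_of_pos_left (mul_pos h1 h2)).1 this
  have hl := congrArg (Real.logb 2) (h θ h0)
  rw [Real.logb_mul (mul_pos h1 h2).ne' h6.ne', Real.logb_mul h1.ne' h2.ne',
    Real.logb_mul (mul_pos h3 h4).ne' h5.ne', Real.logb_mul h3.ne' h4.ne'] at hl
  rw [Real.logb_div h5.ne' h6.ne']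
  linarith

theorem sum_pr (P : Θ → ℝ) (f : Θ → α) : ∑ a, pr P f a = ∑ θ, P θ := by
  simpa using pr_push P f fun _ => 1

theorem pr_fst (P : Θ → ℝ) (f : Θ → α) (k : Θ → γ) (c : γ) :
    ∑ a, pr P (fun θ => (f θ, k θ)) (a, c) = pr P k c := by
  unfold pr
  rw [Finset.sum_comm]
  refine Finset.sum_congr rfl fun θ _ => ?_
  by_cases h : k θ = c <;> simp [h]

theorem cmi_nonneg (P : Θ → ℝ) (hP : ∀ θ, 0 ≤ P θ)
    (f : Θ → α) (g : Θ → β) (k : Θ → γ) : 0 ≤ cmi P f g k := by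
  set A := fun θ => pr P (fun θ => (f θ, g θ, k θ)) (f θ, g θ, k θ)
  set Z := fun θ => pr P k (k θ)
  set X := fun θ => pr P (fun θ => (f θ, k θ)) (f θ, k θ)
  set Y := fun θ => pr P (fun θ => (g θ, k θ)) (g θ, k θ)
  have hlog2 : 0 < Real.log 2 := Real.log_pos (by norm_num)
  have key : ∑ θ, P θ * (X θ * Y θ / (A θ * Z θ)) ≤ ∑ θ, P θ := by
    have := pr_push P (fun θ => (f θ, g θ, k θ)) fun a =>
      pr P (fun θ => (f θ, k θ)) (a.1, a.2.2) * pr P (fun θ => (g θ, k θ)) (a.2.1, a.2.2) /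
      (pr P (fun θ => (f θ, g θ, k θ)) a * pr P k a.2.2)
    rw [← this]
    calc _ ≤ ∑ a : α × β × γ, pr P (fun θ => (f θ, k θ)) (a.1, a.2.2) *
          pr P (fun θ => (g θ, k θ)) (a.2.1, a.2.2) / pr P k a.2.2 := by
          refine Finset.sum_le_sum fun a _ => ?_
          rcases (pr_nonneg' hP (fun θ => (f θ, g θ, k θ)) a).eq_or_lt with h0 | h0
          · rw [← h0, zero_mul]
            exact div_nonneg (mul_nonneg (pr_nonneg' hP _ _) (pr_nonneg' hP _ _))
              (pr_nonneg' hP _ _)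
          · refine le_of_eq ?_
            rw [mul_div_assoc', mul_div_mul_left _ _ h0.ne']
      _ = ∑ c, pr P k c * pr P k c / pr P k c := by
          rw [Fintype.sum_prod_type_right, Fintype.sum_prod_type_right]
          refine Finset.sum_congr rfl fun c _ => ?_
          simp only [← Finset.sum_div, ← Finset.sum_mul, ← Finset.mul_sum, pr_fst]
      _ = ∑ c, pr P k c := Finset.sum_congr rfl fun c _ => by rw [mul_self_div_self]
      _ = ∑ θ, P θ := sum_pr P k
  rw [cmi_eq]
  have : ∀ θ, (P θ - P θ * (X θ * Y θ / (A θ * Z θ))) / Real.log 2 ≤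
      P θ * (Real.logb 2 (A θ) + Real.logb 2 (Z θ) - Real.logb 2 (X θ) - Real.logb 2 (Y θ)) := by
    intro θ
    rcases (hP θ).eq_or_lt with h0 | h0
    · rw [← h0]; simp
    have h1 : 0 < A θ := h0.trans_le (le_pr hP (fun θ => (f θ, g θ, k θ)) θ)
    have h2 : 0 < Z θ := h0.trans_le (le_pr hP k θ)
    have h3 : 0 < X θ := h0.trans_le (le_pr hP (fun θ => (f θ, k θ)) θ)
    have h4 : 0 < Y θ := h0.trans_le (le_pr hP (fun θ => (g θ, k θ)) θ)
    have hr : 0 < X θ * Y θ / (A θ * Z θ) := by positivity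
    have hl := Real.log_le_sub_one_of_pos hr
    rw [Real.log_div (by positivity) (by positivity), Real.log_mul h3.ne' h4.ne',
      Real.log_mul h1.ne' h2.ne'] at hl
    simp only [Real.logb]
    rw [div_le_iff₀ hlog2]
    have e : P θ * (Real.log (A θ) / Real.log 2 + Real.log (Z θ) / Real.log 2 -
      Real.log (X θ) / Real.log 2 - Real.log (Y θ) / Real.log 2) * Real.log 2 =
      P θ * (Real.log (A θ) + Real.log (Z θ) - Real.log (X θ) - Real.log (Y θ)) := by
      field_simp
    rw [e]
    have := mul_le_mul_of_nonneg_left hl h0.le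
    linarith
  refine le_trans ?_ (Finset.sum_le_sum fun θ _ => this θ)
  rw [← Finset.sum_div, Finset.sum_sub_distrib]
  exact div_nonneg (sub_nonneg.2 key) hlog2.le

end EntGen

set_option linter.unusedSectionVars false
section Laws
variable {U V B T X U' V' B' T' X' Y Q : Type} [Fintype U] [Fintype V] [Fintype B] [Fintype T]
  [Fintype X] [Fintype U'] [Fintype V'] [Fintype B'] [Fintype T'] [Fintype X'] [Fintype Y]
  [Fintype Q]

/-- Channel output law given own input and the other user's layer. -/
noncomputable def Wy (S' : Usr U' V' B' T' X') (W : X → X' → Y → ℝ) (x : X) (t' : T') (y : Y) : ℝ :=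
  ∑ x', S'.kx t' x' * W x x' y

/-- Output likelihood of a false candidate. -/
noncomputable def KW (S : Usr U V B T X) (S' : Usr U' V' B' T' X') (W : X → X' → Y → ℝ)
    (c : Fin 2) (c' : Fin 3) (t : T) (t' : T') (y : Y) : ℝ :=
  ∑ z, ∑ z', S.kap c t z * S'.kap2 c' t' z' * W z z' y

theorem Wy_nonneg (S' : Usr U' V' B' T' X') (W : X → X' → Y → ℝ) (hW : ∀ x x', IsPMF (W x x'))
    (x : X) (t' : T') (y : Y) : 0 ≤ Wy S' W x t' y :=
  Finset.sum_nonneg fun x' _ => mul_nonneg ((S'.hx t').1 _) ((hW x x').1 _)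

theorem Wy_sum (S' : Usr U' V' B' T' X') (W : X → X' → Y → ℝ) (hW : ∀ x x', IsPMF (W x x'))
    (x : X) (t' : T') : ∑ y, Wy S' W x t' y = 1 := by
  unfold Wy
  rw [Finset.sum_comm]
  simp only [← Finset.mul_sum, (hW _ _).2, mul_one, (S'.hx t').2]

theorem triple (α : U → B → ℝ) (δ : V' → B' → ℝ) (γ : Y → T → X → T' → ℝ) :
    ∑ v', ∑ y, ∑ u, ∑ b, ∑ t, ∑ x, ∑ b', ∑ t', α u b * (δ v' b' * γ y t x t') =
    (∑ u, ∑ b, α u b) * ((∑ v', ∑ b', δ v' b') * ∑ y, ∑ t, ∑ x, ∑ t', γ y t x t') := by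
  simp only [← Finset.mul_sum, ← Finset.sum_mul]

theorem sum_al (S : Usr U V B T X) : ∑ u, ∑ b, S.pB b * S.ku b u = 1 := S.pU_sum

theorem sum_de (S : Usr U V B T X) : ∑ v, ∑ b, S.pBV b v = 1 := by
  unfold Usr.pBV
  rw [Finset.sum_comm]
  have : ∀ b, ∑ v, ∑ u, S.pB b * S.ku b u * S.kv u v = S.pB b := by
    intro b
    rw [Finset.sum_comm]
    simp only [← Finset.mul_sum, (S.hv _).2, mul_one, (S.hu _).2]
  simp only [this, S.hB.2]

theorem sum_ga (S : Usr U V B T X) (S' : Usr U' V' B' T' X') (W : X → X' → Y → ℝ)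
    (hW : ∀ x x', IsPMF (W x x')) :
    ∑ y, ∑ t, ∑ x, ∑ t', S.pT t * S.kx t x * S'.pT t' * Wy S' W x t' y = 1 := by
  rw [Finset.sum_comm]
  have : ∀ t, ∑ y, ∑ x, ∑ t', S.pT t * S.kx t x * S'.pT t' * Wy S' W x t' y = S.pT t := by
    intro t
    rw [Finset.sum_comm]
    have : ∀ x, ∑ y, ∑ t', S.pT t * S.kx t x * S'.pT t' * Wy S' W x t' y = S.pT t * S.kx t x := by
      intro x
      rw [Finset.sum_comm]
      simp only [← Finset.mul_sum, Wy_sum S' W hW, mul_one, S'.hT.2]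
    simp only [this, ← Finset.mul_sum, (S.hx _).2, mul_one]
  simp only [this, S.hT.2]

theorem bet_pos (S : Usr U V B T X) (c : Fin 3) (b : B) (v : V) (h : 0 < S.pB b)
    (h' : 0 < S.pBV b v) : 0 < S.bet c b v := by
  unfold Usr.bet
  split_ifs
  · exact mul_pos h (h'.trans_le (Finset.single_le_sum (fun b _ => S.pBV_nonneg b v)
      (Finset.mem_univ b)))
  · exact h'

theorem le_pX (S : Usr U V B T X) (t : T) (x : X) (h : 0 < S.pT t) (h' : 0 < S.kx t x) :
    0 < S.pX x :=
  (mul_pos h h').trans_le (Finset.single_le_sum (f := fun t => S.pT t * S.kx t x)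
    (fun t _ => mul_nonneg (S.hT.1 t) ((S.hx t).1 x)) (Finset.mem_univ t))

theorem KW_pos (S : Usr U V B T X) (S' : Usr U' V' B' T' X') (W : X → X' → Y → ℝ)
    (hW : ∀ x x', IsPMF (W x x')) (c : Fin 2) (c' : Fin 3) (t : T) (x : X) (t' : T') (y : Y)
    (ht : 0 < S.pT t) (hx : 0 < S.kx t x) (ht' : 0 < S'.pT t') (hy : 0 < Wy S' W x t' y) :
    0 < KW S S' W c c' t t' y := by
  obtain ⟨x', -, hx'⟩ : ∃ x' ∈ Finset.univ, 0 < S'.kx t' x' * W x x' y := by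
    by_contra hc
    push Not at hc
    exact absurd hy (not_lt.2 (Finset.sum_nonpos hc))
  have h1 : 0 < S'.kx t' x' := by
    rcases ((S'.hx t').1 x').eq_or_lt with h | h
    · rw [← h, zero_mul] at hx'; exact absurd hx' (lt_irrefl _)
    · exact h
  have h2 : 0 < W x x' y := (mul_pos_iff_of_pos_left h1).1 hx'
  have k1 : 0 < S.kap c t x := by
    unfold Usr.kap; split_ifs; exacts [hx, le_pX S t x ht hx]
  have k2 : 0 < S'.kap2 c' t' x' := by
    unfold Usr.kap2; split_ifs; exacts [h1, le_pX S' t' x' ht' h1]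
  have nn : ∀ z z', 0 ≤ S.kap c t z * S'.kap2 c' t' z' * W z z' y := fun z z' =>
    mul_nonneg (mul_nonneg (S.kap_nonneg c t z) (S'.kap2_nonneg c' t' z')) ((hW z z').1 y)
  unfold KW
  calc 0 < S.kap c t x * S'.kap2 c' t' x' * W x x' y := by positivity
    _ ≤ ∑ z', S.kap c t x * S'.kap2 c' t' z' * W x z' y :=
      Finset.single_le_sum (f := fun z' => S.kap c t x * S'.kap2 c' t' z' * W x z' y)
        (fun z' _ => nn x z') (Finset.mem_univ x')
    _ ≤ _ := Finset.single_le_sum (f := fun z => ∑ z', S.kap c t z * S'.kap2 c' t' z' * W z z' y)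
        (fun z _ => Finset.sum_nonneg fun z' _ => nn z z') (Finset.mem_univ x)

theorem LL_pt (s : Usr U V B T X) (s' : Usr U' V' B' T' X')
    (W : X → X' → Y → ℝ) (hW : ∀ x x', IsPMF (W x x')) (c : Fin 2) (c' : Fin 3)
    (v' : V') (y : Y) (u : U) (b : B) (t : T) (x : X) (b' : B') (t' : T') :
    Pa s s' W u b t x b' v' t' y *
      Real.logb 2 (RR s s' W c c' b t x b' v' t' y / Pa s s' W u b t x b' v' t' y) =
    s.pB b * s.ku b u * (s'.pBV b' v' * Real.logb 2 (s'.bet c' b' v' / s'.pBV b' v') *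
        (s.pT t * s.kx t x * s'.pT t' * Wy s' W x t' y)) -
    s.pB b * s.ku b u * (s'.pBV b' v' * (s.pT t * s.kx t x * s'.pT t' * Wy s' W x t' y *
      Real.logb 2 (Wy s' W x t' y / KW s s' W c c' t t' y))) -
    s.pB b * s.ku b u * Real.logb 2 (s.ku b u) * (s'.pBV b' v' *
      (s.pT t * s.kx t x * s'.pT t' * Wy s' W x t' y)) := by
  have hPa : Pa s s' W u b t x b' v' t' y =
      s.pB b * s.ku b u * (s'.pBV b' v' * (s.pT t * s.kx t x * s'.pT t' * Wy s' W x t' y)) := by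
    unfold Pa Wy; ring
  rcases (s.hB.1 b).eq_or_lt with e | p1
  · rw [hPa, ← e]; simp
  rcases ((s.hu b).1 u).eq_or_lt with e | p2
  · rw [hPa, ← e]; simp
  rcases (s'.pBV_nonneg b' v').eq_or_lt with e | p3
  · rw [hPa, ← e]; simp
  rcases (s.hT.1 t).eq_or_lt with e | p4
  · rw [hPa, ← e]; simp
  rcases ((s.hx t).1 x).eq_or_lt with e | p5
  · rw [hPa, ← e]; simp
  rcases (s'.hT.1 t').eq_or_lt with e | p6
  · rw [hPa, ← e]; simp
  rcases (Wy_nonneg s' W hW x t' y).eq_or_lt with e | p7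
  · rw [hPa, ← e]; simp
  have p8 : 0 < s'.pB b' := by
    rcases (s'.hB.1 b').eq_or_lt with e | p
    · have : s'.pBV b' v' = 0 := by unfold Usr.pBV; simp [← e]
      linarith
    · exact p
  have p9 := bet_pos s' c' b' v' p8 p3
  have p10 := KW_pos s s' W hW c c' t x t' y p4 p5 p6 p7
  have hr : RR s s' W c c' b t x b' v' t' y / Pa s s' W u b t x b' v' t' y =
      (s'.bet c' b' v' / s'.pBV b' v') / (Wy s' W x t' y / KW s s' W c c' t t' y) / s.ku b u := by
    rw [hPa]
    change s.pB b * s.pT t * s.kx t x * (s'.pT t' * s'.bet c' b' v') * KW s s' W c c' t t' y / _ = _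
    field_simp
  rw [hr, Real.logb_div (by positivity) p2.ne', Real.logb_div (by positivity) (by positivity), hPa]
  ring

theorem LL_one (s : Usr U V B T X) (s' : Usr U' V' B' T' X')
    (W : X → X' → Y → ℝ) (hW : ∀ x x', IsPMF (W x x')) (c : Fin 2) (c' : Fin 3) :
    ∑ v', ∑ y, ∑ u, ∑ b, ∑ t, ∑ x, ∑ b', ∑ t', Pa s s' W u b t x b' v' t' y *
      Real.logb 2 (RR s s' W c c' b t x b' v' t' y / Pa s s' W u b t x b' v' t' y) =
      (∑ v', ∑ b', s'.pBV b' v' * Real.logb 2 (s'.bet c' b' v' / s'.pBV b' v')) -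
      (∑ y, ∑ t, ∑ x, ∑ t', s.pT t * s.kx t x * s'.pT t' *
        Wy s' W x t' y * Real.logb 2 (Wy s' W x t' y / KW s s' W c c' t t' y)) -
      (∑ u, ∑ b, s.pB b * s.ku b u * Real.logb 2 (s.ku b u)) := by
  have h1 := triple (fun u b => s.pB b * s.ku b u) (fun v' b' => s'.pBV b' v' *
    Real.logb 2 (s'.bet c' b' v' / s'.pBV b' v'))
    (fun y t x t' => s.pT t * s.kx t x * s'.pT t' * Wy s' W x t' y)
  have h2 := triple (fun u b => s.pB b * s.ku b u) (fun v' b' => s'.pBV b' v')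
    (fun y t x t' => s.pT t * s.kx t x * s'.pT t' * Wy s' W x t' y *
      Real.logb 2 (Wy s' W x t' y / KW s s' W c c' t t' y))
  have h3 := triple (fun u b => s.pB b * s.ku b u * Real.logb 2 (s.ku b u))
    (fun v' b' => s'.pBV b' v') (fun y t x t' => s.pT t * s.kx t x * s'.pT t' * Wy s' W x t' y)
  rw [sum_al, sum_ga s s' W hW, one_mul, mul_one] at h1
  rw [sum_al, sum_de, one_mul, one_mul] at h2
  rw [sum_de, sum_ga s s' W hW, one_mul, mul_one] at h3
  rw [← h1, ← h2, ← h3]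
  simp only [← Finset.sum_sub_distrib, LL_pt s s' W hW]

theorem LL_split (pQ : Q → ℝ) (S : Q → Usr U V B T X) (S' : Q → Usr U' V' B' T' X')
    (W : X → X' → Y → ℝ) (hW : ∀ x x', IsPMF (W x x')) (c : Fin 2) (c' : Fin 3) :
    LL pQ S S' W c c' =
      (∑ q, ∑ v', ∑ b', pQ q * (S' q).pBV b' v' *
        Real.logb 2 ((S' q).bet c' b' v' / (S' q).pBV b' v')) -
      (∑ q, ∑ y, ∑ t, ∑ x, ∑ t', pQ q * ((S q).pT t * (S q).kx t x * (S' q).pT t' *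
        Wy (S' q) W x t' y) * Real.logb 2 (Wy (S' q) W x t' y / KW (S q) (S' q) W c c' t t' y)) -
      (∑ q, ∑ u, ∑ b, pQ q * ((S q).pB b * (S q).ku b u) * Real.logb 2 ((S q).ku b u)) := by
  unfold LL
  rw [← Finset.sum_sub_distrib, ← Finset.sum_sub_distrib]
  refine Finset.sum_congr rfl fun q _ => ?_
  have h := LL_one (S q) (S' q) W hW c c'
  simp only [mul_assoc (pQ q), ← Finset.mul_sum]
  rw [h]
  ring

end Laws

set_option linter.unusedSectionVars false
section ChanLaw
variable {U V B T X U' V' B' T' X' Y Q : Type} [Fintype U] [Fintype V] [Fintype B] [Fintype T]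
  [Fintype X] [Fintype U'] [Fintype V'] [Fintype B'] [Fintype T'] [Fintype X'] [Fintype Y]
  [Fintype Q]

/-- Law of `(Q, Y, T, X, T')`. -/
noncomputable def P5 (pQ : Q → ℝ) (S : Q → Usr U V B T X) (S' : Q → Usr U' V' B' T' X')
    (W : X → X' → Y → ℝ) : Q × Y × T × X × T' → ℝ :=
  fun (q, y, t, x, t') => pQ q * ((S q).pT t * (S q).kx t x * (S' q).pT t' * Wy (S' q) W x t' y)

theorem KW_zero (S : Usr U V B T X) (S' : Usr U' V' B' T' X') (W : X → X' → Y → ℝ)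
    (c : Fin 2) (t : T) (t' : T') (y : Y) :
    KW S S' W c 0 t t' y = ∑ z, S.kap c t z * Wy S' W z t' y := by
  unfold KW Wy
  simp only [Finset.mul_sum, Usr.kap2, if_true, mul_assoc]

theorem KW_succ (S : Usr U V B T X) (S' : Usr U' V' B' T' X') (W : X → X' → Y → ℝ)
    (c : Fin 2) (c' : Fin 3) (hc' : c' ≠ 0) (t : T) (t' : T') (y : Y) :
    KW S S' W c c' t t' y = ∑ z, S.kap c t z * ∑ t'', S'.pT t'' * Wy S' W z t'' y := by
  unfold KW Wy
  refine Finset.sum_congr rfl fun z _ => ?_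
  simp only [Finset.mul_sum, Usr.kap2, hc', if_false, Usr.pX, Finset.sum_mul]
  rw [Finset.sum_comm]
  refine Finset.sum_congr rfl fun t'' _ => Finset.sum_congr rfl fun z' _ => ?_
  ring

variable (pQ : Q → ℝ) (hQ : IsPMF pQ) (S : Q → Usr U V B T X) (S' : Q → Usr U' V' B' T' X')
    (W : X → X' → Y → ℝ) (hW : ∀ x x', IsPMF (W x x'))

include hQ hW in
theorem P5_nonneg (θ : Q × Y × T × X × T') : 0 ≤ P5 pQ S S' W θ :=
  mul_nonneg (hQ.1 _) (mul_nonneg (mul_nonneg (mul_nonneg ((S _).hT.1 _) (((S _).hx _).1 _))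
    ((S' _).hT.1 _)) (Wy_nonneg _ W hW _ _ _))

theorem m_all (q : Q) (y : Y) (t : T) (x : X) (t' : T') :
    pr (P5 pQ S S' W) (fun θ => (θ.2.2.2.1, θ.2.1, θ.2.2.1, θ.2.2.2.2, θ.1)) (x, y, t, t', q) =
    pQ q * ((S q).pT t * (S q).kx t x * (S' q).pT t' * Wy (S' q) W x t' y) := by
  rw [pr_marg _ _ (⟨fun a => (a.1.2.2.2.2, a.1.2.1, a.1.2.2.1, a.1.1, a.1.2.2.2.1),
    fun θ => ((θ.2.2.2.1, θ.2.1, θ.2.2.1, θ.2.2.2.2, θ.1), ()), fun _ => rfl, fun _ => rfl⟩ :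
    (X × Y × T × T' × Q) × Unit ≃ Q × Y × T × X × T') (fun _ _ => rfl)]
  simp [P5]

theorem m_all2 (q : Q) (y : Y) (t : T) (x : X) (t' : T') :
    pr (P5 pQ S S' W) (fun θ => ((θ.2.2.2.1, θ.2.2.2.2), θ.2.1, θ.2.2.1, θ.1)) ((x, t'), y, t, q) =
    pQ q * ((S q).pT t * (S q).kx t x * (S' q).pT t' * Wy (S' q) W x t' y) := by
  rw [pr_marg _ _ (⟨fun a => (a.1.2.2.2, a.1.2.1, a.1.2.2.1, a.1.1.1, a.1.1.2),
    fun θ => (((θ.2.2.2.1, θ.2.2.2.2), θ.2.1, θ.2.2.1, θ.1), ()), fun _ => rfl, fun _ => rfl⟩ :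
    ((X × T') × Y × T × Q) × Unit ≃ Q × Y × T × X × T') (fun _ _ => rfl)]
  simp [P5]

theorem m_yttq (q : Q) (y : Y) (t : T) (t' : T') :
    pr (P5 pQ S S' W) (fun θ => (θ.2.1, θ.2.2.1, θ.2.2.2.2, θ.1)) (y, t, t', q) =
    pQ q * (S q).pT t * (S' q).pT t' * KW (S q) (S' q) W 0 0 t t' y := by
  rw [pr_marg _ _ (⟨fun a => (a.1.2.2.2, a.1.1, a.1.2.1, a.2, a.1.2.2.1),
    fun θ => ((θ.2.1, θ.2.2.1, θ.2.2.2.2, θ.1), θ.2.2.2.1), fun _ => rfl, fun _ => rfl⟩ :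
    (Y × T × T' × Q) × X ≃ Q × Y × T × X × T') (fun _ _ => rfl)]
  rw [KW_zero, Finset.mul_sum]
  simp only [P5, Usr.kap, if_true, Equiv.coe_fn_mk]
  exact Finset.sum_congr rfl fun _ _ => by ring

include hW in
theorem m_xttq (q : Q) (x : X) (t : T) (t' : T') :
    pr (P5 pQ S S' W) (fun θ => (θ.2.2.2.1, θ.2.2.1, θ.2.2.2.2, θ.1)) (x, t, t', q) =
    pQ q * ((S q).pT t * (S q).kx t x * (S' q).pT t') := by
  rw [pr_marg _ _ (⟨fun a => (a.1.2.2.2, a.2, a.1.2.1, a.1.1, a.1.2.2.1),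
    fun θ => ((θ.2.2.2.1, θ.2.2.1, θ.2.2.2.2, θ.1), θ.2.1), fun _ => rfl, fun _ => rfl⟩ :
    (X × T × T' × Q) × Y ≃ Q × Y × T × X × T') (fun _ _ => rfl)]
  simp only [P5, Equiv.coe_fn_mk, ← Finset.mul_sum, Wy_sum _ W hW, mul_one]

include hW in
theorem m_xttq2 (q : Q) (x : X) (t : T) (t' : T') :
    pr (P5 pQ S S' W) (fun θ => ((θ.2.2.2.1, θ.2.2.2.2), θ.2.2.1, θ.1)) ((x, t'), t, q) =
    pQ q * ((S q).pT t * (S q).kx t x * (S' q).pT t') := by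
  rw [pr_marg _ _ (⟨fun a => (a.1.2.2, a.2, a.1.2.1, a.1.1.1, a.1.1.2),
    fun θ => (((θ.2.2.2.1, θ.2.2.2.2), θ.2.2.1, θ.1), θ.2.1), fun _ => rfl, fun _ => rfl⟩ :
    ((X × T') × T × Q) × Y ≃ Q × Y × T × X × T') (fun _ _ => rfl)]
  simp only [P5, Equiv.coe_fn_mk, ← Finset.mul_sum, Wy_sum _ W hW, mul_one]

include hW in
theorem m_ttq (q : Q) (t : T) (t' : T') :
    pr (P5 pQ S S' W) (fun θ => (θ.2.2.1, θ.2.2.2.2, θ.1)) (t, t', q) =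
    pQ q * ((S q).pT t * (S' q).pT t') := by
  rw [pr_marg _ _ (⟨fun a => (a.1.2.2, a.2.2, a.1.1, a.2.1, a.1.2.1),
    fun θ => ((θ.2.2.1, θ.2.2.2.2, θ.1), (θ.2.2.2.1, θ.2.1)), fun _ => rfl, fun _ => rfl⟩ :
    (T × T' × Q) × (X × Y) ≃ Q × Y × T × X × T') (fun _ _ => rfl)]
  simp only [P5, Equiv.coe_fn_mk, Fintype.sum_prod_type, ← Finset.mul_sum, Wy_sum _ W hW, mul_one,
    ← Finset.sum_mul, ((S _).hx _).2]

theorem m_xytq (q : Q) (x : X) (y : Y) (t' : T') :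
    pr (P5 pQ S S' W) (fun θ => (θ.2.2.2.1, θ.2.1, θ.2.2.2.2, θ.1)) (x, y, t', q) =
    pQ q * ((S q).pX x * (S' q).pT t' * Wy (S' q) W x t' y) := by
  rw [pr_marg _ _ (⟨fun a => (a.1.2.2.2, a.1.2.1, a.2, a.1.1, a.1.2.2.1),
    fun θ => ((θ.2.2.2.1, θ.2.1, θ.2.2.2.2, θ.1), θ.2.2.1), fun _ => rfl, fun _ => rfl⟩ :
    (X × Y × T' × Q) × T ≃ Q × Y × T × X × T') (fun _ _ => rfl)]
  simp only [P5, Equiv.coe_fn_mk, ← Finset.mul_sum, ← Finset.sum_mul, Usr.pX]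

theorem m_xytq2 (q : Q) (x : X) (y : Y) (t' : T') :
    pr (P5 pQ S S' W) (fun θ => ((θ.2.2.2.1, θ.2.2.2.2), θ.2.1, θ.1)) ((x, t'), y, q) =
    pQ q * ((S q).pX x * (S' q).pT t' * Wy (S' q) W x t' y) := by
  rw [pr_marg _ _ (⟨fun a => (a.1.2.2, a.1.2.1, a.2, a.1.1.1, a.1.1.2),
    fun θ => (((θ.2.2.2.1, θ.2.2.2.2), θ.2.1, θ.1), θ.2.2.1), fun _ => rfl, fun _ => rfl⟩ :
    ((X × T') × Y × Q) × T ≃ Q × Y × T × X × T') (fun _ _ => rfl)]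
  simp only [P5, Equiv.coe_fn_mk, ← Finset.mul_sum, ← Finset.sum_mul, Usr.pX]

include hW in
theorem m_xtq (q : Q) (x : X) (t' : T') :
    pr (P5 pQ S S' W) (fun θ => (θ.2.2.2.1, θ.2.2.2.2, θ.1)) (x, t', q) =
    pQ q * ((S q).pX x * (S' q).pT t') := by
  rw [pr_marg _ _ (⟨fun a => (a.1.2.2, a.2.2, a.2.1, a.1.1, a.1.2.1),
    fun θ => ((θ.2.2.2.1, θ.2.2.2.2, θ.1), (θ.2.2.1, θ.2.1)), fun _ => rfl, fun _ => rfl⟩ :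
    (X × T' × Q) × (T × Y) ≃ Q × Y × T × X × T') (fun _ _ => rfl)]
  simp only [P5, Equiv.coe_fn_mk, Fintype.sum_prod_type, ← Finset.mul_sum, Wy_sum _ W hW, mul_one,
    ← Finset.sum_mul, Usr.pX]

include hW in
theorem m_xtq2 (q : Q) (x : X) (t' : T') :
    pr (P5 pQ S S' W) (fun θ => ((θ.2.2.2.1, θ.2.2.2.2), θ.1)) ((x, t'), q) =
    pQ q * ((S q).pX x * (S' q).pT t') := by
  rw [pr_marg _ _ (⟨fun a => (a.1.2, a.2.2, a.2.1, a.1.1.1, a.1.1.2),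
    fun θ => (((θ.2.2.2.1, θ.2.2.2.2), θ.1), (θ.2.2.1, θ.2.1)), fun _ => rfl, fun _ => rfl⟩ :
    ((X × T') × Q) × (T × Y) ≃ Q × Y × T × X × T') (fun _ _ => rfl)]
  simp only [P5, Equiv.coe_fn_mk, Fintype.sum_prod_type, ← Finset.mul_sum, Wy_sum _ W hW, mul_one,
    ← Finset.sum_mul, Usr.pX]

theorem pX_sum (s : Usr U V B T X) : ∑ x, s.pX x = 1 := by
  unfold Usr.pX
  rw [Finset.sum_comm]
  simp only [← Finset.mul_sum, (s.hx _).2, mul_one, s.hT.2]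

include hW in
theorem m_tq' (q : Q) (t' : T') :
    pr (P5 pQ S S' W) (fun θ => (θ.2.2.2.2, θ.1)) (t', q) = pQ q * (S' q).pT t' := by
  rw [pr_marg _ _ (⟨fun a => (a.1.2, a.2.2.2, a.2.1, a.2.2.1, a.1.1),
    fun θ => ((θ.2.2.2.2, θ.1), (θ.2.2.1, θ.2.2.2.1, θ.2.1)), fun _ => rfl, fun _ => rfl⟩ :
    (T' × Q) × (T × X × Y) ≃ Q × Y × T × X × T') (fun _ _ => rfl)]
  simp only [P5, Equiv.coe_fn_mk, Fintype.sum_prod_type, ← Finset.mul_sum, Wy_sum _ W hW, mul_one,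
    ← Finset.sum_mul, ((S _).hx _).2, (S _).hT.2, one_mul]

include hW in
theorem m_tq (q : Q) (t : T) :
    pr (P5 pQ S S' W) (fun θ => (θ.2.2.1, θ.1)) (t, q) = pQ q * (S q).pT t := by
  rw [pr_marg _ _ (⟨fun a => (a.1.2, a.2.2.2, a.1.1, a.2.1, a.2.2.1),
    fun θ => ((θ.2.2.1, θ.1), (θ.2.2.2.1, θ.2.2.2.2, θ.2.1)), fun _ => rfl, fun _ => rfl⟩ :
    (T × Q) × (X × T' × Y) ≃ Q × Y × T × X × T') (fun _ _ => rfl)]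
  simp only [P5, Equiv.coe_fn_mk, Fintype.sum_prod_type, ← Finset.mul_sum, Wy_sum _ W hW, mul_one,
    ((S _).hx _).2, (S' _).hT.2]

include hW in
theorem m_q (q : Q) : pr (P5 pQ S S' W) (fun θ => θ.1) q = pQ q := by
  rw [pr_marg _ _ (⟨fun a => (a.1, a.2.2.2.2, a.2.1, a.2.2.1, a.2.2.2.1),
    fun θ => (θ.1, (θ.2.2.1, θ.2.2.2.1, θ.2.2.2.2, θ.2.1)), fun _ => rfl, fun _ => rfl⟩ :
    Q × (T × X × T' × Y) ≃ Q × Y × T × X × T') (fun _ _ => rfl)]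
  simp only [P5, Equiv.coe_fn_mk, Fintype.sum_prod_type, ← Finset.mul_sum, Wy_sum _ W hW, mul_one,
    ((S _).hx _).2, (S _).hT.2, (S' _).hT.2]

theorem m_ytq' (q : Q) (y : Y) (t : T) (t' : T') :
    pr (P5 pQ S S' W) (fun θ => (θ.2.1, θ.2.2.2.2, θ.1)) (y, t', q) =
    pQ q * (S' q).pT t' * KW (S q) (S' q) W 1 0 t t' y := by
  rw [pr_marg _ _ (⟨fun a => (a.1.2.2, a.1.1, a.2.2, a.2.1, a.1.2.1),
    fun θ => ((θ.2.1, θ.2.2.2.2, θ.1), (θ.2.2.2.1, θ.2.2.1)), fun _ => rfl, fun _ => rfl⟩ :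
    (Y × T' × Q) × (X × T) ≃ Q × Y × T × X × T') (fun _ _ => rfl)]
  rw [KW_zero]
  simp only [P5, Usr.kap, one_ne_zero, if_false, Equiv.coe_fn_mk, Fintype.sum_prod_type,
    ← Finset.mul_sum, ← Finset.sum_mul, Usr.pX]
  rw [mul_assoc]
  congr 1
  rw [Finset.mul_sum]
  exact Finset.sum_congr rfl fun _ _ => by ring

theorem m_ytq (q : Q) (y : Y) (t : T) (t' : T') (c' : Fin 3) (hc' : c' ≠ 0) :
    pr (P5 pQ S S' W) (fun θ => (θ.2.1, θ.2.2.1, θ.1)) (y, t, q) =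
    pQ q * (S q).pT t * KW (S q) (S' q) W 0 c' t t' y := by
  rw [pr_marg _ _ (⟨fun a => (a.1.2.2, a.1.1, a.1.2.1, a.2.1, a.2.2),
    fun θ => ((θ.2.1, θ.2.2.1, θ.1), (θ.2.2.2.1, θ.2.2.2.2)), fun _ => rfl, fun _ => rfl⟩ :
    (Y × T × Q) × (X × T') ≃ Q × Y × T × X × T') (fun _ _ => rfl)]
  rw [KW_succ _ _ _ _ _ hc', Finset.mul_sum]
  simp only [P5, Usr.kap, if_true, Equiv.coe_fn_mk, Fintype.sum_prod_type, Finset.mul_sum]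
  exact Finset.sum_congr rfl fun _ _ => Finset.sum_congr rfl fun _ _ => by ring

theorem m_yq (q : Q) (y : Y) (t : T) (t' : T') (c' : Fin 3) (hc' : c' ≠ 0) :
    pr (P5 pQ S S' W) (fun θ => (θ.2.1, θ.1)) (y, q) =
    pQ q * KW (S q) (S' q) W 1 c' t t' y := by
  rw [pr_marg _ _ (⟨fun a => (a.1.2, a.1.1, a.2.2.2, a.2.1, a.2.2.1),
    fun θ => ((θ.2.1, θ.1), (θ.2.2.2.1, θ.2.2.2.2, θ.2.2.1)), fun _ => rfl, fun _ => rfl⟩ :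
    (Y × Q) × (X × T' × T) ≃ Q × Y × T × X × T') (fun _ _ => rfl)]
  rw [KW_succ _ _ _ _ _ hc', Finset.mul_sum]
  simp only [P5, Usr.kap, one_ne_zero, if_false, Equiv.coe_fn_mk, Fintype.sum_prod_type,
    ← Finset.mul_sum, ← Finset.sum_mul]
  simp only [Usr.pX, Finset.mul_sum]
  exact Finset.sum_congr rfl fun _ _ => Finset.sum_congr rfl fun _ _ => by ring

/-- Information term of a candidate class. -/
noncomputable def GA (c : Fin 2) (c' : Fin 3) : ℝ :=
  ∑ q, ∑ y, ∑ t, ∑ x, ∑ t', pQ q * ((S q).pT t * (S q).kx t x * (S' q).pT t' *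
        Wy (S' q) W x t' y) * Real.logb 2 (Wy (S' q) W x t' y / KW (S q) (S' q) W c c' t t' y)

theorem GA_eq (c : Fin 2) (c' : Fin 3) : GA pQ S S' W c c' = ∑ θ, P5 pQ S S' W θ *
    Real.logb 2 (Wy (S' θ.1) W θ.2.2.2.1 θ.2.2.2.2 θ.2.1 /
      KW (S θ.1) (S' θ.1) W c c' θ.2.2.1 θ.2.2.2.2 θ.2.1) := by
  simp only [Fintype.sum_prod_type]
  rfl

include hQ hW in
theorem P5_Wy (θ : Q × Y × T × X × T') (h : 0 < P5 pQ S S' W θ) :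
    0 < Wy (S' θ.1) W θ.2.2.2.1 θ.2.2.2.2 θ.2.1 := by
  refine lt_of_le_of_ne (Wy_nonneg _ W hW _ _ _) fun h0 => ?_
  have : P5 pQ S S' W θ = 0 := by
    obtain ⟨q, y, t, x, t'⟩ := θ
    simp only at h0
    simp only [P5, ← h0, mul_zero]
  linarith

include hQ hW in
theorem cmi_a : cmi (P5 pQ S S' W) (fun θ => θ.2.2.2.1) (fun θ => θ.2.1)
    (fun θ => (θ.2.2.1, θ.2.2.2.2, θ.1)) = GA pQ S S' W 0 0 := by
  rw [GA_eq]
  refine cmi_val _ (P5_nonneg pQ hQ S S' W hW) _ _ _ _ _ (P5_Wy pQ hQ S S' W hW) ?_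
  rintro ⟨q, y, t, x, t'⟩ -
  simp only
  rw [m_all, m_ttq pQ S S' W hW, m_xttq pQ S S' W hW, m_yttq]
  ring

include hQ hW in
theorem cmi_d : cmi (P5 pQ S S' W) (fun θ => θ.2.2.2.1) (fun θ => θ.2.1)
    (fun θ => (θ.2.2.2.2, θ.1)) = GA pQ S S' W 1 0 := by
  rw [GA_eq]
  refine cmi_val _ (P5_nonneg pQ hQ S S' W hW) _ _ _ _ _ (P5_Wy pQ hQ S S' W hW) ?_
  rintro ⟨q, y, t, x, t'⟩ -
  simp only
  rw [m_xytq, m_tq' pQ S S' W hW, m_xtq pQ S S' W hW, m_ytq' pQ S S' W q y t t']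
  ring

include hQ hW in
theorem cmi_e (c' : Fin 3) (hc' : c' ≠ 0) : cmi (P5 pQ S S' W)
    (fun θ => (θ.2.2.2.1, θ.2.2.2.2)) (fun θ => θ.2.1)
    (fun θ => (θ.2.2.1, θ.1)) = GA pQ S S' W 0 c' := by
  rw [GA_eq]
  refine cmi_val _ (P5_nonneg pQ hQ S S' W hW) _ _ _ _ _ (P5_Wy pQ hQ S S' W hW) ?_
  rintro ⟨q, y, t, x, t'⟩ -
  simp only
  rw [m_all2, m_tq pQ S S' W hW, m_xttq2 pQ S S' W hW, m_ytq pQ S S' W q y t t' c' hc']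
  ring

include hQ hW in
theorem cmi_g (c' : Fin 3) (hc' : c' ≠ 0) : cmi (P5 pQ S S' W)
    (fun θ => (θ.2.2.2.1, θ.2.2.2.2)) (fun θ => θ.2.1)
    (fun θ => θ.1) = GA pQ S S' W 1 c' := by
  rw [GA_eq]
  refine cmi_val _ (P5_nonneg pQ hQ S S' W hW) _ _ _ _ _ (P5_Wy pQ hQ S S' W hW) ?_
  rintro ⟨q, y, t, x, t'⟩ -
  simp only
  rw [m_xytq2, m_q pQ S S' W hW, m_xtq2 pQ S S' W hW, m_yq pQ S S' W q y t t' c' hc']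
  ring

end ChanLaw

set_option linter.unusedSectionVars false
section SrcLaw
variable {U V B T X Q : Type} [Fintype U] [Fintype V] [Fintype B] [Fintype T]
  [Fintype X] [Fintype Q]

/-- Law of `(Q, B, U, V)`. -/
noncomputable def P4 (pQ : Q → ℝ) (S : Q → Usr U V B T X) : Q × B × U × V → ℝ :=
  fun (q, b, u, v) => pQ q * ((S q).pB b * (S q).ku b u * (S q).kv u v)

variable (pQ : Q → ℝ) (hQ : IsPMF pQ) (S : Q → Usr U V B T X)

include hQ in
theorem P4_nonneg (θ : Q × B × U × V) : 0 ≤ P4 pQ S θ :=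
  mul_nonneg (hQ.1 _) (mul_nonneg (mul_nonneg ((S _).hB.1 _) (((S _).hu _).1 _)) (((S _).hv _).1 _))

theorem s_buq (q : Q) (b : B) (u : U) :
    pr (P4 pQ S) (fun θ => (θ.2.1, θ.2.2.1, θ.1)) (b, u, q) = pQ q * ((S q).pB b * (S q).ku b u) := by
  rw [pr_marg _ _ (⟨fun a => (a.1.2.2, a.1.1, a.1.2.1, a.2),
    fun θ => ((θ.2.1, θ.2.2.1, θ.1), θ.2.2.2), fun _ => rfl, fun _ => rfl⟩ :
    (B × U × Q) × V ≃ Q × B × U × V) (fun _ _ => rfl)]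
  simp only [P4, Equiv.coe_fn_mk, ← Finset.mul_sum, ((S _).hv _).2, mul_one]

theorem s_q (q : Q) : pr (P4 pQ S) (fun θ => θ.1) q = pQ q := by
  rw [pr_marg _ _ (⟨fun a => (a.1, a.2.1, a.2.2.1, a.2.2.2),
    fun θ => (θ.1, (θ.2.1, θ.2.2.1, θ.2.2.2)), fun _ => rfl, fun _ => rfl⟩ :
    Q × (B × U × V) ≃ Q × B × U × V) (fun _ _ => rfl)]
  simp only [P4, Equiv.coe_fn_mk, Fintype.sum_prod_type, ← Finset.mul_sum, ((S _).hv _).2, mul_one,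
    ((S _).hu _).2, (S _).hB.2]

theorem s_bq (q : Q) (b : B) :
    pr (P4 pQ S) (fun θ => (θ.2.1, θ.1)) (b, q) = pQ q * (S q).pB b := by
  rw [pr_marg _ _ (⟨fun a => (a.1.2, a.1.1, a.2.1, a.2.2),
    fun θ => ((θ.2.1, θ.1), (θ.2.2.1, θ.2.2.2)), fun _ => rfl, fun _ => rfl⟩ :
    (B × Q) × (U × V) ≃ Q × B × U × V) (fun _ _ => rfl)]
  simp only [P4, Equiv.coe_fn_mk, Fintype.sum_prod_type, ← Finset.mul_sum, ((S _).hv _).2, mul_one,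
    ((S _).hu _).2]

theorem s_uq (q : Q) (u : U) :
    pr (P4 pQ S) (fun θ => (θ.2.2.1, θ.1)) (u, q) = pQ q * (S q).pU u := by
  rw [pr_marg _ _ (⟨fun a => (a.1.2, a.2.1, a.1.1, a.2.2),
    fun θ => ((θ.2.2.1, θ.1), (θ.2.1, θ.2.2.2)), fun _ => rfl, fun _ => rfl⟩ :
    (U × Q) × (B × V) ≃ Q × B × U × V) (fun _ _ => rfl)]
  simp only [P4, Equiv.coe_fn_mk, Fintype.sum_prod_type, ← Finset.mul_sum, ((S _).hv _).2, mul_one,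
    Usr.pU]

theorem s_bvq (q : Q) (b : B) (v : V) :
    pr (P4 pQ S) (fun θ => (θ.2.1, θ.2.2.2, θ.1)) (b, v, q) = pQ q * (S q).pBV b v := by
  rw [pr_marg _ _ (⟨fun a => (a.1.2.2, a.1.1, a.2, a.1.2.1),
    fun θ => ((θ.2.1, θ.2.2.2, θ.1), θ.2.2.1), fun _ => rfl, fun _ => rfl⟩ :
    (B × V × Q) × U ≃ Q × B × U × V) (fun _ _ => rfl)]
  simp only [P4, Equiv.coe_fn_mk, ← Finset.mul_sum, Usr.pBV]

theorem s_vq (q : Q) (v : V) :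
    pr (P4 pQ S) (fun θ => (θ.2.2.2, θ.1)) (v, q) = pQ q * (S q).pV v := by
  rw [pr_marg _ _ (⟨fun a => (a.1.2, a.2.1, a.2.2, a.1.1),
    fun θ => ((θ.2.2.2, θ.1), (θ.2.1, θ.2.2.1)), fun _ => rfl, fun _ => rfl⟩ :
    (V × Q) × (B × U) ≃ Q × B × U × V) (fun _ _ => rfl)]
  simp only [P4, Equiv.coe_fn_mk, Fintype.sum_prod_type, ← Finset.mul_sum, Usr.pBV, Usr.pV]

theorem s_uvq (q : Q) (u : U) (v : V) :
    pr (P4 pQ S) (fun θ => (θ.2.2.1, θ.2.2.2, θ.1)) (u, v, q) =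
      pQ q * ((S q).pU u * (S q).kv u v) := by
  rw [pr_marg _ _ (⟨fun a => (a.1.2.2, a.2, a.1.1, a.1.2.1),
    fun θ => ((θ.2.2.1, θ.2.2.2, θ.1), θ.2.1), fun _ => rfl, fun _ => rfl⟩ :
    (U × V × Q) × B ≃ Q × B × U × V) (fun _ _ => rfl)]
  simp only [P4, Equiv.coe_fn_mk, ← Finset.mul_sum, ← Finset.sum_mul, Usr.pU]

theorem s_all (q : Q) (b : B) (u : U) (v : V) :
    pr (P4 pQ S) (fun θ => (θ.2.1, θ.2.2.1, θ.2.2.2, θ.1)) (b, u, v, q) =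
      pQ q * ((S q).pB b * (S q).ku b u * (S q).kv u v) := by
  rw [pr_marg _ _ (⟨fun a => (a.1.2.2.2, a.1.1, a.1.2.1, a.1.2.2.1),
    fun θ => ((θ.2.1, θ.2.2.1, θ.2.2.2, θ.1), ()), fun _ => rfl, fun _ => rfl⟩ :
    (B × U × V × Q) × Unit ≃ Q × B × U × V) (fun _ _ => rfl)]
  simp [P4]

theorem s_u (μ : U → ℝ) (hQ : IsPMF pQ) (hU : ∀ q u, (S q).pU u = μ u) (u : U) :
    pr (P4 pQ S) (fun θ => θ.2.2.1) u = μ u := by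
  rw [pr_marg _ _ (⟨fun a => (a.2.1, a.2.2.1, a.1, a.2.2.2),
    fun θ => (θ.2.2.1, (θ.1, θ.2.1, θ.2.2.2)), fun _ => rfl, fun _ => rfl⟩ :
    U × (Q × B × V) ≃ Q × B × U × V) (fun _ _ => rfl)]
  have : ∀ q, ∑ b, (S q).pB b * (S q).ku b u = μ u := fun q => hU q u
  simp only [P4, Equiv.coe_fn_mk, Fintype.sum_prod_type, ← Finset.mul_sum, ((S _).hv _).2, mul_one,
    this, ← Finset.sum_mul, hQ.2, one_mul]

include hQ in
theorem P4_pos (q : Q) (b : B) (u : U) (v : V) (h : 0 < P4 pQ S (q, b, u, v)) :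
    0 < pQ q ∧ 0 < (S q).pB b ∧ 0 < (S q).ku b u ∧ 0 < (S q).kv u v ∧ 0 < (S q).pU u ∧
      0 < (S q).pBV b v ∧ 0 < (S q).pV v := by
  have h' : 0 < pQ q * ((S q).pB b * (S q).ku b u * (S q).kv u v) := h
  have h1 : 0 < pQ q := by
    rcases (hQ.1 q).eq_or_lt with e | e
    · rw [← e] at h'; simp at h'
    · exact e
  have h2 : 0 < (S q).pB b := by
    rcases ((S q).hB.1 b).eq_or_lt with e | e
    · rw [← e] at h'; simp at h'
    · exact e
  have h3 : 0 < (S q).ku b u := by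
    rcases (((S q).hu b).1 u).eq_or_lt with e | e
    · rw [← e] at h'; simp at h'
    · exact e
  have h4 : 0 < (S q).kv u v := by
    rcases (((S q).hv u).1 v).eq_or_lt with e | e
    · rw [← e] at h'; simp at h'
    · exact e
  have h5 : 0 < (S q).pBV b v := by
    refine lt_of_lt_of_le (by positivity : 0 < (S q).pB b * (S q).ku b u * (S q).kv u v)
      (Finset.single_le_sum (f := fun u => (S q).pB b * (S q).ku b u * (S q).kv u v)
      (fun u _ => ?_) (Finset.mem_univ u))
    exact mul_nonneg (mul_nonneg h2.le (((S q).hu b).1 u)) (((S q).hv u).1 v)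
  refine ⟨h1, h2, h3, h4, ?_, h5, ?_⟩
  · exact lt_of_lt_of_le (mul_pos h2 h3)
      (Finset.single_le_sum (f := fun b => (S q).pB b * (S q).ku b u)
      (fun b _ => mul_nonneg ((S q).hB.1 b) (((S q).hu b).1 u)) (Finset.mem_univ b))
  · exact lt_of_lt_of_le h5 (Finset.single_le_sum (f := fun b => (S q).pBV b v)
      (fun b _ => (S q).pBV_nonneg b v) (Finset.mem_univ b))

theorem P4_bu (F : Q → B → U → ℝ) : ∑ θ, P4 pQ S θ * F θ.1 θ.2.1 θ.2.2.1 =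
    ∑ q, ∑ b, ∑ u, pQ q * ((S q).pB b * (S q).ku b u) * F q b u := by
  simp only [Fintype.sum_prod_type, P4]
  refine Finset.sum_congr rfl fun q _ => Finset.sum_congr rfl fun b _ =>
    Finset.sum_congr rfl fun u _ => ?_
  rw [← Finset.sum_mul, ← Finset.mul_sum, ← Finset.mul_sum, ((S q).hv u).2, mul_one]

theorem P4_bv (F : Q → B → V → ℝ) : ∑ θ, P4 pQ S θ * F θ.1 θ.2.1 θ.2.2.2 =
    ∑ q, ∑ v, ∑ b, pQ q * (S q).pBV b v * F q b v := by
  simp only [Fintype.sum_prod_type, P4]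
  refine Finset.sum_congr rfl fun q _ => ?_
  rw [Finset.sum_comm (s := (Finset.univ : Finset V))]
  refine Finset.sum_congr rfl fun b _ => ?_
  rw [Finset.sum_comm]
  refine Finset.sum_congr rfl fun v _ => ?_
  rw [← Finset.sum_mul, ← Finset.mul_sum]
  rfl

include hQ in
theorem cmi_bu : cmi (P4 pQ S) (fun θ => θ.2.1) (fun θ => θ.2.2.1) (fun θ => θ.1) =
    LC pQ S := by
  unfold LC
  rw [← P4_bu pQ S fun q b u => Real.logb 2 ((S q).ku b u / (S q).pU u)]
  refine cmi_val _ (P4_nonneg pQ hQ S) _ _ _ (fun θ => (S θ.1).ku θ.2.1 θ.2.2.1)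
    (fun θ => (S θ.1).pU θ.2.2.1) ?_ ?_
  · rintro ⟨q, b, u, v⟩ h
    exact (P4_pos pQ hQ S q b u v h).2.2.1
  · rintro ⟨q, b, u, v⟩ -
    simp only
    rw [s_buq, s_q, s_bq, s_uq]
    ring

/-- `-I(B;V|Q)` -/
noncomputable def LV (c : Fin 3) : ℝ := ∑ q, ∑ v, ∑ b, pQ q * (S q).pBV b v *
        Real.logb 2 ((S q).bet c b v / (S q).pBV b v)

theorem LV_ne (c : Fin 3) (hc : c ≠ 2) : LV pQ S c = 0 := by
  unfold LV Usr.bet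
  simp only [hc, if_false]
  refine Finset.sum_eq_zero fun q _ => Finset.sum_eq_zero fun v _ => Finset.sum_eq_zero fun b _ => ?_
  by_cases h : (S q).pBV b v = 0
  · simp [h]
  · simp [div_self h]

include hQ in
theorem cmi_bv : cmi (P4 pQ S) (fun θ => θ.2.1) (fun θ => θ.2.2.2) (fun θ => θ.1) =
    -LV pQ S 2 := by
  unfold LV
  rw [← P4_bv pQ S fun q b v => Real.logb 2 ((S q).bet 2 b v / (S q).pBV b v)]
  rw [cmi_val _ (P4_nonneg pQ hQ S) _ _ _ (fun θ => (S θ.1).pBV θ.2.1 θ.2.2.2)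
    (fun θ => (S θ.1).bet 2 θ.2.1 θ.2.2.2)]
  · rw [← Finset.sum_neg_distrib]
    refine Finset.sum_congr rfl fun θ _ => ?_
    rw [← inv_div, Real.logb_inv, mul_neg]
  · rintro ⟨q, b, u, v⟩ h
    exact (P4_pos pQ hQ S q b u v h).2.2.2.2.2.1
  · rintro ⟨q, b, u, v⟩ -
    simp only [Usr.bet, if_true]
    rw [s_bvq, s_q, s_bq, s_vq]
    ring

include hQ in
theorem cmi_buv : cmi (P4 pQ S) (fun θ => θ.2.1) (fun θ => θ.2.2.1) (fun θ => (θ.2.2.2, θ.1)) =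
    LC pQ S + LV pQ S 2 := by
  unfold LC LV
  rw [← P4_bu pQ S fun q b u => Real.logb 2 ((S q).ku b u / (S q).pU u),
    ← P4_bv pQ S fun q b v => Real.logb 2 ((S q).bet 2 b v / (S q).pBV b v),
    ← Finset.sum_add_distrib,
    cmi_val _ (P4_nonneg pQ hQ S) _ _ _
    (fun θ => (S θ.1).ku θ.2.1 θ.2.2.1 * ((S θ.1).pB θ.2.1 * (S θ.1).pV θ.2.2.2))
    (fun θ => (S θ.1).pU θ.2.2.1 * (S θ.1).pBV θ.2.1 θ.2.2.2)]
  · refine Finset.sum_congr rfl ?_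
    rintro ⟨q, b, u, v⟩ -
    rcases (P4_nonneg pQ hQ S (q, b, u, v)).eq_or_lt with h | h
    · rw [← h]; simp
    obtain ⟨h1, h2, h3, h4, h5, h6, h7⟩ := P4_pos pQ hQ S q b u v h
    simp only [Usr.bet, if_true]
    rw [mul_div_mul_comm, Real.logb_mul (by positivity) (by positivity)]
    ring
  · rintro ⟨q, b, u, v⟩ h
    obtain ⟨h1, h2, h3, h4, h5, h6, h7⟩ := P4_pos pQ hQ S q b u v h
    simp only
    positivity
  · rintro ⟨q, b, u, v⟩ -
    simp only
    rw [s_all, s_vq, s_bvq, s_uvq]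
    ring

include hQ in
theorem ent_ku (μ : U → ℝ) (hU : ∀ q u, (S q).pU u = μ u) :
    ∑ q, ∑ u, ∑ b, pQ q * ((S q).pB b * (S q).ku b u) * Real.logb 2 ((S q).ku b u) =
    LC pQ S - ent (P4 pQ S) (fun θ => θ.2.2.1) := by
  have : ∑ q, ∑ u, ∑ b, pQ q * ((S q).pB b * (S q).ku b u) * Real.logb 2 ((S q).ku b u) =
      ∑ q, ∑ b, ∑ u, pQ q * ((S q).pB b * (S q).ku b u) * Real.logb 2 ((S q).ku b u) :=
    Finset.sum_congr rfl fun q _ => Finset.sum_comm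
  unfold LC
  rw [this, ent_eq, ← P4_bu pQ S fun q b u => Real.logb 2 ((S q).ku b u),
    ← P4_bu pQ S fun q b u => Real.logb 2 ((S q).ku b u / (S q).pU u), sub_neg_eq_add,
    ← Finset.sum_add_distrib]
  refine Finset.sum_congr rfl ?_
  rintro ⟨q, b, u, v⟩ -
  rcases (P4_nonneg pQ hQ S (q, b, u, v)).eq_or_lt with h | h
  · rw [← h]; simp
  obtain ⟨h1, h2, h3, h4, h5, h6, h7⟩ := P4_pos pQ hQ S q b u v h
  simp only
  rw [s_u pQ S μ hQ hU, ← hU q, Real.logb_div h3.ne' h5.ne']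
  ring

end SrcLaw

theorem LL_form {U V B T X U' V' B' T' X' Y Q : Type} [Fintype U] [Fintype V] [Fintype B] [Fintype T]
    [Fintype X] [Fintype U'] [Fintype V'] [Fintype B'] [Fintype T'] [Fintype X'] [Fintype Y]
    [Fintype Q] (pQ : Q → ℝ) (hQ : IsPMF pQ) (S : Q → Usr U V B T X) (S' : Q → Usr U' V' B' T' X')
    (W : X → X' → Y → ℝ) (hW : ∀ x x', IsPMF (W x x')) (μ : U → ℝ) (hU : ∀ q u, (S q).pU u = μ u)
    (c : Fin 2) (c' : Fin 3) :
    LL pQ S S' W c c' = LV pQ S' c' - GA pQ S S' W c c' - LC pQ S +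
      ent (P4 pQ S) (fun θ => θ.2.2.1) := by
  rw [LL_split pQ S S' W hW, ent_ku pQ hQ S μ hU]
  unfold LV GA
  ring

set_option linter.unusedSectionVars false

theorem disint {α β : Type} [Fintype α] [Fintype β] [Nonempty β] (J : α → β → ℝ)
    (hJ : ∀ a b, 0 ≤ J a b) :
    ∃ k : α → β → ℝ, (∀ a, IsPMF (k a)) ∧ ∀ a b, (∑ b', J a b') * k a b = J a b := by
  obtain ⟨b0⟩ := ‹Nonempty β›
  refine ⟨fun a b => if ∑ b', J a b' = 0 then (if b = b0 then 1 else 0)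
    else J a b / ∑ b', J a b', fun a => ?_, fun a b => ?_⟩
  · by_cases h : ∑ b', J a b' = 0
    · simp only [h, if_true]
      exact ⟨fun b => by dsimp only; split_ifs <;> norm_num, by simp⟩
    · simp only [h, if_false]
      refine ⟨fun b => div_nonneg (hJ a b) (Finset.sum_nonneg fun b _ => hJ a b), ?_⟩
      rw [← Finset.sum_div, div_self h]
  · dsimp only
    split_ifs with h h'
    · rw [h, zero_mul]
      exact ((Finset.sum_eq_zero_iff_of_nonneg fun b _ => hJ a b).1 h b (Finset.mem_univ b)).symm
    · rw [h, zero_mul]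
      exact ((Finset.sum_eq_zero_iff_of_nonneg fun b _ => hJ a b).1 h b (Finset.mem_univ b)).symm
    · field_simp

theorem mk_usr {U V B T X : Type} [Fintype U] [Fintype V] [Fintype B] [Fintype T] [Fintype X]
    (qq : U × V → ℝ) (hq : IsPMF qq) (kb : U → B → ℝ) (hkb : ∀ u, IsPMF (kb u))
    (kt : T × X → ℝ) (hkt : IsPMF kt) :
    ∃ S : Usr U V B T X, (∀ u, S.pU u = ∑ v, qq (u, v)) ∧
      (∀ u v, S.pU u * S.kv u v = qq (u, v)) ∧
      (∀ b u v, S.pB b * S.ku b u * S.kv u v = qq (u, v) * kb u b) ∧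
      (∀ t x, S.pT t * S.kx t x = kt (t, x)) := by
  have hne : Nonempty (U × V) := by
    by_contra h
    rw [not_nonempty_iff] at h
    have := hq.2
    simp at this
  have hne2 : Nonempty (T × X) := by
    by_contra h
    rw [not_nonempty_iff] at h
    have := hkt.2
    simp at this
  obtain ⟨⟨u0, v0⟩⟩ := hne
  obtain ⟨⟨t0, x0⟩⟩ := hne2
  have : Nonempty U := ⟨u0⟩
  have : Nonempty V := ⟨v0⟩
  have : Nonempty X := ⟨x0⟩
  set μ : U → ℝ := fun u => ∑ v, qq (u, v) with hμ
  have hμ0 : ∀ u, 0 ≤ μ u := fun u => Finset.sum_nonneg fun v _ => hq.1 _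
  have hμ1 : ∑ u, μ u = 1 := by rw [← hq.2, Fintype.sum_prod_type]
  obtain ⟨ku, hu, hu'⟩ := disint (fun b u => μ u * kb u b) fun b u => mul_nonneg (hμ0 u) ((hkb u).1 b)
  obtain ⟨kv, hv, hv'⟩ := disint (fun u v => qq (u, v)) fun u v => hq.1 _
  obtain ⟨kx, hx, hx'⟩ := disint (fun t x => kt (t, x)) fun u v => hkt.1 _
  let S : Usr U V B T X :=
    { pB := fun b => ∑ u, μ u * kb u b
      ku := ku
      kv := kv
      pT := fun t => ∑ x, kt (t, x)
      kx := kx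
      hB := ⟨fun b => Finset.sum_nonneg fun u _ => mul_nonneg (hμ0 u) ((hkb u).1 b), by
        rw [Finset.sum_comm]
        simp only [← Finset.mul_sum, (hkb _).2, mul_one, hμ1]⟩
      hu := hu
      hv := hv
      hT := ⟨fun t => Finset.sum_nonneg fun x _ => hkt.1 _, by
        rw [← hkt.2, Fintype.sum_prod_type]⟩
      hx := hx }
  have hpU : ∀ u, S.pU u = μ u := by
    intro u
    change ∑ b, (∑ u, μ u * kb u b) * ku b u = μ u
    simp only [hu', ← Finset.mul_sum, (hkb u).2, mul_one]
  refine ⟨S, hpU, fun u v => ?_, fun b u v => ?_, hx'⟩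
  · rw [hpU]; exact hv' u v
  · change (∑ u, μ u * kb u b) * ku b u * kv u v = _
    rw [hu']
    have : μ u * kv u v = qq (u, v) := hv' u v
    rw [← this]; ring

theorem pmf2 {α β : Type} [Fintype α] [Fintype β] {p : α × β → ℝ} (h : IsPMF p) :
    ∑ a, ∑ b, p (a, b) = 1 := by rw [← h.2, Fintype.sum_prod_type]

theorem Wm_fst {X X' Y Y' : Type} [Fintype Y] [Fintype Y'] (f : X → X' → Y × Y' → ℝ) (x : X) (x' : X')
    (y : Y) : Wm Prod.fst f x x' y = ∑ y', f x x' (y, y') := by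
  unfold Wm
  rw [Fintype.sum_prod_type, Finset.sum_eq_single y]
  · simp
  · intro b _ hb; simp [hb]
  · simp

theorem Wm_snd {X X' Y Y' : Type} [Fintype Y] [Fintype Y'] (f : X → X' → Y × Y' → ℝ) (x : X) (x' : X')
    (y' : Y') : Wm Prod.snd f x x' y' = ∑ y, f x x' (y, y') := by
  unfold Wm
  rw [Fintype.sum_prod_type_right, Finset.sum_eq_single y']
  · simp
  · intro b _ hb; simp [hb]
  · simp

theorem marg8 {A1 C1 A2 C2 B1 B2 D O : Type} [Fintype A1] [Fintype C1] [Fintype A2] [Fintype C2]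
    [Fintype B1] [Fintype B2] [Fintype D] [Fintype O] (q1 : A1 × C1 → ℝ) (q2 : A2 × C2 → ℝ)
    (hq1 : IsPMF q1) (hq2 : IsPMF q2) (k1 : A1 → B1 → ℝ) (k2 : A2 → B2 → ℝ)
    (hk1 : ∀ u, IsPMF (k1 u)) (hk2 : ∀ u, IsPMF (k2 u)) (a : ℝ) (F : D → O → ℝ) :
    ∑ u1, ∑ v1, ∑ b1, ∑ u2, ∑ v2, ∑ b2, ∑ x, ∑ y,
      a * q1 (u1, v1) * k1 u1 b1 * q2 (u2, v2) * k2 u2 b2 * F x y = a * ∑ x, ∑ y, F x y := by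
  simp only [← Finset.sum_mul, ← Finset.mul_sum, (hk2 _).2, (hk1 _).2, mul_one, pmf2 hq2,
    pmf2 hq1]

theorem marg8' {A1 C1 A2 C2 B1 B2 D O : Type} [Fintype A1] [Fintype C1] [Fintype A2] [Fintype C2]
    [Fintype B1] [Fintype B2] [Fintype D] [Fintype O] (q1 : A1 × C1 → ℝ) (q2 : A2 × C2 → ℝ)
    (hq1 : IsPMF q1) (hq2 : IsPMF q2) (k1 : A1 → B1 → ℝ) (k2 : A2 → B2 → ℝ)
    (hk1 : ∀ u, IsPMF (k1 u)) (hk2 : ∀ u, IsPMF (k2 u)) (a : ℝ) (F : D → O → ℝ) :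
    ∑ b : A1 × C1 × B1 × A2 × C2 × B2 × D × O,
      a * q1 (b.1, b.2.1) * k1 b.1 b.2.2.1 * q2 (b.2.2.2.1, b.2.2.2.2.1) *
      k2 b.2.2.2.1 b.2.2.2.2.2.1 * F b.2.2.2.2.2.2.1 b.2.2.2.2.2.2.2 = a * ∑ x, ∑ y, F x y := by
  rw [← marg8 q1 q2 hq1 hq2 k1 k2 hk1 hk2 a F]
  simp only [Fintype.sum_prod_type]

section Transfer
variable {A1 C1 A2 C2 D1 D2 O1 O2 : Type}
  [Fintype A1] [Fintype C1] [Fintype A2] [Fintype C2]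
  [Fintype D1] [Fintype D2] [Fintype O1] [Fintype O2] {mQ mB1 mB2 mT1 mT2 : ℕ}
  (ch : D1 × D2 → O1 × O2 → ℝ) (q1 : A1 × C1 → ℝ) (q2 : A2 × C2 → ℝ)
  (hch : IsKernel ch) (hq1 : IsPMF q1) (hq2 : IsPMF q2)
  (pQ : Fin mQ → ℝ) (kb1 : A1 → Fin mQ → Fin mB1 → ℝ) (kb2 : A2 → Fin mQ → Fin mB2 → ℝ)
  (kt1 : Fin mQ → Fin mT1 × D1 → ℝ) (kt2 : Fin mQ → Fin mT2 × D2 → ℝ)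
  (hkb1 : ∀ u q, IsPMF (kb1 u q)) (hkb2 : ∀ u q, IsPMF (kb2 u q))
  (hkt1 : ∀ q, IsPMF (kt1 q)) (hkt2 : ∀ q, IsPMF (kt2 q))
  (S1 : Fin mQ → Usr A1 C1 (Fin mB1) (Fin mT1) D1) (S2 : Fin mQ → Usr A2 C2 (Fin mB2) (Fin mT2) D2)
  (h1 : ∀ q b u v, (S1 q).pB b * (S1 q).ku b u * (S1 q).kv u v = q1 (u, v) * kb1 u q b)
  (h2 : ∀ q b u v, (S2 q).pB b * (S2 q).ku b u * (S2 q).kv u v = q2 (u, v) * kb2 u q b)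
  (g1 : ∀ q t x, (S1 q).pT t * (S1 q).kx t x = kt1 q (t, x))
  (g2 : ∀ q t x, (S2 q).pT t * (S2 q).kx t x = kt2 q (t, x))

include hch hq2 hkb2 hkt1 hkt2 h1 in
theorem law_R1 : pr (jointSep ch q1 q2 pQ kb1 kb2 kt1 kt2)
    (fun ω => (sQ ω, sB1 ω, sU1 ω, sV1 ω)) = P4 pQ S1 := by
  funext ⟨q, b, u, v⟩
  rw [pr_marg _ _ (⟨fun a => (a.1.1, a.1.2.2.1, a.1.2.2.2, a.1.2.1, a.2),
    fun θ => ((θ.1, θ.2.2.2.1, θ.2.1, θ.2.2.1), θ.2.2.2.2), fun _ => rfl, fun _ => rfl⟩ :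
    (Fin mQ × Fin mB1 × A1 × C1) × (A2 × C2 × Fin mB2 × Fin mT1 × D1 × Fin mT2 × D2 × O1 × O2) ≃
      OmSep mQ mB1 mB2 mT1 mT2 A1 C1 A2 C2 D1 D2 O1 O2) (fun _ _ => rfl)]
  simp only [jointSep, Equiv.coe_fn_mk, Fintype.sum_prod_type, mul_assoc, ← Finset.mul_sum,
    ← Finset.sum_mul, pmf2 (hch _), pmf2 (hkt1 _), pmf2 (hkt2 _), (hkb2 _ _).2, pmf2 hq2, mul_one,
    one_mul, P4]
  rw [← mul_assoc ((S1 q).pB b), h1]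

include hch hq1 hkb1 hkt1 hkt2 h2 in
theorem law_R2 : pr (jointSep ch q1 q2 pQ kb1 kb2 kt1 kt2)
    (fun ω => (sQ ω, sB2 ω, sU2 ω, sV2 ω)) = P4 pQ S2 := by
  funext ⟨q, b, u, v⟩
  rw [pr_marg _ _ (⟨fun a => (a.1.1, a.2.1, a.2.2.1, a.2.2.2.1, a.1.2.2.1, a.1.2.2.2, a.1.2.1,
      a.2.2.2.2),
    fun θ => ((θ.1, θ.2.2.2.2.2.2.1, θ.2.2.2.2.1, θ.2.2.2.2.2.1),
      (θ.2.1, θ.2.2.1, θ.2.2.2.1, θ.2.2.2.2.2.2.2)), fun _ => rfl, fun _ => rfl⟩ :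
    (Fin mQ × Fin mB2 × A2 × C2) × (A1 × C1 × Fin mB1 × Fin mT1 × D1 × Fin mT2 × D2 × O1 × O2) ≃
      OmSep mQ mB1 mB2 mT1 mT2 A1 C1 A2 C2 D1 D2 O1 O2) (fun _ _ => rfl)]
  simp only [jointSep, Equiv.coe_fn_mk, Fintype.sum_prod_type, mul_assoc, ← Finset.mul_sum,
    ← Finset.sum_mul, pmf2 (hch _), pmf2 (hkt1 _), pmf2 (hkt2 _), (hkb1 _ _).2, pmf2 hq1, mul_one,
    one_mul, P4]
  rw [← mul_assoc ((S2 q).pB b), h2]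

include hq1 hq2 hkb1 hkb2 g1 g2 in
theorem law_C1 : pr (jointSep ch q1 q2 pQ kb1 kb2 kt1 kt2)
    (fun ω => (sQ ω, sY1 ω, sT1 ω, sX1 ω, sT2 ω)) =
    P5 pQ S1 S2 (Wm Prod.fst (fun x x' => ch (x, x'))) := by
  funext ⟨q, y, t, x, t'⟩
  rw [pr_marg _ _ (⟨fun a => (a.1.1, a.2.1, a.2.2.1, a.2.2.2.1, a.2.2.2.2.1, a.2.2.2.2.2.1,
      a.2.2.2.2.2.2.1, a.1.2.2.1, a.1.2.2.2.1, a.1.2.2.2.2, a.2.2.2.2.2.2.2.1, a.1.2.1,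
      a.2.2.2.2.2.2.2.2),
    fun θ => ((sQ θ, sY1 θ, sT1 θ, sX1 θ, sT2 θ),
      (sU1 θ, sV1 θ, sB1 θ, sU2 θ, sV2 θ, sB2 θ, sX2 θ, sY2 θ)), fun _ => rfl, fun _ => rfl⟩ :
    (Fin mQ × O1 × Fin mT1 × D1 × Fin mT2) ×
      (A1 × C1 × Fin mB1 × A2 × C2 × Fin mB2 × D2 × O2) ≃
      OmSep mQ mB1 mB2 mT1 mT2 A1 C1 A2 C2 D1 D2 O1 O2) (fun _ _ => rfl)]
  have key := marg8' q1 q2 hq1 hq2 (fun u => kb1 u q) (fun u => kb2 u q) (fun u => hkb1 u q)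
    (fun u => hkb2 u q) (pQ q) (fun x2 y2 => kt1 q (t, x) * kt2 q (t', x2) * ch (x, x2) (y, y2))
  refine (Finset.sum_congr rfl fun b _ => ?_).trans (key.trans ?_)
  · change pQ q * q1 (b.1, b.2.1) * kb1 b.1 q b.2.2.1 * q2 (b.2.2.2.1, b.2.2.2.2.1) *
      kb2 b.2.2.2.1 q b.2.2.2.2.2.1 * kt1 q (t, x) * kt2 q (t', b.2.2.2.2.2.2.1) *
      ch (x, b.2.2.2.2.2.2.1) (y, b.2.2.2.2.2.2.2) = _
    simp only [← mul_assoc]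
  simp only [P5, Wy, Wm_fst, ← g1, ← g2, Finset.mul_sum]
  refine Finset.sum_congr rfl fun _ _ => Finset.sum_congr rfl fun _ _ => ?_
  ring

include hq1 hq2 hkb1 hkb2 g1 g2 in
theorem law_C2 : pr (jointSep ch q1 q2 pQ kb1 kb2 kt1 kt2)
    (fun ω => (sQ ω, sY2 ω, sT2 ω, sX2 ω, sT1 ω)) =
    P5 pQ S2 S1 (Wm Prod.snd (fun x' x => ch (x, x'))) := by
  funext ⟨q, y, t, x, t'⟩
  rw [pr_marg _ _ (⟨fun a => (a.1.1, a.2.1, a.2.2.1, a.2.2.2.1, a.2.2.2.2.1, a.2.2.2.2.2.1,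
      a.2.2.2.2.2.2.1, a.1.2.2.2.2, a.2.2.2.2.2.2.2.1, a.1.2.2.1, a.1.2.2.2.1,
      a.2.2.2.2.2.2.2.2, a.1.2.1),
    fun θ => ((sQ θ, sY2 θ, sT2 θ, sX2 θ, sT1 θ),
      (sU1 θ, sV1 θ, sB1 θ, sU2 θ, sV2 θ, sB2 θ, sX1 θ, sY1 θ)), fun _ => rfl, fun _ => rfl⟩ :
    (Fin mQ × O2 × Fin mT2 × D2 × Fin mT1) ×
      (A1 × C1 × Fin mB1 × A2 × C2 × Fin mB2 × D1 × O1) ≃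
      OmSep mQ mB1 mB2 mT1 mT2 A1 C1 A2 C2 D1 D2 O1 O2) (fun _ _ => rfl)]
  have key := marg8' q1 q2 hq1 hq2 (fun u => kb1 u q) (fun u => kb2 u q) (fun u => hkb1 u q)
    (fun u => hkb2 u q) (pQ q) (fun x1 y1 => kt1 q (t', x1) * kt2 q (t, x) * ch (x1, x) (y1, y))
  refine (Finset.sum_congr rfl fun b _ => ?_).trans (key.trans ?_)
  · change pQ q * q1 (b.1, b.2.1) * kb1 b.1 q b.2.2.1 * q2 (b.2.2.2.1, b.2.2.2.2.1) *
      kb2 b.2.2.2.1 q b.2.2.2.2.2.1 * kt1 q (t', b.2.2.2.2.2.2.1) * kt2 q (t, x) *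
      ch (b.2.2.2.2.2.2.1, x) (b.2.2.2.2.2.2.2, y) = _
    simp only [← mul_assoc]
  simp only [P5, Wy, Wm_snd, ← g1, ← g2, Finset.mul_sum]
  refine Finset.sum_congr rfl fun _ _ => Finset.sum_congr rfl fun _ _ => ?_
  ring

end Transfer

theorem between2 (a b c d : ℝ) (h1 : a < c) (h2 : a < d) (h3 : b < c) (h4 : b < d) :
    ∃ x, a < x ∧ b < x ∧ x < c ∧ x < d := by
  obtain ⟨x, hx1, hx2⟩ := exists_between (max_lt (lt_min h1 h2) (lt_min h3 h4))
  exact ⟨x, (le_max_left _ _).trans_lt hx1, (le_max_right _ _).trans_lt hx1,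
    hx2.trans_le (min_le_left _ _), hx2.trans_le (min_le_right _ _)⟩

/-- Choice of the rate excesses. -/
theorem fm_elim (H1 H2 I1 I2 J1 J2 a1 d1 e1 g1 a2 d2 e2 g2 : ℝ)
    (hT1 : 0 ≤ I1 - J1) (hT2 : 0 ≤ I2 - J2)
    (h1 : H1 < d1) (h2 : H1 + (I2 - J2) < g1) (h3 : H2 < d2) (h4 : H2 + (I1 - J1) < g2)
    (h5 : H1 + H2 - J1 < a1 + g2) (h6 : H1 + H2 - J2 < a2 + g1)
    (h7 : H1 + H2 - J1 - J2 < e2 + e1)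
    (h8 : H1 + H2 + (I1 - J1) - J2 < g1 + e2)
    (h9 : H1 + H2 + (I2 - J2) - J1 < g2 + e1)
    (h10 : 2 * H1 + H2 - J1 - J2 < g1 + a1 + e2)
    (h11 : H1 + 2 * H2 - J1 - J2 < g2 + a2 + e1) :
    ∃ Δ1 Δ2 ε : ℝ, 0 ≤ Δ1 ∧ 0 ≤ Δ2 ∧ 0 < ε ∧
      (H1 - I1 - Δ1 - a1 + 3 * ε < 0 ∧ H1 - I1 - Δ1 + Δ2 - e1 + 3 * ε < 0 ∧
       H1 - I1 - Δ1 + (I2 - J2) + Δ2 - e1 + 3 * ε < 0 ∧ H1 - d1 + 3 * ε < 0 ∧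
       H1 + Δ2 - g1 + 3 * ε < 0 ∧ H1 + (I2 - J2) + Δ2 - g1 + 3 * ε < 0) ∧
      (H2 - I2 - Δ2 - a2 + 3 * ε < 0 ∧ H2 - I2 - Δ2 + Δ1 - e2 + 3 * ε < 0 ∧
       H2 - I2 - Δ2 + (I1 - J1) + Δ1 - e2 + 3 * ε < 0 ∧ H2 - d2 + 3 * ε < 0 ∧
       H2 + Δ1 - g2 + 3 * ε < 0 ∧ H2 + (I1 - J1) + Δ1 - g2 + 3 * ε < 0) := by
  obtain ⟨l1, hl1, hl1a, hl1b⟩ : ∃ l, 0 ≤ l ∧ H1 - I1 - a1 ≤ l ∧ (l = 0 ∨ l = H1 - I1 - a1) :=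
    ⟨max 0 (H1 - I1 - a1), le_max_left _ _, le_max_right _ _, max_choice _ _⟩
  obtain ⟨l2, hl2, hl2a, hl2b⟩ : ∃ l, 0 ≤ l ∧ H2 - I2 - a2 ≤ l ∧ (l = 0 ∨ l = H2 - I2 - a2) :=
    ⟨max 0 (H2 - I2 - a2), le_max_left _ _, le_max_right _ _, max_choice _ _⟩
  have k1 : l1 < g2 - H2 - (I1 - J1) := by rcases hl1b with h | h <;> linarith
  have k2 : l2 < g1 - H1 - (I2 - J2) := by rcases hl2b with h | h <;> linarith
  obtain ⟨d, hd1, hd2, hd3, hd4⟩ := between2 (H1 - I1 + (I2 - J2) - e1)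
    (l1 - (g1 - H1 - (I2 - J2))) (e2 - (H2 - I2) - (I1 - J1)) (g2 - H2 - (I1 - J1) - l2)
    (by linarith) (by rcases hl2b with h | h <;> linarith)
    (by rcases hl1b with h | h <;> linarith) (by linarith)
  obtain ⟨Δ2, hD1, hD2, hD3, hD4⟩ := between2 l2 (l1 - d) (g1 - H1 - (I2 - J2))
    (g2 - H2 - (I1 - J1) - d) k2 (by linarith) (by linarith) (by linarith)
  have key : ∀ x : ℝ, x < 0 → ∃ ε > 0, ∀ ε' ≤ ε, x + 3 * ε' < 0 := fun x hx =>
    ⟨-x / 4, by linarith, fun ε' h => by linarith⟩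
  obtain ⟨s1, p1, r1⟩ := key (H1 - I1 - (Δ2 + d) - a1) (by linarith)
  obtain ⟨s2, p2, r2⟩ := key (H1 - I1 - (Δ2 + d) + (I2 - J2) + Δ2 - e1) (by linarith)
  obtain ⟨s3, p3, r3⟩ := key (H1 - d1) (by linarith)
  obtain ⟨s4, p4, r4⟩ := key (H1 + (I2 - J2) + Δ2 - g1) (by linarith)
  obtain ⟨s5, p5, r5⟩ := key (H2 - I2 - Δ2 - a2) (by linarith)
  obtain ⟨s6, p6, r6⟩ := key (H2 - I2 - Δ2 + (I1 - J1) + (Δ2 + d) - e2) (by linarith)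
  obtain ⟨s7, p7, r7⟩ := key (H2 - d2) (by linarith)
  obtain ⟨s8, p8, r8⟩ := key (H2 + (I1 - J1) + (Δ2 + d) - g2) (by linarith)
  obtain ⟨ε, h0, hε⟩ := exists_between (lt_min (lt_min (lt_min p1 p2) (lt_min p3 p4))
    (lt_min (lt_min p5 p6) (lt_min p7 p8)))
  simp only [lt_min_iff] at hε
  obtain ⟨⟨⟨q1, q2⟩, q3, q4⟩, ⟨q5, q6⟩, q7, q8⟩ := hε
  have r1 := r1 _ q1.le
  have r2 := r2 _ q2.le
  have r3 := r3 _ q3.le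
  have r4 := r4 _ q4.le
  have r5 := r5 _ q5.le
  have r6 := r6 _ q6.le
  have r7 := r7 _ q7.le
  have r8 := r8 _ q8.le
  refine ⟨Δ2 + d, Δ2, ε, by linarith, by linarith, h0, ⟨?_, ?_, ?_, ?_, ?_, ?_⟩,
    ⟨?_, ?_, ?_, ?_, ?_, ?_⟩⟩ <;> linarith

section Assembly
variable {U V B T X U' V' B' T' X' Y Q : Type} [Fintype U] [Fintype V] [Fintype B] [Fintype T]
    [Fintype X] [Fintype U'] [Fintype V'] [Fintype B'] [Fintype T'] [Fintype X'] [Fintype Y]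
    [Fintype Q]

theorem LL_cases (pQ : Q → ℝ) (hQ : IsPMF pQ) (S : Q → Usr U V B T X) (S' : Q → Usr U' V' B' T' X')
    (W : X → X' → Y → ℝ) (hW : ∀ x x', IsPMF (W x x')) (μ : U → ℝ) (hU : ∀ q u, (S q).pU u = μ u)
    (H I J' I' Δ Δ' ε a d e g : ℝ) (hε : 0 < ε)
    (hH : ent (P4 pQ S) (fun θ => θ.2.2.1) = H) (hI : LC pQ S = I)
    (hJ' : -LV pQ S' 2 = J') (ha : GA pQ S S' W 0 0 = a) (hd : GA pQ S S' W 1 0 = d)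
    (he : ∀ c', c' ≠ 0 → GA pQ S S' W 0 c' = e) (hg : ∀ c', c' ≠ 0 → GA pQ S S' W 1 c' = g)
    (h : H - I - Δ - a + 3 * ε < 0 ∧ H - I - Δ + Δ' - e + 3 * ε < 0 ∧
       H - I - Δ + (I' - J') + Δ' - e + 3 * ε < 0 ∧ H - d + 3 * ε < 0 ∧
       H + Δ' - g + 3 * ε < 0 ∧ H + (I' - J') + Δ' - g + 3 * ε < 0) (c : Fin 2) (c' : Fin 3) :
    LL pQ S S' W c c' + (ex1 (I + ε) Δ c + ex2 (I' + ε) Δ' c' + ε) < 0 := by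
  rw [LL_form pQ hQ S S' W hW μ hU, hH, hI]
  have h0 := LV_ne pQ S' 0 (by decide)
  have h1 := LV_ne pQ S' 1 (by decide)
  have e1 := he 1 (by decide)
  have e2 := he 2 (by decide)
  have g1 := hg 1 (by decide)
  have g2 := hg 2 (by decide)
  obtain ⟨r1, r2, r3, r4, r5, r6⟩ := h
  fin_cases c <;> fin_cases c' <;>
    simp only [Fin.zero_eta, Fin.mk_one, Fin.reduceFinMk, ex1, ex2, h0, h1, e1, e2, g1, g2, ha, hd,
      if_true, if_false, one_ne_zero, Fin.reduceEq, Fin.isValue] <;> linarith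

end Assembly

theorem stmt2 (ch : X1 × X2 → Y1 × Y2 → ℝ) (q1 : U1 × V1 → ℝ) (q2 : U2 × V2 → ℝ)
    (hch : IsKernel ch) (hq1 : IsPMF q1) (hq2 : IsPMF q2)
    (h : ∃ (mQ mB1 mB2 mT1 mT2 : ℕ) (pQ : Fin mQ → ℝ)
        (kb1 : U1 → Fin mQ → Fin mB1 → ℝ) (kb2 : U2 → Fin mQ → Fin mB2 → ℝ)
        (kt1 : Fin mQ → Fin mT1 × X1 → ℝ) (kt2 : Fin mQ → Fin mT2 × X2 → ℝ),
        IsPMF pQ ∧ (∀ u q, IsPMF (kb1 u q)) ∧ (∀ u q, IsPMF (kb2 u q)) ∧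
        (∀ q, IsPMF (kt1 q)) ∧ (∀ q, IsPMF (kt2 q)) ∧
        (let p := jointSep ch q1 q2 pQ kb1 kb2 kt1 kt2
         ent p sU1 < cmi p sX1 sY1 (fun ω => (sT2 ω, sQ ω)) ∧
         ent p sU1 + cmi p sB2 sU2 (fun ω => (sV2 ω, sQ ω)) <
           cmi p (fun ω => (sX1 ω, sT2 ω)) sY1 sQ ∧
         ent p sU2 < cmi p sX2 sY2 (fun ω => (sT1 ω, sQ ω)) ∧
         ent p sU2 + cmi p sB1 sU1 (fun ω => (sV1 ω, sQ ω)) <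
           cmi p (fun ω => (sX2 ω, sT1 ω)) sY2 sQ ∧
         ent p sU1 + ent p sU2 - cmi p sB1 sV1 sQ <
           cmi p sX1 sY1 (fun ω => (sT1 ω, sT2 ω, sQ ω)) +
           cmi p (fun ω => (sT1 ω, sX2 ω)) sY2 sQ ∧
         ent p sU1 + ent p sU2 - cmi p sB2 sV2 sQ <
           cmi p sX2 sY2 (fun ω => (sT1 ω, sT2 ω, sQ ω)) +
           cmi p (fun ω => (sT2 ω, sX1 ω)) sY1 sQ ∧
         ent p sU1 + ent p sU2 - cmi p sB1 sV1 sQ - cmi p sB2 sV2 sQ <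
           cmi p (fun ω => (sT1 ω, sX2 ω)) sY2 (fun ω => (sT2 ω, sQ ω)) +
           cmi p (fun ω => (sT2 ω, sX1 ω)) sY1 (fun ω => (sT1 ω, sQ ω)) ∧
         ent p sU1 + ent p sU2 + cmi p sB1 sU1 (fun ω => (sV1 ω, sQ ω)) - cmi p sB2 sV2 sQ <
           cmi p (fun ω => (sT2 ω, sX1 ω)) sY1 sQ +
           cmi p (fun ω => (sT1 ω, sX2 ω)) sY2 (fun ω => (sT2 ω, sQ ω)) ∧
         ent p sU1 + ent p sU2 + cmi p sB2 sU2 (fun ω => (sV2 ω, sQ ω)) - cmi p sB1 sV1 sQ <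
           cmi p (fun ω => (sT1 ω, sX2 ω)) sY2 sQ +
           cmi p (fun ω => (sT2 ω, sX1 ω)) sY1 (fun ω => (sT1 ω, sQ ω)) ∧
         2 * ent p sU1 + ent p sU2 - cmi p sB1 sV1 sQ - cmi p sB2 sV2 sQ <
           cmi p (fun ω => (sT2 ω, sX1 ω)) sY1 sQ +
           cmi p sX1 sY1 (fun ω => (sT1 ω, sT2 ω, sQ ω)) +
           cmi p (fun ω => (sT1 ω, sX2 ω)) sY2 (fun ω => (sT2 ω, sQ ω)) ∧
         ent p sU1 + 2 * ent p sU2 - cmi p sB1 sV1 sQ - cmi p sB2 sV2 sQ <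
           cmi p (fun ω => (sT1 ω, sX2 ω)) sY2 sQ +
           cmi p sX2 sY2 (fun ω => (sT2 ω, sT1 ω, sQ ω)) +
           cmi p (fun ω => (sT2 ω, sX1 ω)) sY1 (fun ω => (sT1 ω, sQ ω)))) :
    ReliableCross ch q1 q2 := by
  obtain ⟨mQ, mB1, mB2, mT1, mT2, pQ, kb1, kb2, kt1, kt2, hQ, hkb1, hkb2, hkt1, hkt2, h⟩ := h
  choose S1 sa1 sb1 sc1 sd1 using fun q => mk_usr q1 hq1 (fun u => kb1 u q) (fun u => hkb1 u q)
    (kt1 q) (hkt1 q)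
  choose S2 sa2 sb2 sc2 sd2 using fun q => mk_usr q2 hq2 (fun u => kb2 u q) (fun u => hkb2 u q)
    (kt2 q) (hkt2 q)
  have R1 := law_R1 ch q1 q2 hch hq2 pQ kb1 kb2 kt1 kt2 hkb2 hkt1 hkt2 S1 sc1
  have R2 := law_R2 ch q1 q2 hch hq1 pQ kb1 kb2 kt1 kt2 hkb1 hkt1 hkt2 S2 sc2
  have C1 := law_C1 ch q1 q2 hq1 hq2 pQ kb1 kb2 kt1 kt2 hkb1 hkb2 S1 S2 sd1 sd2
  have C2 := law_C2 ch q1 q2 hq1 hq2 pQ kb1 kb2 kt1 kt2 hkb1 hkb2 S1 S2 sd1 sd2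
  have W1 : ∀ x x', IsPMF (Wm Prod.fst (fun x x' => ch (x, x')) x x') :=
    Wm_pmf _ _ fun x x' => hch (x, x')
  have W2 : ∀ x x', IsPMF (Wm Prod.snd (fun x' x => ch (x, x')) x x') :=
    Wm_pmf _ _ fun x x' => hch (x', x)
  have ne1 : Nonempty U1 := by
    by_contra hn
    rw [not_nonempty_iff] at hn
    have := hq1.2
    simp at this
  have ne2 : Nonempty U2 := by
    by_contra hn
    rw [not_nonempty_iff] at hn
    have := hq2.2
    simp at this
  dsimp only at h
  have tU1 := ent_tr _ _ _ R1 sU1 (fun θ => θ.2.2.1) (fun _ _ => Iff.rfl)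
  have t1 := cmi_tr _ _ _ R1 (sB1) (sV1) (sQ) (fun θ => θ.2.1) (fun θ => θ.2.2.2) (fun θ => θ.1)
    (fun _ _ => Iff.rfl) (fun _ _ => Iff.rfl) (fun _ _ => Iff.rfl)
  have t2 := cmi_tr _ _ _ R1 (sB1) (sU1) (fun ω => (sV1 ω, sQ ω)) (fun θ => θ.2.1) (fun θ => θ.2.2.1) (fun θ => (θ.2.2.2, θ.1))
    (fun _ _ => Iff.rfl) (fun _ _ => Iff.rfl) (fun _ _ => by simp only [Prod.mk.injEq]; try tauto)
  have t3 := cmi_tr _ _ _ C1 (sX1) (sY1) (fun ω => (sT1 ω, sT2 ω, sQ ω)) (fun θ => θ.2.2.2.1) (fun θ => θ.2.1) (fun θ => (θ.2.2.1, θ.2.2.2.2, θ.1))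
    (fun _ _ => Iff.rfl) (fun _ _ => Iff.rfl) (fun _ _ => by simp only [Prod.mk.injEq]; try tauto)
  have t4 := cmi_tr _ _ _ C1 (sX1) (sY1) (fun ω => (sT2 ω, sT1 ω, sQ ω)) (fun θ => θ.2.2.2.1) (fun θ => θ.2.1) (fun θ => (θ.2.2.1, θ.2.2.2.2, θ.1))
    (fun _ _ => Iff.rfl) (fun _ _ => Iff.rfl) (fun _ _ => by simp only [Prod.mk.injEq]; try tauto)
  have t5 := cmi_tr _ _ _ C1 (sX1) (sY1) (fun ω => (sT2 ω, sQ ω)) (fun θ => θ.2.2.2.1) (fun θ => θ.2.1) (fun θ => (θ.2.2.2.2, θ.1))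
    (fun _ _ => Iff.rfl) (fun _ _ => Iff.rfl) (fun _ _ => by simp only [Prod.mk.injEq]; try tauto)
  have t6 := cmi_tr _ _ _ C1 (fun ω => (sT2 ω, sX1 ω)) (sY1) (fun ω => (sT1 ω, sQ ω)) (fun θ => (θ.2.2.2.1, θ.2.2.2.2)) (fun θ => θ.2.1) (fun θ => (θ.2.2.1, θ.1))
    (fun _ _ => by simp only [Prod.mk.injEq]; try tauto) (fun _ _ => Iff.rfl) (fun _ _ => by simp only [Prod.mk.injEq]; try tauto)
  have t7 := cmi_tr _ _ _ C1 (fun ω => (sT2 ω, sX1 ω)) (sY1) (sQ) (fun θ => (θ.2.2.2.1, θ.2.2.2.2)) (fun θ => θ.2.1) (fun θ => θ.1)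
    (fun _ _ => by simp only [Prod.mk.injEq]; try tauto) (fun _ _ => Iff.rfl) (fun _ _ => Iff.rfl)
  have t8 := cmi_tr _ _ _ C1 (fun ω => (sX1 ω, sT2 ω)) (sY1) (sQ) (fun θ => (θ.2.2.2.1, θ.2.2.2.2)) (fun θ => θ.2.1) (fun θ => θ.1)
    (fun _ _ => by simp only [Prod.mk.injEq]; try tauto) (fun _ _ => Iff.rfl) (fun _ _ => Iff.rfl)
  have tU2 := ent_tr _ _ _ R2 sU2 (fun θ => θ.2.2.1) (fun _ _ => Iff.rfl)
  have t10 := cmi_tr _ _ _ R2 (sB2) (sV2) (sQ) (fun θ => θ.2.1) (fun θ => θ.2.2.2) (fun θ => θ.1)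
    (fun _ _ => Iff.rfl) (fun _ _ => Iff.rfl) (fun _ _ => Iff.rfl)
  have t11 := cmi_tr _ _ _ R2 (sB2) (sU2) (fun ω => (sV2 ω, sQ ω)) (fun θ => θ.2.1) (fun θ => θ.2.2.1) (fun θ => (θ.2.2.2, θ.1))
    (fun _ _ => Iff.rfl) (fun _ _ => Iff.rfl) (fun _ _ => by simp only [Prod.mk.injEq]; try tauto)
  have t12 := cmi_tr _ _ _ C2 (sX2) (sY2) (fun ω => (sT2 ω, sT1 ω, sQ ω)) (fun θ => θ.2.2.2.1) (fun θ => θ.2.1) (fun θ => (θ.2.2.1, θ.2.2.2.2, θ.1))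
    (fun _ _ => Iff.rfl) (fun _ _ => Iff.rfl) (fun _ _ => by simp only [Prod.mk.injEq]; try tauto)
  have t13 := cmi_tr _ _ _ C2 (sX2) (sY2) (fun ω => (sT1 ω, sT2 ω, sQ ω)) (fun θ => θ.2.2.2.1) (fun θ => θ.2.1) (fun θ => (θ.2.2.1, θ.2.2.2.2, θ.1))
    (fun _ _ => Iff.rfl) (fun _ _ => Iff.rfl) (fun _ _ => by simp only [Prod.mk.injEq]; try tauto)
  have t14 := cmi_tr _ _ _ C2 (sX2) (sY2) (fun ω => (sT1 ω, sQ ω)) (fun θ => θ.2.2.2.1) (fun θ => θ.2.1) (fun θ => (θ.2.2.2.2, θ.1))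
    (fun _ _ => Iff.rfl) (fun _ _ => Iff.rfl) (fun _ _ => by simp only [Prod.mk.injEq]; try tauto)
  have t15 := cmi_tr _ _ _ C2 (fun ω => (sT1 ω, sX2 ω)) (sY2) (fun ω => (sT2 ω, sQ ω)) (fun θ => (θ.2.2.2.1, θ.2.2.2.2)) (fun θ => θ.2.1) (fun θ => (θ.2.2.1, θ.1))
    (fun _ _ => by simp only [Prod.mk.injEq]; try tauto) (fun _ _ => Iff.rfl) (fun _ _ => by simp only [Prod.mk.injEq]; try tauto)
  have t16 := cmi_tr _ _ _ C2 (fun ω => (sT1 ω, sX2 ω)) (sY2) (sQ) (fun θ => (θ.2.2.2.1, θ.2.2.2.2)) (fun θ => θ.2.1) (fun θ => θ.1)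
    (fun _ _ => by simp only [Prod.mk.injEq]; try tauto) (fun _ _ => Iff.rfl) (fun _ _ => Iff.rfl)
  have t17 := cmi_tr _ _ _ C2 (fun ω => (sX2 ω, sT1 ω)) (sY2) (sQ) (fun θ => (θ.2.2.2.1, θ.2.2.2.2)) (fun θ => θ.2.1) (fun θ => θ.1)
    (fun _ _ => by simp only [Prod.mk.injEq]; try tauto) (fun _ _ => Iff.rfl) (fun _ _ => Iff.rfl)
  simp only [tU1, t1, t2, t3, t4, t5, t6, t7, t8, tU2, t10, t11, t12, t13, t14, t15, t16, t17] at h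
  simp only [cmi_bv pQ hQ S1,
    cmi_buv pQ hQ S1,
    cmi_a pQ hQ S1 S2 _ W1,
    cmi_d pQ hQ S1 S2 _ W1,
    cmi_e pQ hQ S1 S2 _ W1 1 (by decide),
    cmi_g pQ hQ S1 S2 _ W1 1 (by decide),
    cmi_bv pQ hQ S2,
    cmi_buv pQ hQ S2,
    cmi_a pQ hQ S2 S1 _ W2,
    cmi_d pQ hQ S2 S1 _ W2,
    cmi_e pQ hQ S2 S1 _ W2 1 (by decide),
    cmi_g pQ hQ S2 S1 _ W2 1 (by decide)] at h
  have n1 := cmi_nonneg _ (P4_nonneg pQ hQ S1) (fun θ => θ.2.1) (fun θ => θ.2.2.1)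
    (fun θ => (θ.2.2.2, θ.1))
  have n2 := cmi_nonneg _ (P4_nonneg pQ hQ S2) (fun θ => θ.2.1) (fun θ => θ.2.2.1)
    (fun θ => (θ.2.2.2, θ.1))
  have m1 := cmi_nonneg _ (P4_nonneg pQ hQ S1) (fun θ => θ.2.1) (fun θ => θ.2.2.1) (fun θ => θ.1)
  have m2 := cmi_nonneg _ (P4_nonneg pQ hQ S2) (fun θ => θ.2.1) (fun θ => θ.2.2.1) (fun θ => θ.1)
  rw [cmi_buv pQ hQ] at n1 n2
  rw [cmi_bu pQ hQ] at m1 m2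
  obtain ⟨h1, h2, h3, h4, h5, h6, h7, h8, h9, h10, h11⟩ := h
  obtain ⟨Δ1, Δ2, ε, hΔ1, hΔ2, hε, c1, c2⟩ := fm_elim _ _ (LC pQ S1) (LC pQ S2) (-LV pQ S1 2)
    (-LV pQ S2 2) _ _ _ _ _ _ _ _ (by linarith) (by linarith) h1 (by linarith) h3 (by linarith)
    h5 h6 h7 (by linarith) (by linarith) h10 h11
  have G1 : ∀ c c', c' ≠ 0 → GA pQ S1 S2 (Wm Prod.fst (fun x x' => ch (x, x'))) c c' =
      GA pQ S1 S2 (Wm Prod.fst (fun x x' => ch (x, x'))) c 1 := by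
    intro c c' hc
    fin_cases c
    · exact (cmi_e pQ hQ S1 S2 _ W1 c' hc).symm.trans (cmi_e pQ hQ S1 S2 _ W1 1 (by decide))
    · exact (cmi_g pQ hQ S1 S2 _ W1 c' hc).symm.trans (cmi_g pQ hQ S1 S2 _ W1 1 (by decide))
  have G2 : ∀ c c', c' ≠ 0 → GA pQ S2 S1 (Wm Prod.snd (fun x' x => ch (x, x'))) c c' =
      GA pQ S2 S1 (Wm Prod.snd (fun x' x => ch (x, x'))) c 1 := by
    intro c c' hc
    fin_cases c
    · exact (cmi_e pQ hQ S2 S1 _ W2 c' hc).symm.trans (cmi_e pQ hQ S2 S1 _ W2 1 (by decide))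
    · exact (cmi_g pQ hQ S2 S1 _ W2 c' hc).symm.trans (cmi_g pQ hQ S2 S1 _ W2 1 (by decide))
  refine nletter ch hch q1 q2 hq1.1 hq2.1 pQ hQ S1 S2 sb1 sb2 (LC pQ S1 + ε) Δ1 (LC pQ S2 + ε) Δ2 ε
    (LC pQ S1 + ε / 2) (LC pQ S2 + ε / 2) hε (by linarith) hΔ1 (by linarith) hΔ2 (by linarith)
    (by linarith) (by linarith) (by linarith) ?_ ?_
  · exact LL_cases pQ hQ S1 S2 _ W1 _ sa1 _ _ _ _ _ _ _ _ _ _ _ hε rfl rfl rfl rfl rfl (G1 0)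
      (G1 1) c1
  · exact LL_cases pQ hQ S2 S1 _ W2 _ sa2 _ _ _ _ _ _ _ _ _ _ _ hε rfl rfl rfl rfl rfl (G2 0)
      (G2 1) c2

end Stmt2

end Paper
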